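/- A 4-connected graph G is W₆-minor-free if and only if G is isomorphic to one of the following graphs: C²ₙ for some 5 ≤ n ≤ 8, DW⁺₄, K₆ minus an edge, K₆, C²₇ + e, DW₅, K^{3,0}_{4,3}, K^{3,1}_{4,3}, K^{4,0}_{4,3}, Γ₁, or K^{4,1}_{4,3}. -/

import Mathlib

open SimpleGraph

/-- `H` is a minor of `G`: there is a family of nonempty, pairwise disjoint,
connected branch sets in `G`, one for each vertex of `H`, such that adjacent
vertices of `H` have branch sets joined by an edge of `G`. -/
def SimpleGraph.IsMinorOf {W V : Type*} (H : SimpleGraph W) (G : SimpleGraph V) : Prop :=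
  ∃ φ : W → Set V,
    (∀ w, (φ w).Nonempty) ∧
    (∀ w, (G.induce (φ w)).Connected) ∧
    (Pairwise fun w₁ w₂ => Disjoint (φ w₁) (φ w₂)) ∧
    (∀ ⦃w₁ w₂⦄, H.Adj w₁ w₂ → ∃ a ∈ φ w₁, ∃ b ∈ φ w₂, G.Adj a b)

/-- The wheel `Wₙ`: a hub (`none`) joined to every vertex of a cycle of length `n`. -/
def wheel (n : ℕ) : SimpleGraph (Option (ZMod n)) :=
  SimpleGraph.fromRel fun a b =>
    (a = none ∧ b ≠ none) ∨ (∃ i j : ZMod n, a = some i ∧ b = some j ∧ j = i + 1)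

/-- The square `C²ₙ` of the `n`-cycle. -/
def cycleSq (n : ℕ) : SimpleGraph (ZMod n) :=
  SimpleGraph.fromRel fun i j => j = i + 1 ∨ j = i + 2

/-- A graph is 4-connected if it has at least five vertices and deleting any set
of at most three vertices leaves it connected. -/
def FourConnected {V : Type*} (G : SimpleGraph V) : Prop :=
  5 ≤ Nat.card V ∧ ∀ S : Set V, S.ncard ≤ 3 → (G.induce Sᶜ).Connected

/-- The double wheel `DWₙ`: a cycle of length `n` plus two nonadjacent hubs,
each joined to every vertex of the cycle. -/
def doubleWheel (n : ℕ) : SimpleGraph (ZMod n ⊕ Fin 2) :=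
  SimpleGraph.fromRel fun a b =>
    match a, b with
    | .inl i, .inl j => j = i + 1
    | .inl _, .inr _ => True
    | .inr _, .inl _ => True
    | .inr _, .inr _ => False

/-- `DW⁺ₙ`: the double wheel together with the edge joining the two hubs. -/
def doubleWheelPlus (n : ℕ) : SimpleGraph (ZMod n ⊕ Fin 2) :=
  SimpleGraph.fromRel fun a b =>
    match a, b with
    | .inl i, .inl j => j = i + 1
    | _, _ => True

/-- The complete graph `K₆`. -/
def K6 : SimpleGraph (Fin 6) := ⊤

/-- `K₆` minus an edge. -/
def K6e : SimpleGraph (Fin 6) := (⊤ : SimpleGraph (Fin 6)).deleteEdges {s(0, 1)}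

/-- `C²₇ + e`: the square of the 7-cycle plus an edge between two (of the)
nonadjacent vertices (all such additions give isomorphic graphs). -/
def cycleSq7PlusE : SimpleGraph (ZMod 7) :=
  SimpleGraph.fromRel fun i j => j = i + 1 ∨ j = i + 2 ∨ (i = 0 ∧ j = 3)

/-- `K^{3,0}_{4,3}`: `K_{4,3}` plus three edges forming a path on the four
vertices of the part of size four. -/
def K43_30 : SimpleGraph (Fin 4 ⊕ Fin 3) :=
  SimpleGraph.fromRel fun a b =>
    match a, b with
    | .inl _, .inr _ => True
    | .inr _, .inl _ => True
    | .inl i, .inl j => (j : ℕ) = (i : ℕ) + 1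
    | .inr _, .inr _ => False

/-- `K^{3,1}_{4,3}`: `K^{3,0}_{4,3}` plus one edge between two vertices of
the part of size three. -/
def K43_31 : SimpleGraph (Fin 4 ⊕ Fin 3) :=
  SimpleGraph.fromRel fun a b =>
    match a, b with
    | .inl _, .inr _ => True
    | .inr _, .inl _ => True
    | .inl i, .inl j => (j : ℕ) = (i : ℕ) + 1
    | .inr i, .inr j => i = 0 ∧ j = 1

/-- `K^{4,0}_{4,3}`: `K_{4,3}` plus four edges forming a cycle on the four
vertices of the part of size four. -/
def K43_40 : SimpleGraph (Fin 4 ⊕ Fin 3) :=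
  SimpleGraph.fromRel fun a b =>
    match a, b with
    | .inl _, .inr _ => True
    | .inr _, .inl _ => True
    | .inl i, .inl j => j = i + 1
    | .inr _, .inr _ => False

/-- `K^{4,1}_{4,3}`: `K^{4,0}_{4,3}` plus one edge between two vertices of
the part of size three. -/
def K43_41 : SimpleGraph (Fin 4 ⊕ Fin 3) :=
  SimpleGraph.fromRel fun a b =>
    match a, b with
    | .inl _, .inr _ => True
    | .inr _, .inl _ => True
    | .inl i, .inl j => j = i + 1
    | .inr i, .inr j => i = 0 ∧ j = 1

/-- The graph `Γ₁` of Figure 1, with vertices `0 = x`, `1 = y`, `2 = v₂`,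
`3 = v₃`, `4 = v₄`, `5 = u`, `6 = w`. -/
def Gamma1 : SimpleGraph (Fin 7) :=
  SimpleGraph.fromEdgeSet
    {s(5, 6), s(5, 2), s(5, 3), s(5, 4), s(6, 2), s(6, 3), s(6, 4),
     s(2, 3), s(3, 4), s(0, 1), s(0, 2), s(0, 4), s(0, 5), s(1, 2), s(1, 4), s(1, 6)}


namespace SimpleGraph

variable {V : Type*} {G : SimpleGraph V}

section Connectivity

lemma conn_singleton (v : V) : (G.induce {v}).Connected := by
  have : Subsingleton ({v} : Set V) := inferInstance
  exact { preconnected := Preconnected.of_subsingleton, nonempty := ⟨⟨v, rfl⟩⟩ }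

lemma conn_insert {s : Set V} {v w : V} (hs : (G.induce s).Connected) (hw : w ∈ s)
    (h : G.Adj v w) : (G.induce (insert v s)).Connected := by
  rw [Set.insert_eq]
  exact connected_induce_union (conn_singleton v).preconnected hs.preconnected rfl hw h

lemma conn_pair {v w : V} (h : G.Adj v w) : (G.induce {v, w}).Connected :=
  induce_pair_connected_of_adj h

lemma conn_walk_subset {s : Set V} (u : V) (hu : u ∈ s)
    (h : ∀ v ∈ s, ∃ p : G.Walk u v, ∀ x ∈ p.support, x ∈ s) : (G.induce s).Connected := by
  refine induce_connected_of_patches u hu fun {v} hv => ?_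
  obtain ⟨p, hp⟩ := h v hv
  exact ⟨{x | x ∈ p.support}, hp, p.start_mem_support, p.end_mem_support,
    p.connected_induce_support.preconnected _ _⟩

/-- The set of vertices reachable from `v` by walks inside `s`. -/
def comp (G : SimpleGraph V) (s : Set V) (v : V) : Set V :=
  {w | ∃ p : G.Walk v w, ∀ x ∈ p.support, x ∈ s}

lemma mem_comp_self {s : Set V} {v : V} (hv : v ∈ s) : v ∈ G.comp s v :=
  ⟨Walk.nil, by simpa using hv⟩

lemma comp_subset {s : Set V} {v : V} : G.comp s v ⊆ s :=
  fun w ⟨p, hp⟩ => hp w p.end_mem_support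

lemma comp_closed {s : Set V} {v w u : V} (hw : w ∈ G.comp s v) (h : G.Adj w u) (hu : u ∈ s) :
    u ∈ G.comp s v := by
  obtain ⟨p, hp⟩ := hw
  refine ⟨p.concat h, fun x hx => ?_⟩
  rw [Walk.support_concat] at hx
  simp only [List.mem_append, List.mem_singleton] at hx
  rcases hx with hx | rfl
  · exact hp x hx
  · exact hu

lemma conn_comp {s : Set V} {v : V} (hv : v ∈ s) : (G.induce (G.comp s v)).Connected := by
  refine conn_walk_subset v (mem_comp_self hv) fun w ⟨p, hp⟩ => ⟨p, fun x hx => ?_⟩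
  classical
  exact ⟨p.takeUntil x hx, fun y hy => hp y (p.support_takeUntil_subset_support hx hy)⟩

/-- A closed nonempty part of a connected set is everything. -/
lemma mem_of_conn_closed {s A : Set V} (hs : (G.induce s).Connected)
    (hcl : ∀ a ∈ A, a ∈ s → ∀ b ∈ s, G.Adj a b → b ∈ A) {v w : V} (hv : v ∈ A) (hvs : v ∈ s)
    (hw : w ∈ s) : w ∈ A := by
  obtain ⟨p⟩ := hs.preconnected ⟨v, hvs⟩ ⟨w, hw⟩
  have key : ∀ (x y : s), (G.induce s).Walk x y → (x : V) ∈ A → (y : V) ∈ A := by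
    intro x y p
    induction p with
    | nil => exact id
    | cons h _ ih => exact fun hx => ih (hcl _ hx (Subtype.prop _) _ (Subtype.prop _) h)
  exact key _ _ p hv

lemma conn_of_closed {s : Set V} (hne : s.Nonempty)
    (h : ∀ A ⊆ s, A.Nonempty → (∀ a ∈ A, ∀ b ∈ s, G.Adj a b → b ∈ A) → A = s) :
    (G.induce s).Connected := by
  obtain ⟨v, hv⟩ := hne
  have := h (G.comp s v) comp_subset ⟨v, mem_comp_self hv⟩ fun a ha b hb hab =>
    comp_closed ha hab hb
  rw [← this]
  exact conn_comp hv

end Connectivity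

section Wheel

lemma wheel_isMinorOf (H : Set V) (A : Fin 6 → Set V) (hH : (G.induce H).Connected)
    (hA : ∀ i, (G.induce (A i)).Connected) (hHA : ∀ i, Disjoint H (A i))
    (hAA : Pairwise fun i j => Disjoint (A i) (A j))
    (hrim : ∀ i, ∃ a ∈ A i, ∃ b ∈ A (i + 1), G.Adj a b)
    (hhub : ∀ i, ∃ a ∈ H, ∃ b ∈ A i, G.Adj a b) : (wheel 6).IsMinorOf G := by
  have hne : ∀ {s : Set V}, (G.induce s).Connected → s.Nonempty := fun h =>
    Set.nonempty_coe_sort.mp h.nonempty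
  refine ⟨fun w => Option.elim w H A, ?_, ?_, ?_, ?_⟩
  · rintro (_ | i)
    exacts [hne hH, hne (hA i)]
  · rintro (_ | i)
    exacts [hH, hA i]
  · rintro (_ | i) (_ | j) hij
    · exact absurd rfl hij
    · exact hHA j
    · exact (hHA i).symm
    · exact hAA fun h => hij (congrArg some h)
  · intro w₁ w₂ h
    simp only [wheel, fromRel_adj] at h
    have hsymm : ∀ {s t : Set V}, (∃ a ∈ s, ∃ b ∈ t, G.Adj a b) → ∃ a ∈ t, ∃ b ∈ s, G.Adj a b :=
      fun ⟨a, ha, b, hb, hab⟩ => ⟨b, hb, a, ha, hab.symm⟩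
    obtain ⟨-, (⟨rfl, h⟩ | ⟨i, j, rfl, rfl, rfl⟩) | (⟨rfl, h⟩ | ⟨i, j, rfl, rfl, rfl⟩)⟩ := h
    · obtain ⟨i, rfl⟩ := Option.ne_none_iff_exists'.mp h
      exact hhub i
    · exact hrim i
    · obtain ⟨i, rfl⟩ := Option.ne_none_iff_exists'.mp h
      exact hsymm (hhub i)
    · exact hsymm (hrim i)

/-- A wheel minor whose rim consists of five single vertices and one connected set. -/
lemma wheel_isMinorOf_of_rim (H Z : Set V) (r₀ r₁ r₂ r₃ r₄ : V) (hH : (G.induce H).Connected)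
    (hZ : (G.induce Z).Connected) (hnd : [r₀, r₁, r₂, r₃, r₄].Nodup)
    (hrH : ∀ r ∈ [r₀, r₁, r₂, r₃, r₄], r ∉ H) (hrZ : ∀ r ∈ [r₀, r₁, r₂, r₃, r₄], r ∉ Z)
    (hHZ : Disjoint H Z) (hhub : ∀ r ∈ [r₀, r₁, r₂, r₃, r₄], ∃ h ∈ H, G.Adj h r)
    (hhubZ : ∃ h ∈ H, ∃ z ∈ Z, G.Adj h z) (h₀ : G.Adj r₀ r₁) (h₁ : G.Adj r₁ r₂)
    (h₂ : G.Adj r₂ r₃) (h₃ : G.Adj r₃ r₄) (h₄ : ∃ z ∈ Z, G.Adj r₄ z)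
    (h₅ : ∃ z ∈ Z, G.Adj z r₀) : (wheel 6).IsMinorOf G := by
  refine wheel_isMinorOf H ![{r₀}, {r₁}, {r₂}, {r₃}, {r₄}, Z] hH ?_ ?_ ?_ ?_ ?_
  · intro i
    fin_cases i
    exacts [conn_singleton _, conn_singleton _, conn_singleton _, conn_singleton _,
      conn_singleton _, hZ]
  · intro i
    fin_cases i <;> simp_all
  · intro i j hij
    fin_cases i <;> fin_cases j <;> simp_all [eq_comm]
  · intro i
    fin_cases i <;> simp_all
  · intro i
    fin_cases i <;> simp_all

end Wheel

section FourConnected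

lemma _root_.FourConnected.finite {V : Type*} {G : SimpleGraph V} (h : FourConnected G) :
    Finite V :=
  Nat.finite_of_card_ne_zero (by have := h.1; omega)

/-- In a 4-connected graph, a set with a nonempty part outside its closed neighbourhood has at
least four outside neighbours. -/
lemma _root_.FourConnected.four_le {V : Type*} {G : SimpleGraph V} (h : FourConnected G)
    {Q R : Finset V} (hQ : Q.Nonempty) (hQR : Disjoint Q R)
    (hN : ∀ q ∈ Q, ∀ v, G.Adj q v → v ∈ Q ∨ v ∈ R) {w : V} (hwQ : w ∉ Q) (hwR : w ∉ R) :
    4 ≤ R.card := by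
  by_contra hlt
  obtain ⟨q, hq⟩ := hQ
  have hc := h.2 (R : Set V) (by rw [Set.ncard_coe_finset]; omega)
  refine hwQ (mem_of_conn_closed (A := (Q : Set V)) hc ?_ hq ?_ (by simpa using hwR))
  · intro a ha _ b hb hab
    exact (hN a ha b hab).resolve_right (by simpa using hb)
  · simpa using Finset.disjoint_left.mp hQR hq

lemma _root_.FourConnected.false_of_three {V : Type*} {G : SimpleGraph V} (h : FourConnected G)
    (Q : Finset V) (a b c : V) (hQ : Q.Nonempty)
    (hN : ∀ q ∈ Q, ∀ v, G.Adj q v → v ∈ Q ∨ v = a ∨ v = b ∨ v = c)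
    (hcard : Q.card + 3 < Nat.card V) : False := by
  classical
  have := h.finite
  have := Fintype.ofFinite V
  have h3 : (({a, b, c} : Finset V) \ Q).card ≤ 3 :=
    (Finset.card_le_card Finset.sdiff_subset).trans Finset.card_le_three
  obtain ⟨w, hw⟩ : ∃ w, w ∉ Q ∪ (({a, b, c} : Finset V) \ Q) := by
    by_contra! hall
    have := Finset.card_le_card (fun x _ => hall x : (Finset.univ : Finset V) ⊆ _)
    have := Finset.card_union_le Q (({a, b, c} : Finset V) \ Q)
    rw [Finset.card_univ, ← Nat.card_eq_fintype_card] at *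
    omega
  simp only [Finset.mem_union, not_or] at hw
  have := h.four_le (R := ({a, b, c} : Finset V) \ Q) hQ Finset.disjoint_sdiff (fun q hq v hv => by
    by_cases hvQ : v ∈ Q
    · exact Or.inl hvQ
    · exact Or.inr (by simpa [hvQ] using hN q hq v hv)) hw.1 hw.2
  omega

lemma fourConnected_of_four_le (hcard : 5 ≤ Nat.card V)
    (h : ∀ Q R : Set V, Q.Nonempty → Disjoint Q R → R.ncard ≤ 3 →
      (∀ q ∈ Q, ∀ v, G.Adj q v → v ∈ Q ∨ v ∈ R) → ∀ w, w ∉ Q → w ∈ R) : FourConnected G := by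
  refine ⟨hcard, fun S hS => conn_of_closed ?_ ?_⟩
  · by_contra hne
    rw [Set.not_nonempty_iff_eq_empty, Set.compl_empty_iff] at hne
    rw [hne, Set.ncard_univ] at hS
    omega
  · intro A hA hne hcl
    refine Set.Subset.antisymm hA fun w hw => ?_
    by_contra hwA
    refine hw (h A S hne ?_ hS ?_ w hwA)
    · exact Set.disjoint_left.mpr fun a ha => hA ha
    · intro q hq v hv
      by_cases hvS : v ∈ S
      · exact Or.inr hvS
      · exact Or.inl (hcl q hq v hvS hv)

end FourConnected

end SimpleGraph

namespace SimpleGraph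

variable {V : Type*} {G : SimpleGraph V}

/-- The three finsets partition the vertex type (parts may be empty). -/
structure IsTripartition (A T B : Finset V) : Prop where
  cover : ∀ v, v ∈ A ∨ v ∈ T ∨ v ∈ B
  left : ∀ v ∈ A, v ∉ T
  right : ∀ v ∈ B, v ∉ T
  sides : ∀ v ∈ A, v ∉ B

/-- `T` is a set of four vertices separating the nonempty sides `A` and `B`. -/
structure IsFourCut (G : SimpleGraph V) (A T B : Finset V) : Prop extends
    IsTripartition A T B where
  not_adj : ∀ a ∈ A, ∀ b ∈ B, ¬ G.Adj a b
  card_eq : T.card = 4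
  left_nonempty : A.Nonempty
  right_nonempty : B.Nonempty

lemma IsTripartition.symm {A T B : Finset V} (h : IsTripartition A T B) :
    IsTripartition B T A :=
  ⟨fun v => by have := h.cover v; tauto, h.right, h.left, fun v hv hv' => h.sides v hv' hv⟩

lemma IsFourCut.symm {A T B : Finset V} (h : IsFourCut G A T B) : IsFourCut G B T A :=
  ⟨h.toIsTripartition.symm, fun a ha b hb hab => h.not_adj b hb a ha hab.symm, h.card_eq,
    h.right_nonempty, h.left_nonempty⟩

variable [DecidableEq V]

lemma IsTripartition.card_inter {A T B : Finset V} (h : IsTripartition A T B) (S : Finset V) :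
    S.card = (S ∩ A).card + (S ∩ T).card + (S ∩ B).card := by
  rw [← Finset.card_union_of_disjoint, ← Finset.card_union_of_disjoint]
  · congr 1
    ext v
    have := h.cover v
    simp only [Finset.mem_union, Finset.mem_inter]
    tauto
  · rw [Finset.disjoint_left]
    intro v hv hv'
    have := h.sides v
    have := h.right v
    simp only [Finset.mem_union, Finset.mem_inter] at hv hv'
    tauto
  · rw [Finset.disjoint_left]
    intro v hv hv'
    have := h.left v
    simp only [Finset.mem_inter] at hv hv'
    tauto

lemma _root_.FourConnected.corner (hG : FourConnected G) {A T B A' T' B' : Finset V}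
    (h : IsTripartition A T B) (h' : IsTripartition A' T' B')
    (hadj : ∀ q ∈ A ∩ A', ∀ v, G.Adj q v → v ∉ B ∧ v ∉ B') (hne : (A ∩ A').Nonempty)
    (hB : B.Nonempty) : 4 ≤ (A ∩ T').card + (T ∩ T').card + (T ∩ A').card := by
  obtain ⟨w, hw⟩ := hB
  have h4 := hG.four_le (Q := A ∩ A') (R := (A ∩ T') ∪ (T ∩ T') ∪ (T ∩ A')) (w := w) hne
    (by
      rw [Finset.disjoint_left]
      intro v hv hv'
      have := h.left v
      have := h'.left v
      simp only [Finset.mem_union, Finset.mem_inter] at hv hv'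
      tauto)
    (by
      intro q hq v hqv
      have := hadj q hq v hqv
      have := h.cover v
      have := h'.cover v
      simp only [Finset.mem_union, Finset.mem_inter]
      tauto)
    (by
      have := h.sides w
      simp only [Finset.mem_inter]
      tauto)
    (by
      have := h.sides w
      have := h.right w
      simp only [Finset.mem_union, Finset.mem_inter]
      tauto)
  have := Finset.card_union_le (A ∩ T' ∪ T ∩ T') (T ∩ A')
  have := Finset.card_union_le (A ∩ T') (T ∩ T')
  omega

lemma _root_.FourConnected.corner_erase (hG : FourConnected G) {A T B A' T' B' : Finset V}
    (h : IsTripartition A T B) (h' : IsTripartition A' T' B')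
    (hadj : ∀ q ∈ A ∩ A', ∀ v, G.Adj q v → v ∉ B ∧ v ∉ B') (hne : (A ∩ A').Nonempty)
    (hB : B.Nonempty) {x : V} (hx : x ∈ T ∩ T') (hxQ : ∀ q ∈ A ∩ A', ¬ G.Adj q x) :
    5 ≤ (A ∩ T').card + (T ∩ T').card + (T ∩ A').card := by
  obtain ⟨w, hw⟩ := hB
  have h4 := hG.four_le (Q := A ∩ A') (R := (A ∩ T') ∪ (T ∩ T').erase x ∪ (T ∩ A')) (w := w) hne
    (by
      rw [Finset.disjoint_left]
      intro v hv hv'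
      have := h.left v
      have := h'.left v
      simp only [Finset.mem_union, Finset.mem_inter, Finset.mem_erase] at hv hv'
      tauto)
    (by
      intro q hq v hqv
      have := hadj q hq v hqv
      have := h.cover v
      have := h'.cover v
      have : v ≠ x := by rintro rfl; exact hxQ q hq hqv
      simp only [Finset.mem_union, Finset.mem_inter, Finset.mem_erase]
      tauto)
    (by
      have := h.sides w
      simp only [Finset.mem_inter]
      tauto)
    (by
      have := h.sides w
      have := h.right w
      simp only [Finset.mem_union, Finset.mem_inter, Finset.mem_erase]
      tauto)
  have := Finset.card_union_le (A ∩ T' ∪ (T ∩ T').erase x) (T ∩ A')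
  have := Finset.card_union_le (A ∩ T') ((T ∩ T').erase x)
  have := Finset.card_erase_add_one hx
  omega

lemma IsFourCut.exists_adj_left (hG : FourConnected G) {A T B : Finset V} (h : IsFourCut G A T B)
    {t : V} (ht : t ∈ T) : ∃ a ∈ A, G.Adj t a := by
  by_contra! hno
  obtain ⟨w, hw⟩ := h.right_nonempty
  have h4 := hG.four_le (Q := A) (R := T.erase t) (w := w) h.left_nonempty
    (Finset.disjoint_left.mpr fun v hv hv' => h.left v hv (Finset.mem_of_mem_erase hv'))
    (by
      intro q hq v hqv
      have h1 := h.cover v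
      have h2 := h.not_adj q hq v
      have : v ≠ t := by rintro rfl; exact hno q hq hqv.symm
      simp only [Finset.mem_erase]
      tauto)
    (fun hA => h.sides w hA hw) (fun hT => h.right w hw (Finset.mem_of_mem_erase hT))
  rw [Finset.card_erase_of_mem ht, h.card_eq] at h4
  omega

lemma IsFourCut.exists_adj_right (hG : FourConnected G) {A T B : Finset V}
    (h : IsFourCut G A T B) {t : V} (ht : t ∈ T) : ∃ b ∈ B, G.Adj t b :=
  h.symm.exists_adj_left hG ht

variable [Fintype V] [DecidableRel G.Adj]

lemma _root_.FourConnected.four_le_degree (hG : FourConnected G) (hn : 6 ≤ Fintype.card V) (v : V) :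
    4 ≤ G.degree v := by
  by_contra hlt
  obtain ⟨w, hw⟩ : ∃ w, w ∉ insert v (G.neighborFinset v) := by
    by_contra! hall
    have h1 := Finset.card_le_card (fun x _ => hall x : (Finset.univ : Finset V) ⊆ _)
    have h2 := Finset.card_insert_le v (G.neighborFinset v)
    rw [card_neighborFinset_eq_degree] at h2
    rw [Finset.card_univ] at h1
    omega
  rw [Finset.mem_insert, not_or] at hw
  have := hG.four_le (Q := {v}) (R := G.neighborFinset v) (w := w) (by simp) (by simp)
    (fun q hq v hv => Or.inr (by simpa [Finset.mem_singleton.mp hq] using hv))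
    (by simpa using hw.1) hw.2
  rw [card_neighborFinset_eq_degree] at this
  omega

/-- A vertex all of whose neighbours lie in a four-element set is adjacent to all of that set. -/
lemma _root_.FourConnected.adj_iff_of_subset (hG : FourConnected G) (hn : 6 ≤ Fintype.card V) {v : V}
    {T : Finset V} (hT : T.card ≤ 4) (h : ∀ w, G.Adj v w → w ∈ T) (w : V) :
    G.Adj v w ↔ w ∈ T := by
  have h1 : G.neighborFinset v ⊆ T := fun w hw => h w (by simpa using hw)
  have h2 := hG.four_le_degree hn v
  rw [← card_neighborFinset_eq_degree] at h2
  have := Finset.eq_of_subset_of_card_le h1 (by omega)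
  rw [← this, mem_neighborFinset]

lemma _root_.FourConnected.degree_eq_four_of_subset (hG : FourConnected G) (hn : 6 ≤ Fintype.card V)
    {v : V} {T : Finset V} (hT : T.card ≤ 4) (h : ∀ w, G.Adj v w → w ∈ T) :
    G.degree v = 4 := by
  have h1 : G.neighborFinset v ⊆ T := fun w hw => h w (by simpa using hw)
  have h2 := hG.four_le_degree hn v
  have := Finset.card_le_card h1
  rw [card_neighborFinset_eq_degree] at this
  omega

end SimpleGraph

namespace SimpleGraph

variable {V : Type*} {G : SimpleGraph V} [DecidableEq V]

lemma exists_eq_pair_of_mem {s : Finset V} {a : V} (hs : s.card = 2) (ha : a ∈ s) :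
    ∃ b, b ≠ a ∧ s = {a, b} := by
  have h1 : (s.erase a).card = 1 := by rw [Finset.card_erase_of_mem ha, hs]
  obtain ⟨b, hb⟩ := Finset.card_eq_one.mp h1
  refine ⟨b, Finset.ne_of_mem_erase (hb ▸ Finset.mem_singleton_self b), ?_⟩
  rw [← Finset.insert_erase ha, hb]

variable [Fintype V] [DecidableRel G.Adj]

/-- A 4-connected graph on at least nine vertices in which no edge can be contracted or deleted
without destroying 4-connectedness, in terms of separations. -/
structure IsMinorCritical (G : SimpleGraph V) : Prop where
  conn : FourConnected G
  card : 9 ≤ Fintype.card V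
  cut : ∀ x y, G.Adj x y → ∃ A T B, IsFourCut G A T B ∧ x ∈ T ∧ y ∈ T
  del : ∀ x y, G.Adj x y → ∃ X S Y : Finset V, IsTripartition X S Y ∧ S.card ≤ 3 ∧ x ∈ X ∧ y ∈ Y ∧
    ∀ a ∈ X, ∀ b ∈ Y, G.Adj a b → a = x ∧ b = y

/-- The edge `xy` lies in a triangle with a vertex of degree four. -/
def IsTrivialEdge (G : SimpleGraph V) [DecidableRel G.Adj] (x y : V) : Prop :=
  ∃ d, G.degree d = 4 ∧ G.Adj d x ∧ G.Adj d y

omit [DecidableEq V] in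
lemma IsTrivialEdge.symm {x y : V} (h : IsTrivialEdge G x y) : IsTrivialEdge G y x :=
  let ⟨d, h₁, h₂, h₃⟩ := h
  ⟨d, h₁, h₃, h₂⟩

lemma IsFourCut.two_le_left (hG : FourConnected G) (hn : 6 ≤ Fintype.card V) {A T B : Finset V}
    (h : IsFourCut G A T B) {x y : V} (hx : x ∈ T) (hy : y ∈ T) (hxy : ¬ IsTrivialEdge G x y) :
    2 ≤ A.card := by
  by_contra hlt
  have h1 := h.left_nonempty.card_pos
  obtain ⟨d, rfl⟩ := Finset.card_eq_one.mp (show A.card = 1 by omega)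
  have hsub : ∀ w, G.Adj d w → w ∈ T := by
    intro w hw
    rcases h.cover w with h2 | h2 | h2
    · exact absurd (Finset.mem_singleton.mp h2) hw.ne'
    · exact h2
    · exact absurd hw (h.not_adj d (by simp) w h2)
  have hiff := hG.adj_iff_of_subset hn h.card_eq.le hsub
  exact hxy ⟨d, hG.degree_eq_four_of_subset hn h.card_eq.le hsub, (hiff x).mpr hx, (hiff y).mpr hy⟩

lemma IsMinorCritical.degree_eq_four_or (hG : IsMinorCritical G) {x y : V} (hxy : G.Adj x y)
    (hnt : ¬ IsTrivialEdge G x y) : G.degree x = 4 ∨ G.degree y = 4 := by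
  obtain ⟨A, T, B, hT, hxT, hyT⟩ := hG.cut x y hxy
  obtain ⟨X, S, Y, hS, hS3, hxX, hyY, hXY⟩ := hG.del x y hxy
  have hn : 6 ≤ Fintype.card V := by have := hG.card; omega
  have hA := hT.two_le_left hG.conn hn hxT hyT hnt
  have hB := hT.symm.two_le_left hG.conn hn hxT hyT hnt
  have hXY' : ∀ {C D : Finset V}, IsFourCut G C T D → ∀ q ∈ C ∩ X, ∀ v, G.Adj q v →
      v ∉ D ∧ v ∉ Y := by
    intro C D hC q hq v hqv
    rw [Finset.mem_inter] at hq
    refine ⟨fun hv => hC.not_adj q hq.1 v hv hqv, fun hv => ?_⟩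
    have := (hXY q hq.2 v hv hqv).1
    subst this
    exact hC.left q hq.1 hxT
  have hYX' : ∀ {C D : Finset V}, IsFourCut G C T D → ∀ q ∈ C ∩ Y, ∀ v, G.Adj q v →
      v ∉ D ∧ v ∉ X := by
    intro C D hC q hq v hqv
    rw [Finset.mem_inter] at hq
    refine ⟨fun hv => hC.not_adj q hq.1 v hv hqv, fun hv => ?_⟩
    have := (hXY v hv q hq.2 hqv.symm).2
    subst this
    exact hC.left q hq.1 hyT
  have e1 := hS.card_inter T
  have e2 := hT.card_inter S
  have e3 := hS.card_inter A
  have e4 := hS.card_inter B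
  have e5 := hT.card_inter X
  have e6 := hT.card_inter Y
  have p1 : 0 < (T ∩ X).card := Finset.card_pos.mpr ⟨x, by simp [*]⟩
  have p2 : 0 < (T ∩ Y).card := Finset.card_pos.mpr ⟨y, by simp [*]⟩
  have c1 := fun h => hG.conn.corner hT.toIsTripartition hS (hXY' hT) (Finset.card_pos.mp h)
    hT.right_nonempty
  have c2 := fun h => hG.conn.corner hT.toIsTripartition hS.symm (hYX' hT) (Finset.card_pos.mp h)
    hT.right_nonempty
  have c3 := fun h => hG.conn.corner hT.symm.toIsTripartition hS (hXY' hT.symm)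
    (Finset.card_pos.mp h) hT.left_nonempty
  have c4 := fun h => hG.conn.corner hT.symm.toIsTripartition hS.symm (hYX' hT.symm)
    (Finset.card_pos.mp h) hT.left_nonempty
  have hT4 := hT.card_eq
  have key : X.card = 1 ∨ Y.card = 1 := by
    simp only [Finset.inter_comm S, Finset.inter_comm X, Finset.inter_comm Y] at *
    omega
  have fin : ∀ {X S Y : Finset V} {x y : V}, IsTripartition X S Y → S.card ≤ 3 → x ∈ X →
      (∀ a ∈ X, ∀ b ∈ Y, G.Adj a b → a = x ∧ b = y) → X.card = 1 → G.degree x = 4 := by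
    intro X S Y x y hS hS3 hx hXY h1
    obtain ⟨x', rfl⟩ := Finset.card_eq_one.mp h1
    obtain rfl := Finset.mem_singleton.mp hx
    refine hG.conn.degree_eq_four_of_subset hn (T := insert y S)
      ((Finset.card_insert_le _ _).trans (by omega)) fun w hw => ?_
    rcases hS.cover w with h2 | h2 | h2
    · exact absurd (Finset.mem_singleton.mp h2) hw.ne'
    · exact Finset.mem_insert_of_mem h2
    · rw [(hXY _ hx w h2 hw).2]
      exact Finset.mem_insert_self _ _
  rcases key with h1 | h1
  · exact Or.inl (fin hS hS3 hxX hXY h1)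
  · exact Or.inr (fin hS.symm hS3 hyY (fun a ha b hb hab => (hXY b hb a ha hab.symm).symm) h1)

set_option maxHeartbeats 800000 in
lemma IsMinorCritical.card_eq_two_or (hG : IsMinorCritical G) {A T B : Finset V}
    (h : IsFourCut G A T B) {x z : V} (hx : x ∈ T) (hA : 2 ≤ A.card) (hB : 2 ≤ B.card)
    (hz : z ∈ A) (hxz : G.Adj x z) (huniq : ∀ v ∈ A, G.Adj x v → v = z) :
    A.card = 2 ∨ ∃ i ∈ T, i ≠ x ∧ ∃ w ∈ A, ∃ r ∈ B, w ≠ z ∧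
      ∀ v, G.Adj i v ↔ v = x ∨ v = z ∨ v = w ∨ v = r := by
  have hn : 6 ≤ Fintype.card V := by have := hG.card; omega
  obtain ⟨A', T', B', h', hxT', hzT'⟩ := hG.cut x z hxz
  have hadj : ∀ {C D C' D' : Finset V}, IsFourCut G C T D → IsFourCut G C' T' D' →
      ∀ q ∈ C ∩ C', ∀ v, G.Adj q v → v ∉ D ∧ v ∉ D' := by
    intro C D C' D' hC hC' q hq v hqv
    rw [Finset.mem_inter] at hq
    exact ⟨fun hv => hC.not_adj q hq.1 v hv hqv, fun hv => hC'.not_adj q hq.2 v hv hqv⟩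
  have hxQ : ∀ {C' D' : Finset V}, IsFourCut G C' T' D' → ∀ q ∈ A ∩ C', ¬ G.Adj q x := by
    intro C' D' hC q hq hqx
    rw [Finset.mem_inter] at hq
    obtain rfl := huniq q hq.1 hqx.symm
    exact hC.left q hq.2 hzT'
  have hxx : x ∈ T ∩ T' := by simp [*]
  have e1 := h'.card_inter T
  have e2 := h.card_inter T'
  have e3 := h'.card_inter A
  have e4 := h'.card_inter B
  have e5 := h.card_inter A'
  have e6 := h.card_inter B'
  have p1 : 0 < (T ∩ T').card := Finset.card_pos.mpr ⟨x, hxx⟩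
  have p2 : 0 < (A ∩ T').card := Finset.card_pos.mpr ⟨z, by simp [*]⟩
  have p3 := h'.left_nonempty.card_pos
  have p4 := h'.right_nonempty.card_pos
  have c1 := fun hp => hG.conn.corner_erase h.toIsTripartition h'.toIsTripartition (hadj h h')
    (Finset.card_pos.mp hp) h.right_nonempty hxx (hxQ h')
  have c2 := fun hp => hG.conn.corner_erase h.toIsTripartition h'.symm.toIsTripartition
    (hadj h h'.symm) (Finset.card_pos.mp hp) h.right_nonempty hxx (hxQ h'.symm)
  have c3 := fun hp => hG.conn.corner h.symm.toIsTripartition h'.toIsTripartition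
    (hadj h.symm h') (Finset.card_pos.mp hp) h.left_nonempty
  have c4 := fun hp => hG.conn.corner h.symm.toIsTripartition h'.symm.toIsTripartition
    (hadj h.symm h'.symm) (Finset.card_pos.mp hp) h.left_nonempty
  have hb : ∀ {C' D' : Finset V}, IsFourCut G C' T' D' → (B ∩ C').card = 0 →
      (A ∩ C').card = 0 → 0 < (B ∩ T').card := by
    intro C' D' hC' hBC hAC
    obtain ⟨i, hi⟩ := hC'.left_nonempty
    rw [Finset.card_eq_zero] at hBC hAC
    have hiT : i ∈ T := by
      rcases h.cover i with h1 | h1 | h1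
      · have := hAC ▸ Finset.mem_inter.mpr ⟨h1, hi⟩
        simp at this
      · exact h1
      · have := hBC ▸ Finset.mem_inter.mpr ⟨h1, hi⟩
        simp at this
    obtain ⟨b, hbB, hib⟩ := h.exists_adj_right hG.conn hiT
    refine Finset.card_pos.mpr ⟨b, Finset.mem_inter.mpr ⟨hbB, ?_⟩⟩
    rcases hC'.cover b with h1 | h1 | h1
    · have := hBC ▸ Finset.mem_inter.mpr ⟨hbB, h1⟩
      simp at this
    · exact h1
    · exact absurd hib (hC'.not_adj i hi b h1)
  have hb1 := hb h'
  have hb2 := hb h'.symm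
  have hT4 := h.card_eq
  have hT4' := h'.card_eq
  have key : A.card = 2 ∨ (A ∩ T').card = 2 ∧ (B ∩ T').card = 1 ∧ (T ∩ T').card = 1 ∧
      (A'.card = 1 ∧ (T ∩ A').card = 1 ∨ B'.card = 1 ∧ (T ∩ B').card = 1) := by
    clear hadj hxQ hb huniq
    simp only [Finset.inter_comm T', Finset.inter_comm A', Finset.inter_comm B'] at *
    omega
  have fin : ∀ {A' B' : Finset V}, IsFourCut G A' T' B' → (A ∩ T').card = 2 →
      (B ∩ T').card = 1 → (T ∩ T').card = 1 → A'.card = 1 → (T ∩ A').card = 1 →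
      ∃ i ∈ T, i ≠ x ∧ ∃ w ∈ A, ∃ r ∈ B, w ≠ z ∧
        ∀ v, G.Adj i v ↔ v = x ∨ v = z ∨ v = w ∨ v = r := by
    intro A' B' h' q1 q2 q3 q4 q5
    obtain ⟨i, rfl⟩ := Finset.card_eq_one.mp q4
    obtain ⟨w, hwz, hw⟩ := exists_eq_pair_of_mem q1 (Finset.mem_inter.mpr ⟨hz, hzT'⟩)
    obtain ⟨r, hr⟩ := Finset.card_eq_one.mp q2
    obtain ⟨x', hx'⟩ := Finset.card_eq_one.mp q3
    obtain rfl : x = x' := by rw [hx'] at hxx; simpa using hxx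
    have hiT : i ∈ T := by
      obtain ⟨j, hj⟩ := Finset.card_pos.mp (q5.symm ▸ Nat.one_pos)
      simp only [Finset.mem_inter, Finset.mem_singleton] at hj
      exact hj.2 ▸ hj.1
    have hwA : w ∈ A ∩ T' := by simp [hw]
    have hrB : r ∈ B ∩ T' := by simp [hr]
    refine ⟨i, hiT, ?_, w, (Finset.mem_inter.mp hwA).1, r, (Finset.mem_inter.mp hrB).1, hwz, ?_⟩
    · rintro rfl
      exact h'.left i (by simp) hxT'
    · have hiff := hG.conn.adj_iff_of_subset hn (v := i) h'.card_eq.le (fun w hw => by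
        rcases h'.cover w with h2 | h2 | h2
        · exact absurd (Finset.mem_singleton.mp h2) hw.ne'
        · exact h2
        · exact absurd hw (h'.not_adj i (by simp) w h2))
      intro v
      rw [hiff]
      have m1 : v ∈ A ∩ T' ↔ v = z ∨ v = w := by simp [hw]
      have m2 : v ∈ B ∩ T' ↔ v = r := by simp [hr]
      have m3 : v ∈ T ∩ T' ↔ v = x := by simp [hx']
      have := h.cover v
      simp only [Finset.mem_inter] at m1 m2 m3
      clear * - m1 m2 m3 this
      tauto
  rcases key with h1 | ⟨q1, q2, q3, ⟨q4, q5⟩ | ⟨q4, q5⟩⟩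
  · exact Or.inl h1
  · exact Or.inr (fin h' q1 q2 q3 q4 q5)
  · exact Or.inr (fin h'.symm q1 q2 q3 q4 q5)

end SimpleGraph

section Finset

variable {V : Type*} [DecidableEq V]

lemma Finset.exists_two_of_card_eq_four {s : Finset V} (hs : s.card = 4) {a b : V} (ha : a ∈ s)
    (hb : b ∈ s) (hab : a ≠ b) : ∃ c d, c ≠ a ∧ c ≠ b ∧ d ≠ a ∧ d ≠ b ∧ d ≠ c ∧
      ∀ v, v ∈ s ↔ v = a ∨ v = b ∨ v = c ∨ v = d := by
  have h1 : ((s.erase a).erase b).card = 2 := by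
    rw [Finset.card_erase_of_mem (by simp [hb, hab.symm]), Finset.card_erase_of_mem ha, hs]
  obtain ⟨c, d, hcd, h⟩ := Finset.card_eq_two.mp h1
  have h' : ∀ v, v ∈ (s.erase a).erase b ↔ v = c ∨ v = d := by simp [h]
  simp only [Finset.mem_erase] at h'
  exact ⟨c, d, by grind⟩

lemma Finset.exists_fourth_of_card_eq_four {s : Finset V} (hs : s.card = 4) {a b c : V}
    (ha : a ∈ s) (hb : b ∈ s) (hc : c ∈ s) (hab : a ≠ b) (hac : a ≠ c) (hbc : b ≠ c) :
    ∃ d, d ≠ a ∧ d ≠ b ∧ d ≠ c ∧ ∀ v, v ∈ s ↔ v = a ∨ v = b ∨ v = c ∨ v = d := by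
  obtain ⟨c', d, h⟩ := Finset.exists_two_of_card_eq_four hs ha hb hab
  have := (h.2.2.2.2.2 c).mp hc
  rcases eq_or_ne c c' with rfl | hcc
  · exact ⟨d, by grind⟩
  · exact ⟨c', by grind⟩

lemma Finset.eq_four_of_card_eq_four {s : Finset V} (hs : s.card = 4) {a b c d : V}
    (ha : a ∈ s) (hb : b ∈ s) (hc : c ∈ s) (hd : d ∈ s) (hab : a ≠ b) (hac : a ≠ c)
    (had : a ≠ d) (hbc : b ≠ c) (hbd : b ≠ d) (hcd : c ≠ d) (v : V) :
    v ∈ s ↔ v = a ∨ v = b ∨ v = c ∨ v = d := by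
  obtain ⟨d', h⟩ := Finset.exists_fourth_of_card_eq_four hs ha hb hc hab hac hbc
  have := (h.2.2.2 d).mp hd
  grind

end Finset

namespace SimpleGraph

variable {V : Type*} {G : SimpleGraph V} [DecidableEq V] [Fintype V] [DecidableRel G.Adj]

lemma exists_two_nbrs {v a b : V} (hv : G.degree v = 4) (ha : G.Adj v a) (hb : G.Adj v b)
    (hab : a ≠ b) : ∃ c d, c ≠ a ∧ c ≠ b ∧ d ≠ a ∧ d ≠ b ∧ d ≠ c ∧
      ∀ w, G.Adj v w ↔ w = a ∨ w = b ∨ w = c ∨ w = d := by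
  simpa using Finset.exists_two_of_card_eq_four (hv : (G.neighborFinset v).card = 4)
    (by simpa using ha) (by simpa using hb) hab

lemma exists_fourth_nbr {v a b c : V} (hv : G.degree v = 4) (ha : G.Adj v a) (hb : G.Adj v b)
    (hc : G.Adj v c) (hab : a ≠ b) (hac : a ≠ c) (hbc : b ≠ c) :
    ∃ d, d ≠ a ∧ d ≠ b ∧ d ≠ c ∧ ∀ w, G.Adj v w ↔ w = a ∨ w = b ∨ w = c ∨ w = d := by
  simpa using Finset.exists_fourth_of_card_eq_four (hv : (G.neighborFinset v).card = 4)
    (by simpa using ha) (by simpa using hb) (by simpa using hc) hab hac hbc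

lemma nbrs_eq {v a b c d : V} (hv : G.degree v = 4) (ha : G.Adj v a) (hb : G.Adj v b)
    (hc : G.Adj v c) (hd : G.Adj v d) (hab : a ≠ b) (hac : a ≠ c) (had : a ≠ d) (hbc : b ≠ c)
    (hbd : b ≠ d) (hcd : c ≠ d) (w : V) : G.Adj v w ↔ w = a ∨ w = b ∨ w = c ∨ w = d := by
  simpa using Finset.eq_four_of_card_eq_four (hv : (G.neighborFinset v).card = 4)
    (by simpa using ha) (by simpa using hb) (by simpa using hc) (by simpa using hd)
    hab hac had hbc hbd hcd w

lemma IsMinorCritical.nbrs_of_subset (hG : IsMinorCritical G) {v a b c d : V}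
    (h : ∀ w, G.Adj v w → w = a ∨ w = b ∨ w = c ∨ w = d) :
    G.degree v = 4 ∧ ∀ w, G.Adj v w ↔ w = a ∨ w = b ∨ w = c ∨ w = d := by
  have hn : 6 ≤ Fintype.card V := by have := hG.card; omega
  have h' : ∀ w, G.Adj v w → w ∈ ({a, b, c, d} : Finset V) := by simpa using h
  refine ⟨hG.conn.degree_eq_four_of_subset hn Finset.card_le_four h', ?_⟩
  simpa using hG.conn.adj_iff_of_subset hn Finset.card_le_four h'

lemma IsMinorCritical.distinct_nbrs (hG : IsMinorCritical G) {v a b c d : V}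
    (h : ∀ w, G.Adj v w ↔ w = a ∨ w = b ∨ w = c ∨ w = d) :
    a ≠ b ∧ a ≠ c ∧ a ≠ d ∧ b ≠ c ∧ b ≠ d ∧ c ≠ d := by
  have hn : 6 ≤ Fintype.card V := by have := hG.card; omega
  have h1 : G.neighborFinset v = {a, b, c, d} := by ext w; simp [h]
  have h2 := hG.conn.four_le_degree hn v
  rw [← card_neighborFinset_eq_degree, h1] at h2
  refine ⟨?_, ?_, ?_, ?_, ?_, ?_⟩ <;> rintro rfl <;> simp only [
    Finset.insert_eq_of_mem, Finset.mem_insert, Finset.mem_singleton, true_or, or_true] at h2 <;>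
    exact absurd (h2.trans Finset.card_le_three) (by norm_num)

omit [DecidableEq V] [DecidableRel G.Adj] in
lemma IsMinorCritical.false_of_three (hG : IsMinorCritical G) (Q : Finset V) (a b c : V)
    (hQ : Q.Nonempty) (hcard : Q.card ≤ 5)
    (hN : ∀ q ∈ Q, ∀ v, G.Adj q v → v ∈ Q ∨ v = a ∨ v = b ∨ v = c) : False :=
  hG.conn.false_of_three Q a b c hQ hN
    (by have := hG.card; rw [Nat.card_eq_fintype_card]; omega)

lemma IsMinorCritical.four_cut_trichotomy (hG : IsMinorCritical G) {A T B : Finset V}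
    (hT : IsFourCut G A T B) {x y z : V} (hx : x ∈ T) (hy : y ∈ T) (hxy : G.Adj x y)
    (hnt : ¬ IsTrivialEdge G x y) (hdx : G.degree x = 4) (hz : z ∈ A) (hxz : G.Adj x z)
    (huniq : ∀ v ∈ A, G.Adj x v → v = z) :
    A.card = 2 ∨ ∃ w ∈ A, ∃ r ∈ B, w ≠ z ∧ ∀ v, G.Adj y v ↔ v = x ∨ v = z ∨ v = w ∨ v = r := by
  have hn : 6 ≤ Fintype.card V := by have := hG.card; omega
  have hA := hT.two_le_left hG.conn hn hx hy hnt
  have hB := hT.symm.two_le_left hG.conn hn hx hy hnt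
  have hsides := hT.sides
  have hleft := hT.left
  have hright := hT.right
  rcases hG.card_eq_two_or hT hx hA hB hz hxz huniq with h2 | ⟨s, hs, hsx, w, hw, r, hr, hwz, hNs⟩
  · exact Or.inl h2
  rcases eq_or_ne s y with rfl | hsy
  · exact Or.inr ⟨w, hw, r, hr, hwz, hNs⟩
  left
  obtain ⟨p, hp, hxp⟩ := hT.exists_adj_right hG.conn hx
  have hxs : G.Adj x s := ((hNs x).mpr (by simp)).symm
  have hNx := nbrs_eq hdx hxy hxs hxz hxp (by grind) (by grind) (by grind) (by grind) (by grind)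
    (by grind)
  have hpuniq : ∀ v ∈ B, G.Adj x v → v = p := by grind
  rcases hG.card_eq_two_or hT.symm hx hB hA hp hxp hpuniq with
    h2 | ⟨i, hi, hix, w', hw', r', hr', hwp, hNi⟩
  · exfalso
    obtain ⟨p', hpp, hBp⟩ := exists_eq_pair_of_mem h2 hp
    obtain ⟨v, hvx, hvy, hvs, hTv⟩ := Finset.exists_fourth_of_card_eq_four hT.card_eq hx hy hs
      hxy.ne (by grind) (by grind)
    have hBp' : ∀ u, u ∈ B ↔ u = p ∨ u = p' := by simp [hBp]
    have hBn : ∀ b ∈ B, ∀ u, G.Adj b u → u ∈ B ∨ u ∈ T := fun b hb u hbu => by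
      rcases hT.cover u with h | h | h
      · exact absurd hbu.symm (hT.not_adj u h b hb)
      · exact Or.inr h
      · exact Or.inl h
    have hNp' := hG.nbrs_of_subset (v := p') (a := p) (b := y) (c := s) (d := v) (by
      intro u hu
      have := hBn p' (by grind) u hu
      have := hu.symm
      have := hu.ne
      grind)
    have hps : G.Adj p' s := (hNp'.2 s).mpr (by simp)
    have hpr : p' = r := by
      have := (hNs p').mp hps.symm
      grind
    have hNp := hG.nbrs_of_subset (v := p) (a := p') (b := x) (c := y) (d := v) (by
      intro u hu
      have := hBn p (by grind) u hu
      have := hu.symm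
      have := hu.ne
      grind)
    exact hnt ⟨p, hNp.1, (hNp.2 x).mpr (by simp), (hNp.2 y).mpr (by simp)⟩
  · have hxi : G.Adj x i := ((hNi x).mpr (by simp)).symm
    have hiy : i = y := by
      rcases (hNx i).mp hxi with h | rfl | rfl | rfl
      · exact h
      · exfalso
        have h1 := (hNs p).mp ((hNi p).mpr (by simp))
        have h2 := (hNs w').mp ((hNi w').mpr (by simp))
        grind
      · grind
      · grind
    subst hiy
    have hyr : G.Adj i r' := (hNi r').mpr (by simp)
    rcases hG.card_eq_two_or hT hi hA hB hr' hyr (by grind) with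
      h2 | ⟨j, hj, hji, w₂, hw₂, r₂, hr₂, hwr, hNj⟩
    · exact h2
    · exfalso
      have h1 := (hNi j).mp ((hNj i).mpr (by simp)).symm
      have hjx : j = x := by grind
      subst hjx
      have h3 := huniq r' hr' ((hNj r').mpr (by simp))
      have h4 := huniq w₂ hw₂ ((hNj w₂).mpr (by simp))
      grind

end SimpleGraph

namespace SimpleGraph

variable {V : Type*} {G : SimpleGraph V} [DecidableEq V] [Fintype V] [DecidableRel G.Adj]

omit [DecidableEq V] [Fintype V] [DecidableRel G.Adj] in
lemma IsFourCut.mem_of_adj {A T B : Finset V} (h : IsFourCut G A T B) {a u : V} (ha : a ∈ A)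
    (hau : G.Adj a u) : u ∈ A ∨ u ∈ T := by
  rcases h.cover u with h1 | h1 | h1
  · exact Or.inl h1
  · exact Or.inr h1
  · exact absurd hau (h.not_adj a ha u h1)

lemma IsMinorCritical.false_of_common (hG : IsMinorCritical G) {x y z r p w : V}
    (hxy : G.Adj x y) (hnt : ¬ IsTrivialEdge G x y)
    (hNx : ∀ v, G.Adj x v ↔ v = y ∨ v = z ∨ v = r ∨ v = p)
    (hNy : ∀ v, G.Adj y v ↔ v = x ∨ v = z ∨ v = w ∨ v = r) : False := by
  have hn : 6 ≤ Fintype.card V := by have := hG.card; omega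
  have dx := hG.distinct_nbrs hNx
  have dy := hG.distinct_nbrs hNy
  have hdx := (hG.nbrs_of_subset fun v => (hNx v).mp).1
  obtain ⟨A, T, B, hT, hxT, hpT⟩ := hG.cut x p ((hNx p).mpr (by simp))
  have hyT : ∀ {A B : Finset V}, IsFourCut G A T B → y ∉ A := by
    intro A B hT hyA
    obtain ⟨b, hb, hxb⟩ := hT.exists_adj_right hG.conn hxT
    have h1 := hT.mem_of_adj hyA ((hNy z).mpr (by simp))
    have h2 := hT.mem_of_adj hyA ((hNy r).mpr (by simp))
    have := hT.sides b
    have := hT.right b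
    grind
  have hyT : y ∈ T := by
    have h1 := hyT hT
    have h2 := hyT hT.symm
    have := hT.cover y
    tauto
  have key : ∀ {A B : Finset V} {z r : V}, IsFourCut G A T B → z ∈ A → r ∈ B →
      (∀ v, G.Adj x v ↔ v = y ∨ v = z ∨ v = r ∨ v = p) →
      (∀ v, G.Adj y v ↔ v = x ∨ v = z ∨ v = w ∨ v = r) → w ∈ A := by
    intro A B z r hT hz hr hNx hNy
    have hleft := hT.left
    have hright := hT.right
    have hsides := hT.sides
    have dx := hG.distinct_nbrs hNx
    have dy := hG.distinct_nbrs hNy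
    rcases hG.four_cut_trichotomy hT hxT hyT hxy hnt hdx hz ((hNx z).mpr (by simp)) (by grind) with
      h2 | ⟨w', hw', r', hr', hwz, hNy'⟩
    · obtain ⟨w₁, hw₁, hA⟩ := exists_eq_pair_of_mem h2 hz
      have hA' : ∀ u, u ∈ A ↔ u = z ∨ u = w₁ := by simp [hA]
      obtain ⟨t, ht⟩ := Finset.exists_fourth_of_card_eq_four hT.card_eq hxT hyT hpT hxy.ne
        ((hNx p).mpr (by simp)).ne (by grind)
      have hN := hG.nbrs_of_subset (v := w₁) (a := z) (b := y) (c := p) (d := t) (by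
        intro u hu
        have := hT.mem_of_adj (by grind) hu
        have := hu.symm
        have := hu.ne
        grind)
      have h1 := (hN.2 y).mpr (by simp)
      have h3 := (hN.2 p).mpr (by simp)
      have h4 := (hNy w₁).mp h1.symm
      grind
    · have := (hNy w').mp ((hNy' w').mpr (by simp))
      have := (hNy' w).mp ((hNy w).mpr (by simp))
      have := hG.distinct_nbrs hNy'
      grind
  obtain ⟨a, ha, hxa⟩ := hT.exists_adj_left hG.conn hxT
  obtain ⟨b, hb, hxb⟩ := hT.exists_adj_right hG.conn hxT
  have hleft := hT.left
  have hright := hT.right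
  have hsides := hT.sides
  have hab : a = z ∧ b = r ∨ a = r ∧ b = z := by grind
  rcases hab with ⟨rfl, rfl⟩ | ⟨rfl, rfl⟩
  · have h1 := key hT ha hb hNx hNy
    have h2 := key hT.symm hb ha (fun v => by rw [hNx]; tauto) (fun v => by rw [hNy]; tauto)
    exact hsides w h1 h2
  · have h1 := key hT.symm hb ha hNx hNy
    have h2 := key hT ha hb (fun v => by rw [hNx]; tauto) (fun v => by rw [hNy]; tauto)
    exact hsides w h2 h1

lemma IsMinorCritical.card_side_eq_two (hG : IsMinorCritical G) {A T B : Finset V}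
    (hT : IsFourCut G A T B) {x y : V} (hx : x ∈ T) (hy : y ∈ T) (hxy : G.Adj x y)
    (hnt : ¬ IsTrivialEdge G x y) (hdx : G.degree x = 4) : A.card = 2 ∨ B.card = 2 := by
  have key : ∀ {A B : Finset V} {z : V}, IsFourCut G A T B → z ∈ A → G.Adj x z →
      (∀ v ∈ A, G.Adj x v → v = z) → A.card = 2 ∨ B.card = 2 := by
    intro A B z hT hz hxz huniq
    have hleft := hT.left
    have hright := hT.right
    have hsides := hT.sides
    rcases hG.four_cut_trichotomy hT hx hy hxy hnt hdx hz hxz huniq with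
      h2 | ⟨w, hw, r, hr, hwz, hNy⟩
    · exact Or.inl h2
    have hdy := (hG.nbrs_of_subset fun v => (hNy v).mp).1
    rcases hG.four_cut_trichotomy hT.symm hy hx hxy.symm (fun h => hnt h.symm) hdy hr
      ((hNy r).mpr (by simp)) (by grind) with h2 | ⟨p, hp, z', hz', hpr, hNx⟩
    · exact Or.inr h2
    obtain rfl : z' = z := huniq z' hz' ((hNx z').mpr (by simp))
    exact (hG.false_of_common (z := z') (r := r) (p := p) hxy hnt
      (fun v => by rw [hNx]; tauto) hNy).elim
  obtain ⟨a, ha, hxa⟩ := hT.exists_adj_left hG.conn hx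
  obtain ⟨b, hb, hxb⟩ := hT.exists_adj_right hG.conn hx
  have hleft := hT.left
  have hright := hT.right
  have hsides := hT.sides
  obtain ⟨c, hc⟩ := exists_fourth_nbr hdx hxy hxa hxb (by grind) (by grind) (by grind)
  by_cases hcA : c ∈ A
  · exact (key hT.symm hb hxb (by grind)).symm
  · exact key hT ha hxa (by grind)

/-- A four-cut through `x` and `y` with a side `{b, c}` of size two, where `x` has degree four and
just one neighbour `b` on that side. -/
structure IsPairSide (G : SimpleGraph V) (A T B : Finset V) (x y b c u v p q : V) : Prop where
  cut : IsFourCut G A T B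
  card_right : B.card ≠ 2
  mem_left : ∀ w, w ∈ A ↔ w = b ∨ w = c
  mem_mid : ∀ w, w ∈ T ↔ w = x ∨ w = y ∨ w = u ∨ w = v
  hp : p ∈ B
  hq : q ∈ B
  nbrs : ∀ w, G.Adj x w ↔ w = y ∨ w = b ∨ w = p ∨ w = q
  hcb : c ≠ b
  hyx : y ≠ x
  hux : u ≠ x
  huy : u ≠ y
  hvx : v ≠ x
  hvy : v ≠ y
  hvu : v ≠ u

omit [Fintype V] [DecidableRel G.Adj] in
lemma isPairSide_of_nbrs {A T B : Finset V}
    (hT : IsFourCut G A T B) (hA : A.card = 2) (hB : B.card ≠ 2) {x y b p q : V} (hx : x ∈ T)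
    (hy : y ∈ T) (hb : b ∈ A) (hp : p ∈ B) (hq : q ∈ B)
    (hN : ∀ w, G.Adj x w ↔ w = y ∨ w = b ∨ w = p ∨ w = q) :
    ∃ c u v, IsPairSide G A T B x y b c u v p q := by
  obtain ⟨c, hcb, rfl⟩ := exists_eq_pair_of_mem hA hb
  have hxy := ((hN y).mpr (by simp)).ne
  obtain ⟨u, v, h⟩ := Finset.exists_two_of_card_eq_four hT.card_eq hx hy hxy
  exact ⟨c, u, v, hT, hB, by simp, h.2.2.2.2.2, hp, hq, hN, hcb, hxy.symm, h.1, h.2.1, h.2.2.1,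
    h.2.2.2.1, h.2.2.2.2.1⟩

lemma IsMinorCritical.exists_isPairSide (hG : IsMinorCritical G) {x y : V} (hxy : G.Adj x y)
    (hnt : ¬ IsTrivialEdge G x y) (hdx : G.degree x = 4) :
    (∃ A T B b c u v p q, IsPairSide G A T B x y b c u v p q) ∨
      G.degree y = 4 ∧ ∃ A T B b c u v p q, IsPairSide G A T B y x b c u v p q := by
  have key : ∀ {A T B : Finset V}, IsFourCut G A T B → x ∈ T → y ∈ T → A.card = 2 →
      (∃ A T B b c u v p q, IsPairSide G A T B x y b c u v p q) ∨
      G.degree y = 4 ∧ ∃ A T B b c u v p q, IsPairSide G A T B y x b c u v p q := by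
    intro A T B hT hx hy hA
    have hB : B.card ≠ 2 := by
      intro hB
      have h1 := hT.toIsTripartition.card_inter Finset.univ
      simp only [Finset.univ_inter, Finset.card_univ] at h1
      have := hG.card
      have := hT.card_eq
      omega
    obtain ⟨a, ha, hxa⟩ := hT.exists_adj_left hG.conn hx
    obtain ⟨b, hb, hxb⟩ := hT.exists_adj_right hG.conn hx
    have hleft := hT.left
    have hright := hT.right
    have hsides := hT.sides
    obtain ⟨c, hca, hcb, hcy, hNx⟩ := exists_fourth_nbr hdx hxy hxa hxb (by grind) (by grind)
      (by grind)
    by_cases hcB : c ∈ B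
    · obtain ⟨c, u, v, h⟩ := isPairSide_of_nbrs hT hA hB hx hy ha hb hcB hNx
      exact Or.inl ⟨_, _, _, _, _, _, _, _, _, h⟩
    · rcases hG.four_cut_trichotomy hT.symm hx hy hxy hnt hdx hb hxb (by grind) with
        h2 | ⟨w, hw, r, hr, hwb, hNy⟩
      · exact absurd h2 hB
      · obtain ⟨c, u, v, h⟩ := isPairSide_of_nbrs hT hA hB hy hx hr hb hw
          (fun v => by rw [hNy]; tauto)
        exact Or.inr ⟨(hG.nbrs_of_subset fun v => (hNy v).mp).1, _, _, _, _, _, _, _, _, _, h⟩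
  obtain ⟨A, T, B, hT, hx, hy⟩ := hG.cut x y hxy
  rcases hG.card_side_eq_two hT hx hy hxy hnt hdx with h2 | h2
  · exact key hT hx hy h2
  · exact key hT.symm hx hy h2

lemma IsPairSide.nbrs_inner (hG : IsMinorCritical G) {A T B : Finset V} {x y b c u v p q : V}
    (h : IsPairSide G A T B x y b c u v p q) :
    (∀ w, G.Adj c w ↔ w = b ∨ w = y ∨ w = u ∨ w = v) ∧
      ∀ w, G.Adj b w → w = c ∨ w = x ∨ w = y ∨ w = u ∨ w = v := by
  have hT := h.cut
  have hA := h.mem_left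
  have hTm := h.mem_mid
  have hleft := hT.left
  have hright := hT.right
  have hsides := hT.sides
  have hcb := h.hcb
  have hN := h.nbrs
  have hp := h.hp
  have hq := h.hq
  have hyx := h.hyx
  have hcA := (hA c).mpr (Or.inr rfl)
  have hbA := (hA b).mpr (Or.inl rfl)
  have hyT := (hTm y).mpr (by simp)
  constructor
  · refine (hG.nbrs_of_subset fun w hw => ?_).2
    have := hT.mem_of_adj (by grind) hw
    have := hw.symm
    have := hw.ne
    grind
  · intro w hw
    have := hT.mem_of_adj (by grind) hw
    have := hw.ne
    grind

end SimpleGraph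

namespace SimpleGraph

variable {V : Type*} {G : SimpleGraph V} [DecidableEq V] [Fintype V] [DecidableRel G.Adj]

omit [DecidableRel G.Adj] in
lemma IsMinorCritical.false_of_quad (hG : IsMinorCritical G) (q₁ q₂ q₃ q₄ a b c : V)
    (h : ∀ w, G.Adj q₁ w ∨ G.Adj q₂ w ∨ G.Adj q₃ w ∨ G.Adj q₄ w →
      w = q₁ ∨ w = q₂ ∨ w = q₃ ∨ w = q₄ ∨ w = a ∨ w = b ∨ w = c) : False := by
  refine hG.false_of_three {q₁, q₂, q₃, q₄} a b c (by simp)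
    (Finset.card_le_four.trans (by norm_num)) ?_
  intro q hq w hw
  have := h w
  simp only [Finset.mem_insert, Finset.mem_singleton] at hq ⊢
  rcases hq with rfl | rfl | rfl | rfl <;> simp only [hw, true_or, or_true, forall_const] at this
  all_goals simpa only [or_assoc] using this

lemma IsPairSide.adj_inner (hG : IsMinorCritical G) {A T B : Finset V} {x y b c u v p q : V}
    (h : IsPairSide G A T B x y b c u v p q) (hnt : ¬ IsTrivialEdge G x y) : G.Adj b y := by
  by_contra hby
  obtain ⟨hNc, hNb1⟩ := h.nbrs_inner hG
  have hNx := h.nbrs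
  have hn : 6 ≤ Fintype.card V := by have := hG.card; omega
  have hdx := (hG.nbrs_of_subset fun w => (hNx w).mp).1
  obtain ⟨hdb, hNb⟩ := hG.nbrs_of_subset (v := b) (a := x) (b := c) (c := u) (d := v) (by grind)
  have dx := hG.distinct_nbrs hNx
  have db := hG.distinct_nbrs hNb
  have dc := hG.distinct_nbrs hNc
  have hTm := h.mem_mid
  have hyx := h.hyx
  have hcb := h.hcb
  have hux := h.hux
  have huy := h.huy
  have hvx := h.hvx
  have hvy := h.hvy
  have hp : p ≠ c ∧ p ≠ u ∧ p ≠ v ∧ q ≠ c ∧ q ≠ u ∧ q ≠ v := by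
    have h1 := h.cut.right p h.hp
    have h2 := h.cut.right q h.hq
    have h3 := fun h' => h.cut.sides p h' h.hp
    have h4 := fun h' => h.cut.sides q h' h.hq
    rw [h.mem_mid] at h1 h2
    rw [h.mem_left] at h3 h4
    grind
  have hxb : G.Adj x b := (hNx b).mpr (by simp)
  have hnt' : ¬ IsTrivialEdge G x b := by
    rintro ⟨d, -, hd1, hd2⟩
    have := (hNx d).mp hd1.symm
    have := (hNb d).mp hd2.symm
    have := hd1.ne
    have := hd2.ne
    grind
  obtain ⟨A', T', B', hT, hx, hb⟩ := hG.cut x b hxb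
  have hcT : ∀ {A B : Finset V}, IsFourCut G A T' B → c ∉ A := by
    intro A B hT hcA
    obtain ⟨w, hw, hbw⟩ := hT.exists_adj_right hG.conn hb
    have h1 := hT.mem_of_adj hcA ((hNc u).mpr (by simp))
    have h2 := hT.mem_of_adj hcA ((hNc v).mpr (by simp))
    have := hT.sides w
    have := hT.right w
    grind
  have hc : c ∈ T' := by
    have h1 := hcT hT
    have h2 := hcT hT.symm
    have := hT.cover c
    tauto
  have key : ∀ {A B : Finset V} {u v : V}, IsFourCut G A T' B → A.card = 2 → u ∈ A → v ∈ B →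
      (∀ w, G.Adj c w ↔ w = b ∨ w = y ∨ w = u ∨ w = v) →
      (∀ w, G.Adj b w ↔ w = x ∨ w = c ∨ w = u ∨ w = v) →
      (p ≠ c ∧ p ≠ u ∧ p ≠ v ∧ q ≠ c ∧ q ≠ u ∧ q ≠ v) → False := by
    intro A B u v hT hA hu hv hNc hNb hp
    obtain ⟨u', huu, hA'⟩ := exists_eq_pair_of_mem hA hu
    have hA' : ∀ w, w ∈ A ↔ w = u ∨ w = u' := by simp [hA']
    have db := hG.distinct_nbrs hNb
    have dc := hG.distinct_nbrs hNc
    obtain ⟨t, ht⟩ := Finset.exists_fourth_of_card_eq_four hT.card_eq hx hb hc hxb.ne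
      (by grind) (by grind)
    have hleft := hT.left
    have hright := hT.right
    have hsides := hT.sides
    obtain ⟨-, hNu'⟩ := hG.nbrs_of_subset (v := u') (a := u) (b := x) (c := c) (d := t) (by
      intro w hw
      have := hT.mem_of_adj (by grind) hw
      have := hw.symm
      have := hw.ne
      grind)
    have h1 := (hNx u').mp ((hNu' x).mpr (by simp)).symm
    have h2 := (hNc u').mp ((hNu' c).mpr (by simp)).symm
    clear hNb1
    obtain rfl : u' = y := by grind
    have hNu : ∀ w, G.Adj u w → w = u' ∨ w = b ∨ w = c ∨ w = t := by
      intro w hw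
      have := hT.mem_of_adj hu hw
      have := hw.symm
      have := hw.ne
      grind
    exact hG.false_of_quad b c u u' x v t fun w hw => by
      have h3 := (hNb w).mp
      have h4 := (hNc w).mp
      have h5 := hNu w
      have h6 := (hNu' w).mp
      clear * - h3 h4 h5 h6 hw
      grind
  obtain ⟨a₁, ha₁, hba₁⟩ := hT.exists_adj_left hG.conn hb
  obtain ⟨a₂, ha₂, hba₂⟩ := hT.exists_adj_right hG.conn hb
  have hleft := hT.left
  have hright := hT.right
  have hsides := hT.sides
  have hNc' : ∀ w, G.Adj c w ↔ w = b ∨ w = y ∨ w = v ∨ w = u := fun w => by rw [hNc]; tauto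
  have hNb' : ∀ w, G.Adj b w ↔ w = x ∨ w = c ∨ w = v ∨ w = u := fun w => by rw [hNb]; tauto
  have huv : a₁ = u ∧ a₂ = v ∨ a₁ = v ∧ a₂ = u := by grind
  rcases hG.card_side_eq_two hT hx hb hxb hnt' hdx with h2 | h2 <;>
    rcases huv with ⟨rfl, rfl⟩ | ⟨rfl, rfl⟩
  · exact key hT h2 ha₁ ha₂ hNc hNb hp
  · exact key hT h2 ha₁ ha₂ hNc' hNb' (by tauto)
  · exact key hT.symm h2 ha₂ ha₁ hNc' hNb' (by tauto)
  · exact key hT.symm h2 ha₂ ha₁ hNc hNb hp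

lemma IsPairSide.isTrivialEdge (hG : IsMinorCritical G) {A T B : Finset V} {x y b c u v p q : V}
    (h : IsPairSide G A T B x y b c u v p q) : IsTrivialEdge G x y := by
  by_contra hnt
  have hby := h.adj_inner hG hnt
  obtain ⟨hNc, hNb⟩ := h.nbrs_inner hG
  have hNx := h.nbrs
  have hn : 6 ≤ Fintype.card V := by have := hG.card; omega
  have hdx := (hG.nbrs_of_subset fun w => (hNx w).mp).1
  have dx := hG.distinct_nbrs hNx
  have dc := hG.distinct_nbrs hNc
  have hTm := h.mem_mid
  have hAm := h.mem_left
  have hyx := h.hyx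
  have hcb := h.hcb
  have hux := h.hux
  have huy := h.huy
  have hvx := h.hvx
  have hvy := h.hvy
  have hp : p ≠ c ∧ p ≠ u ∧ p ≠ v ∧ q ≠ c ∧ q ≠ u ∧ q ≠ v := by
    have h1 := h.cut.right p h.hp
    have h2 := h.cut.right q h.hq
    have h3 := fun h' => h.cut.sides p h' h.hp
    have h4 := fun h' => h.cut.sides q h' h.hq
    rw [h.mem_mid] at h1 h2
    rw [h.mem_left] at h3 h4
    grind
  have hxb : G.Adj x b := (hNx b).mpr (by simp)
  have hxy : G.Adj x y := (hNx y).mpr (by simp)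
  have hcy : G.Adj c y := (hNc y).mpr (by simp)
  have hcx : c ≠ x := by
    rintro rfl
    exact h.cut.left c ((hAm c).mpr (by simp)) ((hTm c).mpr (by simp))
  have hdb : G.degree b ≠ 4 := fun hd => hnt ⟨b, hd, hxb.symm, hby⟩
  have hbu : G.Adj b u := by
    by_contra hbu
    exact hdb (hG.nbrs_of_subset (v := b) (a := c) (b := x) (c := y) (d := v) (by grind)).1
  have hbv : G.Adj b v := by
    by_contra hbv
    exact hdb (hG.nbrs_of_subset (v := b) (a := c) (b := x) (c := y) (d := u) (by grind)).1
  by_cases hdy : G.degree y = 4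
  · obtain ⟨r, hr⟩ := exists_fourth_nbr hdy hxy.symm hby.symm hcy.symm hxb.ne hcx.symm
      (by grind)
    have hxT := (hTm x).mpr (by simp)
    have hyT := (hTm y).mpr (by simp)
    obtain ⟨r', hr', hyr⟩ := h.cut.exists_adj_right hG.conn hyT
    have hright := h.cut.right
    have hsides := h.cut.sides
    obtain rfl : r' = r := by grind
    rcases hG.four_cut_trichotomy h.cut.symm hyT hxT hxy.symm (fun h => hnt h.symm) hdy hr' hyr
      (by grind) with h2 | ⟨w, hw, r, hr, hwb, hNx'⟩
    · exact h.card_right h2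
    · have h1 := (hNx r).mp ((hNx' r).mpr (by simp))
      have hrb : r = b := by
        have := h.hp
        have := h.hq
        grind
      subst hrb
      exact hG.false_of_common (z := r) (r := r') (p := w) (w := c) hxy hnt
        (fun v => by rw [hNx']; tauto) (fun v => by rw [hr.2.2.2])
  · have hnt' : ¬ IsTrivialEdge G x b := by
      rintro ⟨d, hd, hd1, hd2⟩
      have h1 := (hNx d).mp hd1.symm
      have h2 := hNb d hd2.symm
      have hd2 := hd2.ne
      have hd1 := hd1.ne
      have : d ≠ y := by rintro rfl; exact hdy hd
      grind
    rcases hG.exists_isPairSide hxb hnt' hdx with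
      ⟨A', T', B', b', c', m, k, p', q', h'⟩ | ⟨h1, -⟩
    swap
    · exact hdb h1
    obtain ⟨hNc', hNb'⟩ := h'.nbrs_inner hG
    have hbb := h'.adj_inner hG hnt'
    have h1 := hNb b' hbb.symm
    have h2 := (hNx b').mp ((h'.nbrs b').mpr (by simp))
    obtain rfl : b' = y := by
      have := hbb.ne
      have := ((h'.nbrs b').mpr (by simp)).ne
      grind
    have dc' := hG.distinct_nbrs hNc'
    have hc1 := hNb' c hcy.symm
    by_cases hcc : c' = c
    · subst hcc
      have hm : m = u ∨ m = v := by
        have := (hNc m).mp ((hNc' m).mpr (by simp))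
        grind
      have hk : k = u ∨ k = v := by
        have := (hNc k).mp ((hNc' k).mpr (by simp))
        grind
      exact hG.false_of_quad b' c' b b x u v fun w hw => by
        have h3 := hNb' w
        have h4 := (hNc w).mp
        have h5 := hNb w
        clear * - h3 h4 h5 hw hm hk
        grind
    · have hc2 := hNb c' ((hNc' b).mpr (by simp)).symm
      have hc3 : c' ≠ x := by
        rintro rfl
        exact h'.cut.left c' ((h'.mem_left c').mpr (by simp)) ((h'.mem_mid c').mpr (by simp))
      have key : ∀ u v m k, (∀ w, G.Adj c w → w = b ∨ w = b' ∨ w = u ∨ w = v) →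
          (∀ w, G.Adj b w → w = c ∨ w = x ∨ w = b' ∨ w = u ∨ w = v) →
          (∀ w, G.Adj c' w → w = b' ∨ w = b ∨ w = m ∨ w = k) →
          (∀ w, G.Adj b' w → w = c' ∨ w = x ∨ w = b ∨ w = m ∨ w = k) → c' = u → c = m →
          False := by
        rintro u v m k hNc hNb hNc' hNb' rfl rfl
        exact hG.false_of_quad b c c' b' x v k fun w hw => by
          have h3 := hNb' w
          have h4 := hNc w
          have h5 := hNb w
          have h6 := hNc' w
          clear * - h3 h4 h5 h6 hw
          grind
      have hcb' := h'.hcb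
      have e1 : c' = u ∨ c' = v := by grind
      have e2 : c = m ∨ c = k := by grind
      rcases e1 with e1 | e1 <;> rcases e2 with e2 | e2
      · exact key u v m k (by grind) (by grind) (by grind) (by grind) e1 e2
      · exact key u v k m (by grind) (by grind) (by grind) (by grind) e1 e2
      · exact key v u m k (by grind) (by grind) (by grind) (by grind) e1 e2
      · exact key v u k m (by grind) (by grind) (by grind) (by grind) e1 e2

lemma IsMinorCritical.isTrivialEdge (hG : IsMinorCritical G) {x y : V} (hxy : G.Adj x y) :
    IsTrivialEdge G x y := by
  by_contra hnt
  have key : ∀ {x y : V}, G.Adj x y → ¬ IsTrivialEdge G x y → G.degree x = 4 → False := by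
    intro x y hxy hnt hdx
    rcases hG.exists_isPairSide hxy hnt hdx with
      ⟨A, T, B, b, c, u, v, p, q, h⟩ | ⟨-, A, T, B, b, c, u, v, p, q, h⟩
    · exact hnt (h.isTrivialEdge hG)
    · exact hnt (h.isTrivialEdge hG).symm
  rcases hG.degree_eq_four_or hxy hnt with h | h
  · exact key hxy hnt h
  · exact key hxy.symm (fun h => hnt h.symm) h

end SimpleGraph

namespace SimpleGraph

variable {V : Type*} {G : SimpleGraph V} [DecidableEq V] [Fintype V] [DecidableRel G.Adj]

lemma IsMinorCritical.degree_eq_four (hG : IsMinorCritical G) (z : V) : G.degree z = 4 := by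
  by_contra hz
  have hn : 6 ≤ Fintype.card V := by have := hG.card; omega
  obtain ⟨y, hy⟩ : (G.neighborFinset z).Nonempty := by
    rw [← Finset.card_pos, card_neighborFinset_eq_degree]
    have := hG.conn.four_le_degree hn z
    omega
  rw [mem_neighborFinset] at hy
  obtain ⟨d, hd, hdz, -⟩ := hG.isTrivialEdge hy
  obtain ⟨d', hd', hdz', hdd⟩ := hG.isTrivialEdge hdz.symm
  obtain ⟨t, ht, htd, htd'⟩ := hG.isTrivialEdge hdd
  have htz : t ≠ z := by rintro rfl; exact hz ht
  obtain ⟨e, he⟩ := exists_fourth_nbr hd hdz hdd.symm htd'.symm hdz'.ne' htz.symm htd.ne'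
  obtain ⟨e', he'⟩ := exists_fourth_nbr hd' hdz' hdd htd.symm hdz.ne' htz.symm htd'.ne'
  have hNd := he.2.2.2
  have hNd' := he'.2.2.2
  have ndd := hdd.ne
  have ntd := htd.ne
  have ntd' := htd'.ne
  have nde := ((hNd e).mpr (by simp)).ne
  have nde' := ((hNd' e').mpr (by simp)).ne
  by_cases htz' : G.Adj t z
  · obtain ⟨f, hf⟩ := exists_fourth_nbr ht htz' htd' htd hdz.ne' hdz'.ne' hdd.ne'
    have hNt := hf.2.2.2
    have hde : e = e' ∨ e = f := by
      obtain ⟨s, hs, hsd, hse⟩ := hG.isTrivialEdge ((hNd e).mpr (by simp))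
      have hsz : s ≠ z := by rintro rfl; exact hz hs
      have h1 := (hNd s).mp hsd.symm
      have h2 := hNd' e
      have h3 := hNt e
      have := hse.ne
      grind
    refine hG.false_of_quad d d' t t z e' f fun w hw => ?_
    grind
  · obtain ⟨s, hs, hsd, hse⟩ := hG.isTrivialEdge ((hNd e).mpr (by simp))
    obtain ⟨s', hs', hsd', hse'⟩ := hG.isTrivialEdge ((hNd' e').mpr (by simp))
    have hsz : s ≠ z := by rintro rfl; exact hz hs
    have hsz' : s' ≠ z := by rintro rfl; exact hz hs'
    have h1 := (hNd s).mp hsd.symm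
    have h1' := (hNd' s').mp hsd'.symm
    have hse1 := hse.ne
    have hse1' := hse'.ne
    by_cases hee : e = e'
    · refine hG.false_of_quad d d' d d z e t fun w hw => ?_
      grind
    have hs1 : s = t := by have := hNd' e; grind
    have hs1' : s' = t := by have := hNd e'; grind
    subst hs1
    rw [hs1'] at hse'
    have hNt := nbrs_eq hs htd' htd hse hse' hdd.ne' (by grind) (by grind) (by grind) (by grind) hee
    refine hG.false_of_quad d d' s s z e e' fun w hw => ?_
    grind

lemma IsMinorCritical.exists_triangle (hG : IsMinorCritical G) {x y : V} (h : G.Adj x y) :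
    ∃ d, G.Adj d x ∧ G.Adj d y :=
  let ⟨d, _, h₁, h₂⟩ := hG.isTrivialEdge h
  ⟨d, h₁, h₂⟩

/-- Two triangles on an edge `ab` can be completed to the square of a path. -/
lemma IsMinorCritical.exists_strip (hG : IsMinorCritical G) {a b c c' : V} (hab : G.Adj a b)
    (hac : G.Adj a c) (hbc : G.Adj b c) (hac' : G.Adj a c') (hbc' : G.Adj b c') (hcc : c ≠ c') :
    ∃ d e, (∀ w, G.Adj a w ↔ w = b ∨ w = c ∨ w = c' ∨ w = d) ∧
      (∀ w, G.Adj b w ↔ w = a ∨ w = c ∨ w = c' ∨ w = e) ∧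
      (G.Adj d c ∧ G.Adj e c' ∨ G.Adj d c' ∧ G.Adj e c) := by
  obtain ⟨d, hd⟩ := exists_fourth_nbr (hG.degree_eq_four a) hab hac hac' hbc.ne hbc'.ne hcc
  obtain ⟨e, he⟩ := exists_fourth_nbr (hG.degree_eq_four b) hab.symm hbc hbc' hac.ne hac'.ne hcc
  have hNa := hd.2.2.2
  have hNb := he.2.2.2
  refine ⟨d, e, hNa, hNb, ?_⟩
  have nad := ((hNa d).mpr (by simp)).ne
  have nbe := ((hNb e).mpr (by simp)).ne
  have hde : d ≠ e := by
    rintro rfl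
    refine hG.false_of_quad a b a a c c' d fun w hw => ?_
    grind
  obtain ⟨s, hsa, hsd⟩ := hG.exists_triangle ((hNa d).mpr (by simp))
  obtain ⟨t, htb, hte⟩ := hG.exists_triangle ((hNb e).mpr (by simp))
  have h1 := (hNa s).mp hsa.symm
  have h2 := (hNb t).mp htb.symm
  have h3 := hNa e
  have h4 := hNb d
  have h5 := hsd.ne
  have h6 := hte.ne
  have hs : G.Adj d c ∨ G.Adj d c' := by
    have := hsd.symm
    grind
  have ht : G.Adj e c ∨ G.Adj e c' := by
    have := hte.symm
    grind
  have key : ∀ c c', c ≠ c' → (∀ w, G.Adj a w → w = b ∨ w = c ∨ w = c' ∨ w = d) →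
      (∀ w, G.Adj b w → w = a ∨ w = c ∨ w = c' ∨ w = e) → G.Adj a c → G.Adj b c →
      d ≠ a → e ≠ a → d ≠ b → e ≠ b → ¬ (G.Adj d c ∧ G.Adj e c) := by
    rintro c c' hcc hNa hNb hac hbc h1 h2 h3 h4 ⟨h5, h6⟩
    have hNc := nbrs_eq (hG.degree_eq_four c) hac.symm hbc.symm h5.symm h6.symm hab.ne h1.symm
      h2.symm h3.symm h4.symm hde
    refine hG.false_of_quad a b c c c' d e fun w hw => ?_
    grind
  have k1 := key c c' hcc (by grind) (by grind) hac hbc (by grind) (by grind) (by grind) (by grind)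
  have k2 := key c' c hcc.symm (by grind) (by grind) hac' hbc' (by grind) (by grind) (by grind)
    (by grind)
  grind

end SimpleGraph

namespace SimpleGraph

variable {V : Type*} {G : SimpleGraph V} [DecidableEq V] [Fintype V] [DecidableRel G.Adj]

/-- Consecutive vertices of the square of a path whose two middle vertices have no other
neighbours. -/
structure IsStrip (G : SimpleGraph V) (v₁ v₂ v₃ v₄ v₅ v₆ : V) : Prop where
  adj_left : G.Adj v₁ v₂
  nbrs₃ : ∀ w, G.Adj v₃ w ↔ w = v₁ ∨ w = v₂ ∨ w = v₄ ∨ w = v₅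
  nbrs₄ : ∀ w, G.Adj v₄ w ↔ w = v₂ ∨ w = v₃ ∨ w = v₅ ∨ w = v₆
  adj_right : G.Adj v₅ v₆

omit [DecidableRel G.Adj] in
lemma IsStrip.ne (hG : IsMinorCritical G) {v₁ v₂ v₃ v₄ v₅ v₆ : V}
    (h : IsStrip G v₁ v₂ v₃ v₄ v₅ v₆) : v₁ ≠ v₆ := by
  intro heq
  have h3 := h.nbrs₃
  have h4 := h.nbrs₄
  refine hG.false_of_quad v₃ v₄ v₄ v₄ v₁ v₂ v₅ fun w hw => ?_
  grind

lemma IsStrip.exists_next (hG : IsMinorCritical G) {v₁ v₂ v₃ v₄ v₅ v₆ : V}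
    (h : IsStrip G v₁ v₂ v₃ v₄ v₅ v₆) : ∃ v₇, IsStrip G v₂ v₃ v₄ v₅ v₆ v₇ := by
  have h3 := h.nbrs₃
  have h4 := h.nbrs₄
  have d3 := hG.distinct_nbrs h3
  have d4 := hG.distinct_nbrs h4
  have h16 := h.ne hG
  have a12 := h.adj_left
  have a45 : G.Adj v₄ v₅ := (h4 v₅).mpr (by simp)
  have a34 : G.Adj v₃ v₄ := (h3 v₄).mpr (by simp)
  have a35 : G.Adj v₃ v₅ := (h3 v₅).mpr (by simp)
  have a32 : G.Adj v₃ v₂ := (h3 v₂).mpr (by simp)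
  have a42 : G.Adj v₄ v₂ := (h4 v₂).mpr (by simp)
  have a46 : G.Adj v₄ v₆ := (h4 v₆).mpr (by simp)
  obtain ⟨d, e, hd, he, hde⟩ := hG.exists_strip a45 a34.symm a35.symm a46 h.adj_right d4.2.2.2.2.1
  have n45 := a45.ne
  have n31 := ((h3 v₁).mpr (by simp)).ne
  have de := hG.distinct_nbrs he
  have hd2 : d = v₂ := by
    have h5 := hd d
    have h6 := h4 d
    have := hG.distinct_nbrs hd
    grind
  subst hd2
  refine ⟨e, a32.symm, fun w => by rw [h4], fun w => by rw [he]; tauto, ?_⟩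
  rcases hde with hde | ⟨h26, h3e⟩
  · exact hde.2.symm
  exfalso
  have he3 := (h3 e).mp h3e.symm
  have he5 : v₅ ≠ e := ((he e).mpr (by simp)).ne
  have hN2 := nbrs_eq (hG.degree_eq_four d) a12.symm a32.symm a42.symm h26 (by grind)
    (by grind) (by grind) a34.ne (by grind) a46.ne
  have h25 : ¬ G.Adj d v₅ := by
    rw [hN2]
    have := h.adj_right.ne
    grind
  have he1 : e = v₁ := by
    have := (he e).mpr (by simp)
    have := this.symm
    grind
  refine hG.false_of_quad d v₃ v₄ v₅ v₁ v₆ v₆ fun w hw => ?_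
  rw [hN2, h3, h4, he] at hw
  clear * - hw he1
  grind

lemma IsStrip.isMinorOf (hG : IsMinorCritical G) {v₁ v₂ v₃ v₄ v₅ v₆ : V}
    (h : IsStrip G v₁ v₂ v₃ v₄ v₅ v₆) : (wheel 6).IsMinorOf G := by
  obtain ⟨v₇, s2⟩ := h.exists_next hG
  obtain ⟨v₈, s3⟩ := s2.exists_next hG
  obtain ⟨v₉, s4⟩ := s3.exists_next hG
  have a12 := h.adj_left
  have a89 := s4.adj_right
  have a78 := s3.adj_right
  have h3 := h.nbrs₃
  have h4 := h.nbrs₄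
  have h5 := s2.nbrs₄
  have h6 := s3.nbrs₄
  have h7 := s4.nbrs₄
  have d3 := hG.distinct_nbrs h3
  have d4 := hG.distinct_nbrs h4
  have d5 := hG.distinct_nbrs h5
  have d6 := hG.distinct_nbrs h6
  have d7 := hG.distinct_nbrs h7
  have n16 := h.ne hG
  have n27 := s2.ne hG
  have n38 := s3.ne hG
  have n49 := s4.ne hG
  have n12 := a12.ne
  have n23 := s2.adj_left.ne
  have n34 := s3.adj_left.ne
  have n45 := s4.adj_left.ne
  have n56 := h.adj_right.ne
  have n67 := s2.adj_right.ne
  have n78 := a78.ne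
  have n89 := a89.ne
  have n31 := ((h3 v₁).mpr (by simp)).ne
  have n42 := ((h4 v₂).mpr (by simp)).ne
  have n53 := ((h5 v₃).mpr (by simp)).ne
  have n64 := ((h6 v₄).mpr (by simp)).ne
  have n75 := ((h7 v₅).mpr (by simp)).ne
  have n68 := ((h6 v₈).mpr (by simp)).ne
  have n79 := ((h7 v₉).mpr (by simp)).ne
  have n17 : v₁ ≠ v₇ := fun heq => hG.false_of_quad v₃ v₄ v₅ v₅ v₁ v₂ v₆ fun w hw => by
    rw [h3, h4, h5] at hw
    clear * - hw heq
    grind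
  have n28 : v₂ ≠ v₈ := fun heq => hG.false_of_quad v₄ v₅ v₆ v₆ v₂ v₃ v₇ fun w hw => by
    rw [h4, h5, h6] at hw
    clear * - hw heq
    grind
  have n39 : v₃ ≠ v₉ := fun heq => hG.false_of_quad v₅ v₆ v₇ v₇ v₃ v₄ v₈ fun w hw => by
    rw [h5, h6, h7] at hw
    clear * - hw heq
    grind
  have n18 : v₁ ≠ v₈ := fun heq => hG.false_of_quad v₃ v₄ v₅ v₆ v₁ v₂ v₇ fun w hw => by
    rw [h3, h4, h5, h6] at hw
    clear * - hw heq
    grind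
  have n29 : v₂ ≠ v₉ := fun heq => hG.false_of_quad v₄ v₅ v₆ v₇ v₂ v₃ v₈ fun w hw => by
    rw [h4, h5, h6, h7] at hw
    clear * - hw heq
    grind
  have n19 : v₁ ≠ v₉ := by
    rintro rfl
    refine hG.false_of_three {v₃, v₄, v₅, v₆, v₇} v₁ v₂ v₈ (by simp) Finset.card_le_five ?_
    simp only [Finset.mem_insert, Finset.mem_singleton]
    rintro q (rfl | rfl | rfl | rfl | rfl) w hw
    · rw [h3] at hw; clear * - hw; grind
    · rw [h4] at hw; clear * - hw; grind
    · rw [h5] at hw; clear * - hw; grind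
    · rw [h6] at hw; clear * - hw; grind
    · rw [h7] at hw; clear * - hw; grind
  obtain ⟨S, hS⟩ : ∃ S : Set V, ∀ w, w ∈ S ↔ ¬ (w = v₁ ∨ w = v₂ ∨ w = v₃ ∨ w = v₄ ∨ w = v₅ ∨
      w = v₆ ∨ w = v₇ ∨ w = v₈) := ⟨{w | _}, fun w => Iff.rfl⟩
  have h9 : v₉ ∈ S := by rw [hS]; grind
  have hsub : ∀ w ∈ G.comp S v₉, w ∈ S := fun w hw => comp_subset hw
  have hcl : ∀ z ∈ G.comp S v₉, ∀ w, G.Adj z w → w ∈ S → w ∈ G.comp S v₉ :=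
    fun z hz w hzw hw => comp_closed hz hzw hw
  have h9Z := mem_comp_self (G := G) h9
  have hZ := conn_comp (G := G) h9
  generalize G.comp S v₉ = Z at hsub hcl h9Z hZ
  have hZ' : ∀ w ∈ Z, w ≠ v₁ ∧ w ≠ v₂ ∧ w ≠ v₃ ∧ w ≠ v₄ ∧ w ≠ v₅ ∧ w ≠ v₆ ∧ w ≠ v₇ ∧ w ≠ v₈ := by
    intro w hw
    have := (hS w).mp (hsub w hw)
    tauto
  have h1Z : ∃ z ∈ Z, G.Adj z v₁ := by
    by_contra! hno
    classical
    have h4le := hG.conn.four_le (Q := Z.toFinset) (R := {v₂, v₇, v₈}) (w := v₃)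
      ⟨v₉, by simpa using h9Z⟩ (by
        rw [Finset.disjoint_left]
        intro w hw
        have := hZ' w (by simpa using hw)
        simp [this]) (by
        intro z hz w hzw
        simp only [Set.mem_toFinset] at hz ⊢
        simp only [Finset.mem_insert, Finset.mem_singleton]
        have g1 := hno z hz
        have g2 := hcl z hz w hzw
        have g3 := hZ' z hz
        rw [hS] at g2
        have g4 := hzw.symm
        have := h3 z
        have := h4 z
        have := h5 z
        have := h6 z
        clear * - g1 g2 g3 g4 hzw h3 h4 h5 h6 h9
        grind) (fun h => (hZ' v₃ (by simpa using h)).2.2.1 rfl) (by simp; grind)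
    exact absurd (h4le.trans Finset.card_le_three) (by norm_num)
  refine wheel_isMinorOf_of_rim {v₃, v₅, v₇} Z v₁ v₂ v₄ v₆ v₈ ?_ hZ ?_ ?_ ?_ ?_ ?_ ?_ a12 ?_ ?_ ?_
    ⟨v₉, h9Z, a89⟩ h1Z
  · exact conn_insert (conn_pair ((h5 v₇).mpr (by simp))) (w := v₅) (by simp) ((h3 v₅).mpr (by simp))
  · simp only [List.nodup_cons, List.mem_cons, List.not_mem_nil, or_false, List.nodup_nil]
    grind
  · simp only [List.mem_cons, List.not_mem_nil, or_false, Set.mem_insert_iff,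
      Set.mem_singleton_iff]
    clear hS hcl hsub hZ' h1Z
    grind
  · simp only [List.mem_cons, List.not_mem_nil, or_false]
    rintro r hr hrZ
    have := hZ' r hrZ
    tauto
  · rw [Set.disjoint_left]
    intro w hw hwZ
    have := hZ' w hwZ
    simp only [Set.mem_insert_iff, Set.mem_singleton_iff] at hw
    tauto
  · simp only [List.mem_cons, List.not_mem_nil, or_false, Set.mem_insert_iff,
      Set.mem_singleton_iff]
    rintro r (rfl | rfl | rfl | rfl | rfl)
    exacts [⟨v₃, by simp, (h3 _).mpr (by simp)⟩, ⟨v₃, by simp, (h3 _).mpr (by simp)⟩,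
      ⟨v₃, by simp, (h3 _).mpr (by simp)⟩, ⟨v₇, by simp, (h7 _).mpr (by simp)⟩,
      ⟨v₇, by simp, (h7 _).mpr (by simp)⟩]
  · exact ⟨v₇, by simp, v₉, h9Z, (h7 _).mpr (by simp)⟩
  · exact ((h4 v₂).mpr (by simp)).symm
  · exact (h4 v₆).mpr (by simp)
  · exact (h6 v₈).mpr (by simp)

lemma IsMinorCritical.isMinorOf_of_two_triangles (hG : IsMinorCritical G) {a b c c' : V}
    (hab : G.Adj a b) (hac : G.Adj a c) (hbc : G.Adj b c) (hac' : G.Adj a c') (hbc' : G.Adj b c')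
    (hcc : c ≠ c') : (wheel 6).IsMinorOf G := by
  obtain ⟨d, e, hd, he, ⟨h1, h2⟩ | ⟨h1, h2⟩⟩ := hG.exists_strip hab hac hbc hac' hbc' hcc
  · exact IsStrip.isMinorOf hG (v₁ := d) (v₂ := c) (v₃ := a) (v₄ := b) (v₅ := c') (v₆ := e)
      ⟨h1, fun w => by rw [hd]; tauto, fun w => by rw [he]; tauto, h2.symm⟩
  · exact IsStrip.isMinorOf hG (v₁ := d) (v₂ := c') (v₃ := a) (v₄ := b) (v₅ := c) (v₆ := e)
      ⟨h1, fun w => by rw [hd]; tauto, fun w => by rw [he]; tauto, h2.symm⟩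

end SimpleGraph

namespace SimpleGraph

section InducedPath

variable {V : Type*} {G : SimpleGraph V}

/-- A connected set contains an induced path between any two of its vertices. -/
lemma exists_induced_path {S : Set V} (hS : (G.induce S).Connected) {x y : V} (hx : x ∈ S)
    (hy : y ∈ S) : ∃ (m : ℕ) (q : ℕ → V), q 0 = x ∧ q m = y ∧ (∀ i ≤ m, q i ∈ S) ∧
      ∀ i j, i < j → j ≤ m → q i ≠ q j ∧ (G.Adj (q i) (q j) ↔ j = i + 1) := by
  classical
  have hex : ∃ m, ∃ q : ℕ → V, q 0 = x ∧ q m = y ∧ (∀ i ≤ m, q i ∈ S) ∧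
      ∀ i < m, G.Adj (q i) (q (i + 1)) := by
    obtain ⟨p⟩ := hS.preconnected ⟨x, hx⟩ ⟨y, hy⟩
    refine ⟨p.length, fun i => p.getVert i, by simp, by simp, fun i _ => Subtype.prop _, ?_⟩
    intro i hi
    exact p.adj_getVert_succ hi
  obtain ⟨q, h0, hm, hqS, hadj⟩ := Nat.find_spec hex
  have hmin := fun n => Nat.find_min (m := n) hex
  generalize Nat.find hex = m at hm hqS hadj hmin
  have short : ∀ i j, i < j → j ≤ m → ∀ s, i + s ≤ j → 0 < s → (i + 1 + s ≤ m →
      G.Adj (q i) (q (i + 1 + s))) → (m = i + s → q i = y) → False := by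
    intro i j hij hj s hs hs0 hadj' hend
    refine hmin (m - s) (by omega) ⟨fun t => if t ≤ i then q t else q (t + s), by simp [h0], ?_, ?_, ?_⟩
    · dsimp only
      split_ifs with h
      · have : m = i + s := by omega
        rw [← hend this]
        congr 1
        omega
      · rw [← hm]
        congr 1
        omega
    · intro t ht
      dsimp only
      split_ifs with h
      · exact hqS t (by omega)
      · exact hqS _ (by omega)
    · intro t ht
      dsimp only
      rcases lt_trichotomy t i with h | rfl | h
      · rw [if_pos h.le, if_pos (by omega)]
        exact hadj t (by omega)
      · rw [if_pos le_rfl, if_neg (by omega)]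
        exact hadj' (by omega)
      · rw [if_neg (by omega), if_neg (by omega), add_right_comm]
        exact hadj _ (by omega)
  refine ⟨m, q, h0, hm, hqS, fun i j hij hj => ⟨fun heq => ?_, fun hA => ?_, ?_⟩⟩
  · refine short i j hij hj (j - i) (by omega) (by omega) (fun h => ?_) (fun h => ?_)
    · rw [heq, show i + 1 + (j - i) = j + 1 by omega]
      exact hadj j (by omega)
    · rw [heq, ← hm]
      congr 1
      omega
  · by_contra hne
    refine short i j hij hj (j - i - 1) (by omega) (by omega) (fun h => ?_) (fun h => by omega)
    rwa [show i + 1 + (j - i - 1) = j by omega]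
  · rintro rfl
    exact hadj i (by omega)

/-- The first `k` values of `f` form an induced cycle. -/
def IsInducedCycle (G : SimpleGraph V) (k : ℕ) (f : ℕ → V) : Prop :=
  ∀ i j, i < j → j < k → f i ≠ f j ∧ (G.Adj (f i) (f j) ↔ j = i + 1 ∨ i = 0 ∧ j + 1 = k)

lemma conn_image_Icc {f : ℕ → V} (hf : ∀ i, G.Adj (f i) (f (i + 1))) {i j : ℕ} (hij : i ≤ j) :
    (G.induce (f '' Set.Icc i j)).Connected := by
  induction j, hij using Nat.le_induction with
  | base =>
    rw [Set.Icc_self, Set.image_singleton]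
    exact conn_singleton (f i)
  | succ j hij ih =>
    have : f '' Set.Icc i (j + 1) = insert (f (j + 1)) (f '' Set.Icc i j) := by
      rw [← Set.image_insert_eq]
      congr 1
      ext x
      simp only [Set.mem_Icc, Set.mem_insert_iff]
      omega
    rw [this]
    exact conn_insert ih (Set.mem_image_of_mem f (Set.right_mem_Icc.mpr hij)) (hf j).symm

/-- A shortest induced cycle of length at least four, listed periodically, together with the apexes
of the triangles on its edges, in a graph whose edges lie in at most one triangle. -/
structure IsShortCycle (G : SimpleGraph V) (k : ℕ) (f p : ℕ → V) : Prop where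
  four_le : 4 ≤ k
  cycle : IsInducedCycle G k f
  periodic : ∀ i, f (i + k) = f i
  periodic' : ∀ i, p (i + k) = p i
  adj_left : ∀ i, G.Adj (p i) (f i)
  adj_right : ∀ i, G.Adj (p i) (f (i + 1))
  min : ∀ m g, 4 ≤ m → m < k → ¬ IsInducedCycle G m g
  uniq : ∀ a b c d, G.Adj a b → G.Adj a c → G.Adj b c → G.Adj a d → G.Adj b d → c = d

lemma IsInducedCycle.succ {k : ℕ} {f : ℕ → V} (h : IsInducedCycle G k f)
    (hp : ∀ i, f (i + k) = f i) : IsInducedCycle G k (fun i => f (i + 1)) := by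
  intro i j hij hj
  dsimp only
  by_cases hjk : j + 1 < k
  · rw [(h (i + 1) (j + 1) (by omega) hjk).2]
    exact ⟨(h (i + 1) (j + 1) (by omega) hjk).1, by omega⟩
  · have e : f (j + 1) = f 0 := by rw [← hp 0]; congr 1; omega
    rw [e, G.adj_comm, (h 0 (i + 1) (by omega) (by omega)).2]
    exact ⟨(h 0 (i + 1) (by omega) (by omega)).1.symm, by omega⟩

lemma IsInducedCycle.shift {k : ℕ} {f : ℕ → V} (h : IsInducedCycle G k f)
    (hp : ∀ i, f (i + k) = f i) (s : ℕ) : IsInducedCycle G k (fun i => f (i + s)) := by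
  induction s with
  | zero => exact h
  | succ s ih =>
    have := ih.succ fun i => by rw [add_right_comm]; exact hp _
    intro i j
    have := this i j
    dsimp only at this ⊢
    rwa [show i + 1 + s = i + (s + 1) by omega, show j + 1 + s = j + (s + 1) by omega] at this

lemma IsInducedCycle.adj_succ {k : ℕ} {f : ℕ → V} (h : IsInducedCycle G k f) (hk : 3 ≤ k)
    (hp : ∀ i, f (i + k) = f i) (i : ℕ) : G.Adj (f i) (f (i + 1)) := by
  have := ((h.shift hp i 0 1 (by omega) (by omega)).2).mpr (by simp)
  dsimp only at this
  rwa [zero_add, add_comm] at this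

namespace IsShortCycle

variable {k : ℕ} {f p : ℕ → V}

lemma shift (h : IsShortCycle G k f p) (s : ℕ) :
    IsShortCycle G k (fun i => f (i + s)) (fun i => p (i + s)) where
  four_le := h.four_le
  cycle := h.cycle.shift h.periodic s
  periodic i := by rw [add_right_comm]; exact h.periodic _
  periodic' i := by rw [add_right_comm]; exact h.periodic' _
  adj_left i := h.adj_left _
  adj_right i := by rw [add_right_comm]; exact h.adj_right _
  min := h.min
  uniq := h.uniq

lemma adj_succ (h : IsShortCycle G k f p) (i : ℕ) : G.Adj (f i) (f (i + 1)) :=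
  h.cycle.adj_succ (by have := h.four_le; omega) h.periodic i

lemma ne_zero (h : IsShortCycle G k f p) {j : ℕ} (hj : j < k) : p 0 ≠ f j := by
  intro he
  have h0 := h.adj_left 0
  have h1 := h.adj_right 0
  have hk := h.four_le
  rw [he] at h0 h1
  rcases Nat.lt_trichotomy j 1 with hj1 | rfl | hj1
  · obtain rfl : j = 0 := by omega
    exact h0.ne rfl
  · exact h1.ne rfl
  · have h2 := (h.cycle 0 j (by omega) hj).2.mp h0.symm
    have h3 := (h.cycle 1 j (by omega) hj).2.mp h1.symm
    omega

lemma adj_zero (h : IsShortCycle G k f p) {j : ℕ} (hj : j < k) (ha : G.Adj (p 0) (f j)) :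
    j = 0 ∨ j = 1 := by
  classical
  by_contra hj1
  have hk := h.four_le
  have hex : ∃ j, 2 ≤ j ∧ j < k ∧ G.Adj (p 0) (f j) := ⟨j, by omega, hj, ha⟩
  obtain ⟨h2, hjk, hadj⟩ := Nat.find_spec hex
  have hmin := fun n => Nat.find_min (m := n) hex
  generalize Nat.find hex = j at h2 hjk hadj hmin
  have h0 := h.adj_left 0
  have h1 := h.adj_right 0
  rw [zero_add] at h1
  have h01 : G.Adj (f 0) (f 1) := h.adj_succ 0
  have hj2 : j ≠ 2 := by
    rintro rfl
    exact (h.cycle 0 2 (by omega) hjk).1 (h.uniq _ _ _ _ h1 h0 h01.symm hadj (h.adj_succ 1))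
  have hj3 : j + 1 ≠ k := by
    intro hj3
    exact (h.cycle 1 j (by omega) hjk).1 (h.uniq _ _ _ _ h0 h1 h01 hadj
      ((h.cycle 0 j (by omega) hjk).2.mpr (Or.inr ⟨rfl, hj3⟩)))
  refine h.min (j + 1) (fun i => if i = 0 then p 0 else f i) (by omega) (by omega) ?_
  intro i i' hi hi'
  dsimp only
  rw [if_neg (show i' ≠ 0 by omega)]
  split_ifs with hi0
  · refine ⟨h.ne_zero (by omega), fun ha => ?_, ?_⟩
    · by_contra hno
      exact hmin i' (by omega) ⟨by omega, by omega, ha⟩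
    · rintro (rfl | ⟨-, hij⟩)
      · rwa [hi0]
      · rwa [show i' = j by omega]
  · rw [(h.cycle i i' hi (by omega)).2]
    exact ⟨(h.cycle i i' hi (by omega)).1, by omega⟩

lemma apex_ne (h : IsShortCycle G k f p) {i j : ℕ} (hi : i < k) (hj : j < k) : p i ≠ f j := by
  have := (h.shift i).ne_zero (j := if i ≤ j then j - i else j + k - i) (by split_ifs <;> omega)
  simp only [zero_add] at this
  split_ifs at this with hij
  · rwa [Nat.sub_add_cancel hij] at this
  · rwa [Nat.sub_add_cancel (by omega), h.periodic] at this

lemma adj_apex (h : IsShortCycle G k f p) {i j : ℕ} (hi : i < k) (hj : j < k)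
    (ha : G.Adj (p i) (f j)) : j = i ∨ j = i + 1 ∨ j = 0 ∧ i + 1 = k := by
  have := (h.shift i).adj_zero (j := if i ≤ j then j - i else j + k - i) (by split_ifs <;> omega)
  simp only [zero_add] at this
  split_ifs at this with hij
  · rw [Nat.sub_add_cancel hij] at this
    have := this ha
    omega
  · rw [Nat.sub_add_cancel (by omega), h.periodic] at this
    have := this ha
    omega

lemma apex_injective (h : IsShortCycle G k f p) {i j : ℕ} (hij : i < j) (hj : j < k) :
    p i ≠ p j := by
  intro he
  have h1 := h.adj_left j
  have h2 := h.adj_left i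
  have hk := h.four_le
  rw [← he] at h1
  rw [he] at h2
  have h3 := h.adj_apex (by omega) hj h1
  have h4 := h.adj_apex hj (by omega) h2
  omega

lemma apex_adj_zero (h : IsShortCycle G k f p) {j : ℕ} (hj0 : 0 < j) (hj : j < k)
    (ha : G.Adj (p 0) (p j)) : 2 ≤ j ∧ k ≤ j + 2 := by
  have hk := h.four_le
  have h0 := h.adj_left 0
  have h1 := h.adj_right 0
  rw [zero_add] at h1
  have h01 : G.Adj (f 0) (f 1) := h.adj_succ 0
  have hj1 : j ≠ 1 := by
    rintro rfl
    exact h.apex_ne hj (by omega) (h.uniq _ _ _ _ h1 h0 h01.symm ha (h.adj_left 1).symm).symm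
  refine ⟨by omega, ?_⟩
  by_contra hlt
  refine h.min (j + 2) (fun i => if i = 0 then p 0 else if i = j + 1 then p j else f i) (by omega)
    (by omega) ?_
  intro i i' hi hi'
  dsimp only
  rw [if_neg (show i' ≠ 0 by omega), if_neg (show i ≠ j + 1 by omega)]
  split_ifs with hi0 hi1 hi1
  · subst hi0
    rw [iff_true_left ha]
    exact ⟨h.apex_injective hj0 hj, by omega⟩
  · subst hi0
    refine ⟨h.apex_ne (by omega) (by omega), fun ha' => ?_, ?_⟩
    · have := h.adj_apex (by omega) (by omega) ha'
      omega
    · rintro (rfl | h')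
      · exact h1
      · omega
  · refine ⟨(h.apex_ne hj (by omega)).symm, fun ha' => ?_, ?_⟩
    · have := h.adj_apex hj (by omega) ha'.symm
      omega
    · rintro (rfl | h')
      · obtain rfl : i = j := by omega
        exact (h.adj_left i).symm
      · omega
  · rw [(h.cycle i i' hi (by omega)).2]
    exact ⟨(h.cycle i i' hi (by omega)).1, by omega⟩

lemma apex_adj (h : IsShortCycle G k f p) {j : ℕ} (hj0 : 0 < j) (hj : j < k)
    (ha : G.Adj (p 0) (p j)) : j = 2 := by
  have h1 := h.apex_adj_zero hj0 hj ha
  have h2 := (h.shift j).apex_adj_zero (j := k - j) (by omega) (by omega) (by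
    rw [zero_add, Nat.sub_add_cancel hj.le]
    rw [← zero_add k, h.periodic']
    exact ha.symm)
  omega

end IsShortCycle

end InducedPath

end SimpleGraph

namespace SimpleGraph

variable {V : Type*} {G : SimpleGraph V} {k : ℕ} {f p : ℕ → V}

/-- Four apices attached to a connected set away from the cycle yield a `W₆`-minor. -/
lemma IsShortCycle.isMinorOf (h : IsShortCycle G k f p) {Q : Set V}
    (hQ : (G.induce Q).Connected) (hQf : ∀ i < k, f i ∉ Q) (hQp : ∀ i < k, p i ∉ Q) {a b d : ℕ}
    (ha : 0 < a) (hab : a < b) (hbd : b < d) (hdk : d < k) (h₀ : ∃ z ∈ Q, G.Adj (p 0) z)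
    (hₐ : ∃ z ∈ Q, G.Adj (p a) z) (hb : ∃ z ∈ Q, G.Adj (p b) z) (hd : ∃ z ∈ Q, G.Adj (p d) z) :
    (wheel 6).IsMinorOf G := by
  have hfk : f k = f 0 := by simpa using h.periodic 0
  have hinj : ∀ i j, 1 ≤ i → i < j → j ≤ k → f i ≠ f j := by
    intro i j hi hij hj
    have := ((h.shift 1).cycle (i - 1) (j - 1) (by omega) (by omega)).1
    simpa [show i - 1 + 1 = i by omega, show j - 1 + 1 = j by omega] using this
  have hinj' : ∀ i j, 1 ≤ i → i ≤ k → 1 ≤ j → j ≤ k → f i = f j → i = j := by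
    intro i j h1 h2 h3 h4 h5
    rcases lt_trichotomy i j with h6 | h6 | h6
    · exact absurd h5 (hinj i j h1 h6 h4)
    · exact h6
    · exact absurd h5.symm (hinj j i h3 h6 h2)
  have hfp : ∀ i j, j ≤ k → i < k → f j ≠ p i := by
    intro i j hj hi
    rcases hj.lt_or_eq with hj | rfl
    · exact (h.apex_ne hi hj).symm
    · rw [hfk]
      exact (h.apex_ne hi (by omega)).symm
  have hfQ : ∀ j ≤ k, f j ∉ Q := by
    intro j hj
    rcases hj.lt_or_eq with hj | rfl
    · exact hQf j hj
    · rw [hfk]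
      exact hQf 0 (by omega)
  have hpp : ∀ i j, i < k → j < k → p i = p j → i = j := by
    intro i j hi hj he
    rcases lt_trichotomy i j with h6 | h6 | h6
    · exact absurd he (h.apex_injective h6 hj)
    · exact h6
    · exact absurd he.symm (h.apex_injective h6 hi)
  have hmem : ∀ i j v, v ∈ f '' Set.Icc i j ↔ ∃ s, i ≤ s ∧ s ≤ j ∧ v = f s := by
    intro i j v
    simp only [Set.mem_image, Set.mem_Icc, and_assoc, eq_comm]
  have arc_arc : ∀ i j i' j', 1 ≤ i → j < i' → j' ≤ k →
      Disjoint (f '' Set.Icc i j) (f '' Set.Icc i' j') := by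
    intro i j i' j' h1 h2 h3
    rw [Set.disjoint_left]
    intro v hv hv'
    obtain ⟨s, hs1, hs2, rfl⟩ := (hmem _ _ _).mp hv
    obtain ⟨t, ht1, ht2, hst⟩ := (hmem _ _ _).mp hv'
    have := hinj' s t (by omega) (by omega) (by omega) (by omega) hst
    omega
  have arc_apex : ∀ i j c, j ≤ k → c < k → Disjoint (f '' Set.Icc i j) {p c} := by
    intro i j c h1 h2
    rw [Set.disjoint_singleton_right]
    intro hv
    obtain ⟨s, hs1, hs2, hs⟩ := (hmem _ _ _).mp hv
    exact hfp c s (by omega) h2 hs.symm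
  have arc_hub : ∀ i j, j ≤ k → Disjoint (insert (p a) (insert (p d) Q)) (f '' Set.Icc i j) := by
    intro i j h1
    rw [Set.disjoint_left]
    intro v hv hv'
    obtain ⟨s, hs1, hs2, rfl⟩ := (hmem _ _ _).mp hv'
    rcases hv with hv | hv | hv
    · exact hfp _ _ (by omega) (by omega) hv
    · exact hfp _ _ (by omega) (by omega) hv
    · exact hfQ s (by omega) hv
  have apex_hub : ∀ c, c < k → c ≠ a → c ≠ d →
      Disjoint (insert (p a) (insert (p d) Q)) {p c} := by
    intro c h1 h2 h3
    rw [Set.disjoint_singleton_right]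
    rintro (hv | hv | hv)
    · exact h2 (hpp _ _ h1 (by omega) hv)
    · exact h3 (hpp _ _ h1 (by omega) hv)
    · exact hQp c h1 hv
  have hmemf : ∀ i j s, i ≤ s → s ≤ j → f s ∈ f '' Set.Icc i j :=
    fun i j s h1 h2 => Set.mem_image_of_mem f ⟨h1, h2⟩
  obtain ⟨za, hza, hza'⟩ := hₐ
  obtain ⟨zd, hzd, hzd'⟩ := hd
  refine wheel_isMinorOf (insert (p a) (insert (p d) Q))
    ![{p 0}, f '' Set.Icc 1 a, f '' Set.Icc (a + 1) b, {p b}, f '' Set.Icc (b + 1) d,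
      f '' Set.Icc (d + 1) k] ?_ ?_ ?_ ?_ ?_ ?_
  · exact conn_insert (conn_insert hQ hzd hzd') (Or.inr hza) hza'
  · intro i
    fin_cases i
    exacts [conn_singleton _, conn_image_Icc h.adj_succ (by omega),
      conn_image_Icc h.adj_succ (by omega), conn_singleton _,
      conn_image_Icc h.adj_succ (by omega), conn_image_Icc h.adj_succ (by omega)]
  · intro i
    fin_cases i
    exacts [apex_hub 0 (by omega) (by omega) (by omega), arc_hub _ _ (by omega),
      arc_hub _ _ (by omega), apex_hub b (by omega) (by omega) (by omega),
      arc_hub _ _ (by omega), arc_hub _ _ le_rfl]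
  · have hlt : ∀ i j : Fin 6, i < j → Disjoint
        ((![{p 0}, f '' Set.Icc 1 a, f '' Set.Icc (a + 1) b, {p b}, f '' Set.Icc (b + 1) d,
          f '' Set.Icc (d + 1) k] : Fin 6 → Set V) i)
        ((![{p 0}, f '' Set.Icc 1 a, f '' Set.Icc (a + 1) b, {p b}, f '' Set.Icc (b + 1) d,
          f '' Set.Icc (d + 1) k] : Fin 6 → Set V) j) := by
      intro i j hij
      fin_cases i <;> fin_cases j <;> first
        | exact absurd hij (by decide)
        | exact arc_arc _ _ _ _ (by omega) (by omega) (by omega)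
        | exact arc_apex _ _ _ (by omega) (by omega)
        | exact (arc_apex _ _ _ (by omega) (by omega)).symm
        | skip
      exact Set.disjoint_singleton.mpr fun he => by
        have := hpp 0 b (by omega) (by omega) he
        omega
    intro i j hij
    rcases lt_or_gt_of_ne hij with h1 | h1
    · exact hlt i j h1
    · exact (hlt j i h1).symm
  · intro i
    fin_cases i
    · exact ⟨_, rfl, f 1, hmemf _ _ _ le_rfl (by omega), h.adj_right 0⟩
    · exact ⟨f a, hmemf _ _ _ (by omega) le_rfl, f (a + 1), hmemf _ _ _ le_rfl (by omega),
        h.adj_succ a⟩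
    · exact ⟨f b, hmemf _ _ _ (by omega) le_rfl, p b, rfl, (h.adj_left b).symm⟩
    · exact ⟨p b, rfl, f (b + 1), hmemf _ _ _ le_rfl (by omega), h.adj_right b⟩
    · exact ⟨f d, hmemf _ _ _ (by omega) le_rfl, f (d + 1), hmemf _ _ _ le_rfl (by omega),
        h.adj_succ d⟩
    · refine ⟨f k, hmemf _ _ _ (by omega) le_rfl, p 0, rfl, ?_⟩
      rw [hfk]
      exact (h.adj_left 0).symm
  · intro i
    have hpa : p a ∈ insert (p a) (insert (p d) Q) := Or.inl rfl
    have hpd : p d ∈ insert (p a) (insert (p d) Q) := Or.inr (Or.inl rfl)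
    have hq : ∀ z ∈ Q, z ∈ insert (p a) (insert (p d) Q) := fun z hz => Or.inr (Or.inr hz)
    fin_cases i
    · obtain ⟨z, hz, hz'⟩ := h₀
      exact ⟨z, hq z hz, p 0, rfl, hz'.symm⟩
    · exact ⟨p a, hpa, f a, hmemf _ _ _ (by omega) le_rfl, h.adj_left a⟩
    · exact ⟨p a, hpa, f (a + 1), hmemf _ _ _ le_rfl (by omega), h.adj_right a⟩
    · obtain ⟨z, hz, hz'⟩ := hb
      exact ⟨z, hq z hz, p b, rfl, hz'.symm⟩
    · exact ⟨p d, hpd, f d, hmemf _ _ _ (by omega) le_rfl, h.adj_left d⟩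
    · exact ⟨p d, hpd, f (d + 1), hmemf _ _ _ le_rfl (by omega), h.adj_right d⟩

variable [DecidableEq V] [Fintype V] [DecidableRel G.Adj]

lemma IsMinorCritical.exists_inducedCycle (hG : IsMinorCritical G)
    (huniq : ∀ a b c d, G.Adj a b → G.Adj a c → G.Adj b c → G.Adj a d → G.Adj b d → c = d) :
    ∃ k f, 4 ≤ k ∧ IsInducedCycle G k f := by
  have hn := hG.card
  obtain ⟨a⟩ : Nonempty V := Fintype.card_pos_iff.mp (by omega)
  have hda := hG.degree_eq_four a
  obtain ⟨x, hax⟩ : (G.neighborFinset a).Nonempty := by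
    rw [← Finset.card_pos, card_neighborFinset_eq_degree, hda]
    norm_num
  rw [mem_neighborFinset] at hax
  obtain ⟨x', hxa, hxx⟩ := hG.exists_triangle hax
  obtain ⟨y, y', hy⟩ := exists_two_nbrs hda hax hxa.symm hxx.ne'
  have hNa := hy.2.2.2.2.2
  have hay : G.Adj a y := (hNa y).mpr (by simp)
  have hay' : G.Adj a y' := (hNa y').mpr (by simp)
  have hcard : ({a, x', y'} : Set V).ncard ≤ 3 := by
    rw [show ({a, x', y'} : Set V) = (({a, x', y'} : Finset V) : Set V) by simp,
      Set.ncard_coe_finset]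
    exact Finset.card_le_three
  obtain ⟨m, q, h0, hm, hqS, hq⟩ := exists_induced_path (hG.conn.2 _ hcard) (x := x) (y := y)
    (by simp only [Set.mem_compl_iff, Set.mem_insert_iff, Set.mem_singleton_iff]
        have := hax.ne
        have := hxx.ne
        grind)
    (by simp only [Set.mem_compl_iff, Set.mem_insert_iff, Set.mem_singleton_iff]
        have := hay.ne
        grind)
  simp only [Set.mem_compl_iff, Set.mem_insert_iff, Set.mem_singleton_iff] at hqS
  have hm0 : m ≠ 0 := by
    rintro rfl
    exact hy.1 (hm.symm.trans h0)
  have hm1 : m ≠ 1 := by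
    rintro rfl
    have hxy := (hq 0 1 (by omega) le_rfl).2.mpr rfl
    rw [h0, hm] at hxy
    exact hy.2.1 (huniq a x y x' hax hay hxy hxa.symm hxx.symm)
  refine ⟨m + 2, fun i => if i = 0 then a else q (i - 1), by omega, ?_⟩
  intro i j hij hj
  dsimp only
  rw [if_neg (show j ≠ 0 by omega)]
  split_ifs with hi
  · subst hi
    have h1 := hqS (j - 1) (by omega)
    refine ⟨by tauto, fun ha => ?_, ?_⟩
    · rcases (hNa _).mp ha with h2 | h2 | h2 | h2
      · left
        by_contra hj1
        rw [← h0] at h2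
        exact (hq 0 (j - 1) (by omega) (by omega)).1 h2.symm
      · tauto
      · right
        by_contra hj1
        rw [← hm] at h2
        exact (hq (j - 1) m (by omega) (by omega)).1 h2
      · tauto
    · rintro (rfl | ⟨-, h2⟩)
      · simpa [h0] using hax
      · obtain rfl : j = m + 1 := by omega
        simpa [hm] using hay
  · have := hq (i - 1) (j - 1) (by omega) (by omega)
    rw [this.2]
    exact ⟨this.1, by omega⟩

lemma IsMinorCritical.exists_isShortCycle (hG : IsMinorCritical G)
    (huniq : ∀ a b c d, G.Adj a b → G.Adj a c → G.Adj b c → G.Adj a d → G.Adj b d → c = d) :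
    ∃ k f p, IsShortCycle G k f p := by
  classical
  have hex : ∃ k f, 4 ≤ k ∧ IsInducedCycle G k f := hG.exists_inducedCycle huniq
  obtain ⟨f, hk, hf⟩ := Nat.find_spec hex
  have hmin := fun n => Nat.find_min (m := n) hex
  generalize Nat.find hex = k at hk hf hmin
  have hper : ∀ i, f ((i + k) % k) = f (i % k) := fun i => by rw [Nat.add_mod_right]
  have hcyc : IsInducedCycle G k (fun i => f (i % k)) := by
    intro i j hij hj
    dsimp only
    rw [Nat.mod_eq_of_lt hj, Nat.mod_eq_of_lt (hij.trans hj)]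
    exact hf i j hij hj
  have hadj := hcyc.adj_succ (by omega) hper
  have hp : ∀ i, ∃ d, G.Adj d (f (i % k)) ∧ G.Adj d (f ((i + 1) % k)) :=
    fun i => hG.exists_triangle (hadj i)
  choose p hp1 hp2 using hp
  refine ⟨k, fun i => f (i % k), fun i => p (i % k), hk, hcyc, hper,
    fun i => by rw [Nat.add_mod_right], fun i => ?_, fun i => ?_, ?_, huniq⟩
  · simpa using hp1 (i % k)
  · simpa using hp2 (i % k)
  · exact fun m g hm hmk hg => hmin m hmk ⟨g, hm, hg⟩

lemma IsMinorCritical.isMinorOf_of_unique_triangle (hG : IsMinorCritical G)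
    (huniq : ∀ a b c d, G.Adj a b → G.Adj a c → G.Adj b c → G.Adj a d → G.Adj b d → c = d) :
    (wheel 6).IsMinorOf G := by
  classical
  obtain ⟨k, f, p, h⟩ := hG.exists_isShortCycle huniq
  have hk := h.four_le
  have hNf : ∀ i < k, ∀ w, G.Adj (f i) w → (∃ j < k, w = f j) ∨ ∃ j < k, w = p j := by
    intro i hi w hw
    obtain ⟨s, hs1, hs2⟩ : ∃ s, f (s + 1) = f i ∧ s < k := by
      rcases Nat.eq_zero_or_pos i with rfl | hi0
      · refine ⟨k - 1, ?_, by omega⟩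
        rw [show k - 1 + 1 = 0 + k by omega, h.periodic]
      · exact ⟨i - 1, by rw [Nat.sub_add_cancel hi0], by omega⟩
    have hmod : ∀ j, f j = f (j % k) ∧ p j = p (j % k) := by
      intro j
      constructor
      · exact (Function.Periodic.map_mod_nat h.periodic j).symm
      · exact (Function.Periodic.map_mod_nat h.periodic' j).symm
    have h1 := h.adj_left (s + 1)
    have h2 := h.adj_right s
    have h3 := h.adj_succ (s + 1)
    have h4 := h.adj_succ s
    rw [← hs1] at hw
    have hN := nbrs_eq (hG.degree_eq_four (f (s + 1))) h4.symm h3 h2.symm h1.symm ?_ ?_ ?_ ?_ ?_ ?_ w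
    · rcases hN.mp hw with rfl | rfl | rfl | rfl
      · exact Or.inl ⟨_, Nat.mod_lt _ (by omega), (hmod _).1⟩
      · exact Or.inl ⟨_, Nat.mod_lt _ (by omega), (hmod _).1⟩
      · exact Or.inr ⟨_, Nat.mod_lt _ (by omega), (hmod _).2⟩
      · exact Or.inr ⟨_, Nat.mod_lt _ (by omega), (hmod _).2⟩
    · have : f s ≠ f (s + 2) := by
        simpa [add_comm] using ((h.shift s).cycle 0 2 (by omega) (by omega)).1
      exact this
    · exact (h.adj_left s).ne'
    · have := (h.shift s).apex_ne (i := 1) (j := 0) (by omega) (by omega)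
      simpa [add_comm, eq_comm] using this
    · have : p s ≠ f (s + 2) := by
        simpa [add_comm] using (h.shift s).apex_ne (i := 0) (j := 2) (by omega) (by omega)
      exact this.symm
    · exact (h.adj_right (s + 1)).ne'
    · have := (h.shift s).apex_injective (i := 0) (j := 1) (by omega) (by omega)
      simpa [add_comm] using this
  have h0 := h.adj_left 0
  have h1 := h.adj_right 0
  rw [zero_add] at h1
  have h01 := h.adj_succ 0
  obtain ⟨r, r', hr⟩ := exists_two_nbrs (hG.degree_eq_four (p 0)) h0 h1 h01.ne
  have hNp := hr.2.2.2.2.2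
  have hout : ∀ r, G.Adj (p 0) r → r ≠ f 0 → r ≠ f 1 → r ≠ p 2 →
      ¬ ((∃ j < k, r = f j) ∨ ∃ j < k, r = p j) := by
    rintro r hr hr0 hr1 hr2 (⟨j, hj, rfl⟩ | ⟨j, hj, rfl⟩)
    · rcases h.adj_zero hj hr with rfl | rfl
      exacts [hr0 rfl, hr1 rfl]
    · rcases Nat.eq_zero_or_pos j with rfl | hj0
      · exact hr.ne rfl
      · exact hr2 (by rw [h.apex_adj hj0 hj hr])
  obtain ⟨q, hq⟩ : ∃ q, ¬ ((∃ j < k, q = f j) ∨ ∃ j < k, q = p j) := by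
    by_cases hr2 : r = p 2
    · exact ⟨r', hout r' ((hNp r').mpr (by simp)) hr.2.2.1 hr.2.2.2.1 (hr2 ▸ hr.2.2.2.2.1)⟩
    · exact ⟨r, hout r ((hNp r).mpr (by simp)) hr.1 hr.2.1 hr2⟩
  obtain ⟨S, hS⟩ : ∃ S : Set V, ∀ w, w ∈ S ↔ ¬ ((∃ j < k, w = f j) ∨ ∃ j < k, w = p j) :=
    ⟨{w | _}, fun w => Iff.rfl⟩
  have hqS := (hS q).mpr hq
  have hsub : ∀ w ∈ G.comp S q, w ∈ S := fun w hw => comp_subset hw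
  have hcl : ∀ z ∈ G.comp S q, ∀ w, G.Adj z w → w ∈ S → w ∈ G.comp S q :=
    fun z hz w hzw hw => comp_closed hz hzw hw
  have hqQ := mem_comp_self (G := G) hqS
  have hQ := conn_comp (G := G) hqS
  generalize G.comp S q = Q at hsub hcl hqQ hQ
  have hQf : ∀ i < k, f i ∉ Q := fun i hi hQ => (hS _).mp (hsub _ hQ) (Or.inl ⟨i, hi, rfl⟩)
  have hQp : ∀ i < k, p i ∉ Q := fun i hi hQ => (hS _).mp (hsub _ hQ) (Or.inr ⟨i, hi, rfl⟩)
  set I := (Finset.range k).filter fun i => ∃ z ∈ Q, G.Adj (p i) z with hI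
  have hmI : ∀ i, i ∈ I ↔ i < k ∧ ∃ z ∈ Q, G.Adj (p i) z := by simp [hI]
  have hI4 : 4 ≤ I.card := by
    refine (hG.conn.four_le (Q := Q.toFinset) (R := I.image p) (w := f 0)
      ⟨q, by simpa using hqQ⟩ ?_ ?_ ?_ ?_).trans Finset.card_image_le
    · rw [Finset.disjoint_left]
      intro w hw hw'
      obtain ⟨i, hi, rfl⟩ := Finset.mem_image.mp hw'
      exact hQp i ((hmI i).mp hi).1 (by simpa using hw)
    · intro z hz w hzw
      rw [Set.mem_toFinset] at hz ⊢
      by_cases hw : w ∈ S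
      · exact Or.inl (hcl z hz w hzw hw)
      · rw [hS, not_not] at hw
        right
        rcases hw with ⟨j, hj, rfl⟩ | ⟨j, hj, rfl⟩
        · exact absurd (hNf j hj z hzw.symm) ((hS z).mp (hsub z hz))
        · exact Finset.mem_image_of_mem p ((hmI j).mpr ⟨hj, z, hz, hzw.symm⟩)
    · rw [Set.mem_toFinset]
      exact hQf 0 (by omega)
    · intro hmem
      obtain ⟨i, hi, hi'⟩ := Finset.mem_image.mp hmem
      exact h.apex_ne ((hmI i).mp hi).1 (by omega) hi'
  obtain ⟨J, hJI, hJ⟩ := Finset.exists_subset_card_eq hI4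
  set e := J.orderEmbOfFin hJ with he
  have heI : ∀ i, e i ∈ I := fun i => hJI (J.orderEmbOfFin_mem hJ i)
  have hlt : ∀ i j, i < j → e i < e j := fun i j hij => e.strictMono hij
  have l01 := hlt 0 1 (by decide)
  have l12 := hlt 1 2 (by decide)
  have l23 := hlt 2 3 (by decide)
  have m0 := (hmI _).mp (heI 0)
  have m1 := (hmI _).mp (heI 1)
  have m2 := (hmI _).mp (heI 2)
  have m3 := (hmI _).mp (heI 3)
  have hsf : ∀ i < k, ∃ j < k, f (i + e 0) = f j ∧ p (i + e 0) = p j := by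
    intro i hi
    exact ⟨_, Nat.mod_lt _ (by omega), (Function.Periodic.map_mod_nat h.periodic _).symm,
      (Function.Periodic.map_mod_nat h.periodic' _).symm⟩
  refine (h.shift (e 0)).isMinorOf hQ (a := e 1 - e 0) (b := e 2 - e 0) (d := e 3 - e 0) ?_ ?_
    (by omega) (by omega) (by omega) (by omega) ?_ ?_ ?_ ?_
  · intro i hi
    obtain ⟨j, hj, hj1, hj2⟩ := hsf i hi
    rw [hj1]
    exact hQf j hj
  · intro i hi
    obtain ⟨j, hj, hj1, hj2⟩ := hsf i hi
    rw [hj2]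
    exact hQp j hj
  · simpa using m0.2
  · rw [Nat.sub_add_cancel l01.le]
    exact m1.2
  · rw [Nat.sub_add_cancel (l01.trans l12).le]
    exact m2.2
  · rw [Nat.sub_add_cancel ((l01.trans l12).trans l23).le]
    exact m3.2

theorem IsMinorCritical.isMinorOf (hG : IsMinorCritical G) : (wheel 6).IsMinorOf G := by
  by_cases h : ∀ a b c d, G.Adj a b → G.Adj a c → G.Adj b c → G.Adj a d → G.Adj b d → c = d
  · exact hG.isMinorOf_of_unique_triangle h
  · push Not at h
    obtain ⟨a, b, c, d, h1, h2, h3, h4, h5, h6⟩ := h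
    exact hG.isMinorOf_of_two_triangles h1 h2 h3 h4 h5 h6

end SimpleGraph

namespace SimpleGraph

variable {V : Type*} {G : SimpleGraph V}

lemma IsMinorOf.mono {W : Type*} {H : SimpleGraph W} {G' : SimpleGraph V} (h : H.IsMinorOf G)
    (hle : G ≤ G') : H.IsMinorOf G' := by
  obtain ⟨φ, h1, h2, h3, h4⟩ := h
  exact ⟨φ, h1, fun w => (h2 w).mono (comap_monotone _ hle), h3, fun w₁ w₂ h =>
    let ⟨a, ha, b, hb, hab⟩ := h4 h
    ⟨a, ha, b, hb, hle hab⟩⟩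

/-- The graph obtained by identifying `y` with `x`. -/
def contract (G : SimpleGraph V) (x y : V) : SimpleGraph {v // v ≠ y} where
  Adj a b := a ≠ b ∧ (G.Adj a b ∨ ((a : V) = x ∧ G.Adj y b) ∨ ((b : V) = x ∧ G.Adj a y))
  symm := ⟨fun a b => by
    simp only [G.adj_comm, ne_eq, eq_comm]
    tauto⟩
  loopless := ⟨fun a h => h.1 rfl⟩

lemma IsMinorOf.of_contract {W : Type*} {H : SimpleGraph W} {x y : V} (hxy : G.Adj x y)
    (h : H.IsMinorOf (G.contract x y)) : H.IsMinorOf G := by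
  obtain ⟨φ, h1, h2, h3, h4⟩ := h
  refine ⟨fun w => {v | ∃ a ∈ φ w, v = a ∨ (v = y ∧ (a : V) = x)}, ?_, ?_, ?_, ?_⟩
  · intro w
    obtain ⟨a, ha⟩ := h1 w
    exact ⟨a, a, ha, Or.inl rfl⟩
  · intro w
    refine conn_of_closed ?_ fun A hA hne hcl => Set.Subset.antisymm hA ?_
    · obtain ⟨a, ha⟩ := h1 w
      exact ⟨a, a, ha, Or.inl rfl⟩
    obtain ⟨a₀, ha₀, ha₀A⟩ : ∃ a ∈ φ w, (a : V) ∈ A := by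
      obtain ⟨v, hv⟩ := hne
      obtain ⟨a, ha, rfl | ⟨rfl, rfl⟩⟩ := hA hv
      · exact ⟨a, ha, hv⟩
      · exact ⟨a, ha, hcl _ hv _ ⟨a, ha, Or.inl rfl⟩ hxy.symm⟩
    have hall : ∀ b ∈ φ w, (b : V) ∈ A := by
      intro b hb
      refine mem_of_conn_closed (A := {a : {v // v ≠ y} | (a : V) ∈ A}) (h2 w) ?_ ha₀A ha₀ hb
      rintro a ha haw b hb ⟨-, hab | ⟨rfl, hab⟩ | ⟨rfl, hab⟩⟩
      · exact hcl a ha b ⟨b, hb, Or.inl rfl⟩ hab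
      · exact hcl y (hcl a ha y ⟨a, haw, Or.inr ⟨rfl, rfl⟩⟩ hxy) b ⟨b, hb, Or.inl rfl⟩ hab
      · exact hcl y (hcl a ha y ⟨b, hb, Or.inr ⟨rfl, rfl⟩⟩ hab) b ⟨b, hb, Or.inl rfl⟩ hxy.symm
    rintro v ⟨a, ha, rfl | ⟨rfl, rfl⟩⟩
    · exact hall a ha
    · exact hcl a (hall a ha) _ ⟨a, ha, Or.inr ⟨rfl, rfl⟩⟩ hxy
  · intro w₁ w₂ hw
    have hd := Set.disjoint_left.mp (h3 hw)
    refine Set.disjoint_left.mpr ?_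
    rintro v ⟨a, ha, hva⟩ ⟨b, hb, hvb⟩
    have hab : a = b := by
      rcases hva with rfl | ⟨rfl, hax⟩ <;> rcases hvb with hvb | ⟨hvb, hbx⟩
      · exact Subtype.ext hvb
      · exact absurd hvb a.2
      · exact absurd hvb.symm b.2
      · exact Subtype.ext (hax.trans hbx.symm)
    exact hd ha (hab ▸ hb)
  · intro w₁ w₂ hw
    obtain ⟨a, ha, b, hb, -, hab | ⟨rfl, hab⟩ | ⟨rfl, hab⟩⟩ := h4 hw
    · exact ⟨a, ⟨a, ha, Or.inl rfl⟩, b, ⟨b, hb, Or.inl rfl⟩, hab⟩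
    · exact ⟨y, ⟨a, ha, Or.inr ⟨rfl, rfl⟩⟩, b, ⟨b, hb, Or.inl rfl⟩, hab⟩
    · exact ⟨a, ⟨a, ha, Or.inl rfl⟩, y, ⟨b, hb, Or.inr ⟨rfl, rfl⟩⟩, hab⟩

lemma card_ne [Finite V] (y : V) : Nat.card {v // v ≠ y} + 1 = Nat.card V := by
  classical
  have := Fintype.ofFinite V
  rw [Nat.card_eq_fintype_card, Nat.card_eq_fintype_card, Fintype.card_subtype_compl]
  have : 0 < Fintype.card V := Fintype.card_pos_iff.mpr ⟨y⟩
  simp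
  omega

lemma exists_isFourCut_of_contract [DecidableEq V] [Fintype V] (hG : FourConnected G)
    (h6 : 6 ≤ Fintype.card V) {x y : V} (hxy : G.Adj x y)
    (hc : ¬ FourConnected (G.contract x y)) :
    ∃ A T B, IsFourCut G A T B ∧ x ∈ T ∧ y ∈ T := by
  classical
  have hcard := card_ne (V := V) y
  rw [Nat.card_eq_fintype_card] at hcard
  contrapose! hc
  refine fourConnected_of_four_le (by rw [Nat.card_eq_fintype_card] at *; omega) ?_
  intro Q R hQ hQR hR hN w hwQ
  by_contra hwR
  set p : {v // v ≠ y} → V → Prop := fun a v => v = a ∨ (v = y ∧ (a : V) = x) with hp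
  set A : Finset V := {v | ∃ a ∈ Q, v = a ∨ (v = y ∧ (a : V) = x)} with hA
  set T : Finset V := {v | ∃ a ∈ R, v = a ∨ (v = y ∧ (a : V) = x)} with hT
  have hAT : ∀ v ∈ A, v ∉ T := by
    intro v hv hv'
    simp only [hA, hT, Finset.mem_filter, Finset.mem_univ, true_and] at hv hv'
    obtain ⟨a, ha, hva⟩ := hv
    obtain ⟨b, hb, hvb⟩ := hv'
    have hab : a = b := by
      rcases hva with rfl | ⟨rfl, hax⟩ <;> rcases hvb with hvb | ⟨hvb, hbx⟩
      · exact Subtype.ext hvb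
      · exact absurd hvb a.2
      · exact absurd hvb.symm b.2
      · exact Subtype.ext (hax.trans hbx.symm)
    exact Set.disjoint_left.mp hQR ha (hab ▸ hb)
  have hx : x ≠ y := hxy.ne
  have memA : ∀ v (hv : v ≠ y), v ∈ A ↔ (⟨v, hv⟩ : {v // v ≠ y}) ∈ Q := by
    intro v hv
    simp only [hA, Finset.mem_filter, Finset.mem_univ, true_and]
    constructor
    · rintro ⟨a, ha, rfl | ⟨h, -⟩⟩
      exacts [ha, absurd h hv]
    · exact fun h => ⟨_, h, Or.inl rfl⟩
  have memT : ∀ v (hv : v ≠ y), v ∈ T ↔ (⟨v, hv⟩ : {v // v ≠ y}) ∈ R := by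
    intro v hv
    simp only [hT, Finset.mem_filter, Finset.mem_univ, true_and]
    constructor
    · rintro ⟨a, ha, rfl | ⟨h, -⟩⟩
      exacts [ha, absurd h hv]
    · exact fun h => ⟨_, h, Or.inl rfl⟩
  have yA : y ∈ A ↔ (⟨x, hx⟩ : {v // v ≠ y}) ∈ Q := by
    simp only [hA, Finset.mem_filter, Finset.mem_univ, true_and]
    constructor
    · rintro ⟨a, ha, h | ⟨-, rfl⟩⟩
      exacts [absurd h.symm a.2, ha]
    · exact fun h => ⟨_, h, by simp⟩
  have yT : y ∈ T ↔ (⟨x, hx⟩ : {v // v ≠ y}) ∈ R := by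
    simp only [hT, Finset.mem_filter, Finset.mem_univ, true_and]
    constructor
    · rintro ⟨a, ha, h | ⟨-, rfl⟩⟩
      exacts [absurd h.symm a.2, ha]
    · exact fun h => ⟨_, h, by simp⟩
  have hcl : ∀ q ∈ A, ∀ v, G.Adj q v → v ∈ A ∨ v ∈ T := by
    intro q hq v hqv
    have key : ∀ (a b : {v // v ≠ y}), a ∈ Q → (a ≠ b → (G.contract x y).Adj a b) →
        b ∈ Q ∨ b ∈ R := by
      intro a b ha hab
      by_cases h : a = b
      · exact Or.inl (h ▸ ha)
      · exact hN a ha b (hab h)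
    by_cases hqy : q = y
    · subst hqy
      rw [memA v hqv.ne', memT v hqv.ne']
      exact key _ _ (yA.mp hq) fun h => ⟨h, Or.inr (Or.inl ⟨rfl, hqv⟩)⟩
    · by_cases hvy : v = y
      · subst hvy
        rw [yA, yT]
        exact key _ _ ((memA q hqy).mp hq) fun h => ⟨h, Or.inr (Or.inr ⟨rfl, hqv⟩)⟩
      · rw [memA v hvy, memT v hvy]
        exact key _ _ ((memA q hqy).mp hq) fun h => ⟨h, Or.inl hqv⟩
  have hne : A.Nonempty := by
    obtain ⟨a, ha⟩ := hQ
    exact ⟨a, (memA a a.2).mpr ha⟩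
  have hwA : (w : V) ∉ A := fun h => hwQ ((memA w w.2).mp h)
  have hwT : (w : V) ∉ T := fun h => hwR ((memT w w.2).mp h)
  have h4 := hG.four_le hne (Finset.disjoint_left.mpr hAT) hcl hwA hwT
  have hRf : R.toFinset.card ≤ 3 := by rwa [Set.ncard_eq_toFinset_card'] at hR
  have himg : T.erase y ⊆ R.toFinset.image Subtype.val := by
    intro v hv
    rw [Finset.mem_erase] at hv
    exact Finset.mem_image.mpr ⟨⟨v, hv.1⟩, by simpa using (memT v hv.1).mp hv.2, rfl⟩
  have h3 := (Finset.card_le_card himg).trans Finset.card_image_le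
  have hyT : y ∈ T := by
    by_contra h
    rw [Finset.erase_eq_of_notMem h] at h3
    omega
  have hxT : x ∈ T := (memT x hx).mpr (yT.mp hyT)
  have h5 := Finset.card_erase_of_mem hyT
  refine hc A T (A ∪ T)ᶜ ⟨⟨?_, ?_, ?_, ?_⟩, ?_, ?_, hne, ?_⟩ hxT hyT
  · intro v
    by_cases h1 : v ∈ A <;> by_cases h2 : v ∈ T <;> simp [h1, h2]
  · exact hAT
  · intro v hv hv'
    simp [hv'] at hv
  · intro v hv hv'
    simp [hv] at hv'
  · intro a ha b hb hab
    simp only [Finset.mem_compl, Finset.mem_union] at hb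
    exact hb (hcl a ha b hab)
  · omega
  · exact ⟨w, by simp [hwA, hwT]⟩

lemma exists_isTripartition_of_deleteEdges [DecidableEq V] [Fintype V] (hG : FourConnected G)
    {x y : V} (hc : ¬ FourConnected (G.deleteEdges {s(x, y)})) :
    ∃ X S Y : Finset V, IsTripartition X S Y ∧ S.card ≤ 3 ∧ x ∈ X ∧ y ∈ Y ∧
      ∀ a ∈ X, ∀ b ∈ Y, G.Adj a b → a = x ∧ b = y := by
  classical
  contrapose! hc
  refine fourConnected_of_four_le hG.1 fun Q R hQ hQR hR hN w hwQ => ?_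
  by_contra hwR
  have hT : IsTripartition Q.toFinset R.toFinset (Q.toFinset ∪ R.toFinset)ᶜ := by
    constructor
    · intro v
      by_cases h1 : v ∈ Q <;> by_cases h2 : v ∈ R <;> simp [h1, h2]
    · intro v hv
      simpa using Set.disjoint_left.mp hQR (by simpa using hv)
    · intro v hv
      simp at hv
      simpa using hv.2
    · intro v hv
      simp at hv
      simp [hv]
  have hRf : R.toFinset.card ≤ 3 := by rwa [Set.ncard_eq_toFinset_card'] at hR
  have hcross : ∀ a ∈ Q.toFinset, ∀ b ∈ (Q.toFinset ∪ R.toFinset)ᶜ, G.Adj a b →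
      a = x ∧ b = y ∨ a = y ∧ b = x := by
    intro a ha b hb hab
    by_contra hne
    have := hN a (by simpa using ha) b (by simpa [deleteEdges_adj, hab] using hne)
    simp at hb
    tauto
  obtain ⟨a, ha, b, hb, hab⟩ : ∃ a ∈ Q.toFinset, ∃ b ∈ (Q.toFinset ∪ R.toFinset)ᶜ,
      G.Adj a b := by
    by_contra! hno
    have := hG.four_le (Q := Q.toFinset) (R := R.toFinset) (w := w) (by simpa using hQ)
      (by simpa using hQR) (fun q hq v hv => by
        by_contra h
        exact hno q hq v (by simpa using h) hv) (by simpa using hwQ) (by simpa using hwR)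
    omega
  have hQY : ∀ v ∈ Q.toFinset, v ∉ (Q.toFinset ∪ R.toFinset)ᶜ := hT.sides
  rcases hcross a ha b hb hab with ⟨rfl, rfl⟩ | ⟨rfl, rfl⟩
  · obtain ⟨c, hc, d, hd, hcd, hne⟩ := hc _ _ _ hT hRf ha hb
    have := hcross c hc d hd hcd
    grind
  · obtain ⟨c, hc, d, hd, hcd, hne⟩ := hc _ _ _ hT.symm hRf hb ha
    have := hcross d hd c hc hcd.symm
    grind

end SimpleGraph

namespace SimpleGraph

variable {V : Type*} {G : SimpleGraph V}

lemma IsMinorOf.of_injective_hom {W V' : Type*} {H : SimpleGraph W} {K : SimpleGraph V'}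
    (h : H.IsMinorOf K) (f : V' → V) (hf : Function.Injective f)
    (hadj : ∀ a b, K.Adj a b → G.Adj (f a) (f b)) : H.IsMinorOf G := by
  obtain ⟨φ, h1, h2, h3, h4⟩ := h
  refine ⟨fun w => f '' φ w, fun w => (h1 w).image f, fun w => ?_, fun w₁ w₂ hw => ?_, ?_⟩
  · refine conn_of_closed ((h1 w).image f) fun A hA hne hcl => Set.Subset.antisymm hA ?_
    obtain ⟨v, hv⟩ := hne
    obtain ⟨a, ha, rfl⟩ := hA hv
    rintro _ ⟨b, hb, rfl⟩
    refine mem_of_conn_closed (A := f ⁻¹' A) (h2 w) ?_ hv ha hb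
    exact fun c hc _ d hd hcd => hcl _ hc _ ⟨d, hd, rfl⟩ (hadj _ _ hcd)
  · exact (Set.disjoint_image_iff hf).mpr (h3 hw)
  · intro w₁ w₂ hw
    obtain ⟨a, ha, b, hb, hab⟩ := h4 hw
    exact ⟨_, ⟨a, ha, rfl⟩, _, ⟨b, hb, rfl⟩, hadj _ _ hab⟩

/-- A wheel minor whose rim is a 6-cycle of the graph. -/
lemma wheel_isMinorOf_of_cycle (H : Set V) (r : Fin 6 → V) (hH : (G.induce H).Connected)
    (hr : Function.Injective r) (hrH : ∀ i, r i ∉ H) (hrim : ∀ i, G.Adj (r i) (r (i + 1)))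
    (hhub : ∀ i, ∃ h ∈ H, G.Adj h (r i)) : (wheel 6).IsMinorOf G :=
  wheel_isMinorOf H (fun i => {r i}) hH (fun i => conn_singleton _)
    (fun i => by simpa using hrH i) (fun i j hij => by simpa using hr.ne hij)
    (fun i => ⟨_, rfl, _, rfl, hrim i⟩)
    (fun i => let ⟨h, hh, hhr⟩ := hhub i; ⟨h, hh, _, rfl, hhr⟩)

lemma wheel_isMinorOf_of_pair {h₁ h₂ : V} (r : Fin 6 → V) (hh : G.Adj h₁ h₂)
    (hr : Function.Injective r) (hr₁ : ∀ i, r i ≠ h₁) (hr₂ : ∀ i, r i ≠ h₂)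
    (hrim : ∀ i, G.Adj (r i) (r (i + 1))) (hhub : ∀ i, G.Adj h₁ (r i) ∨ G.Adj h₂ (r i)) :
    (wheel 6).IsMinorOf G :=
  wheel_isMinorOf_of_cycle {h₁, h₂} r (conn_pair hh) hr (by simp [hr₁, hr₂]) hrim
    (by simpa using hhub)

/-- The edges certainly present in a 4-connected graph on nine vertices which contracts, along
the edge `0 8`, to the square of an 8-cycle, if `0` may miss `i` and `8` may miss `j`. -/
def expandedCycleSq (i j : Fin 9) : SimpleGraph (Fin 9) :=
  fromRel fun a b => (1 ≤ a ∧ a < b ∧ b ≤ 7 ∧ (b = a + 1 ∨ b = a + 2)) ∨ (a = 7 ∧ b = 1) ∨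
    (a = 0 ∧ b = 8) ∨ (a = 0 ∧ b ≠ i ∧ b ∈ [1, 2, 6, 7]) ∨ (a = 8 ∧ b ≠ j ∧ b ∈ [1, 2, 6, 7])

instance (i j : Fin 9) : DecidableRel (expandedCycleSq i j).Adj := fun a b =>
  inferInstanceAs (Decidable (a ≠ b ∧ (_ ∨ _)))

lemma wheel_isMinorOf_expandedCycleSq {i j : Fin 9} (hi : i ∈ ([1, 2, 6, 7] : List (Fin 9)))
    (hj : j ∈ ([1, 2, 6, 7] : List (Fin 9))) (hij : i ≠ j) :
    (wheel 6).IsMinorOf (expandedCycleSq i j) := by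
  simp only [List.mem_cons, List.not_mem_nil, or_false] at hi hj
  rcases hi with rfl | rfl | rfl | rfl <;> rcases hj with rfl | rfl | rfl | rfl
  · exact absurd rfl hij
  · exact wheel_isMinorOf_of_pair (h₁ := 0) (h₂ := 2) ![1, 8, 7, 6, 4, 3] (by decide) (by decide)
      (by decide) (by decide) (by decide) (by decide)
  · exact wheel_isMinorOf_of_pair (h₁ := 0) (h₂ := 2) ![1, 8, 7, 6, 4, 3] (by decide) (by decide)
      (by decide) (by decide) (by decide) (by decide)
  · exact wheel_isMinorOf_of_rim {0, 2} {7, 5} 1 8 6 4 3 (conn_pair (by decide))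
      (conn_pair (by decide)) (by decide) (by simp) (by simp) (by simp) (by simp; decide)
      (by simp; decide) (by decide) (by decide) (by decide) (by decide) (by simp; decide)
      (by simp; decide)
  · exact wheel_isMinorOf_of_pair (h₁ := 8) (h₂ := 2) ![1, 0, 7, 6, 4, 3] (by decide) (by decide)
      (by decide) (by decide) (by decide) (by decide)
  · exact absurd rfl hij
  · exact wheel_isMinorOf_of_pair (h₁ := 1) (h₂ := 3) ![2, 8, 0, 7, 5, 4] (by decide) (by decide)
      (by decide) (by decide) (by decide) (by decide)
  · exact wheel_isMinorOf_of_pair (h₁ := 8) (h₂ := 6) ![1, 0, 7, 5, 4, 2] (by decide) (by decide)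
      (by decide) (by decide) (by decide) (by decide)
  · exact wheel_isMinorOf_of_pair (h₁ := 8) (h₂ := 2) ![1, 0, 7, 6, 4, 3] (by decide) (by decide)
      (by decide) (by decide) (by decide) (by decide)
  · exact wheel_isMinorOf_of_pair (h₁ := 1) (h₂ := 3) ![2, 0, 8, 7, 5, 4] (by decide) (by decide)
      (by decide) (by decide) (by decide) (by decide)
  · exact absurd rfl hij
  · exact wheel_isMinorOf_of_pair (h₁ := 8) (h₂ := 6) ![1, 0, 2, 4, 5, 7] (by decide) (by decide)
      (by decide) (by decide) (by decide) (by decide)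
  · exact wheel_isMinorOf_of_rim {0, 6} {4, 3} 1 2 8 7 5 (conn_pair (by decide))
      (conn_pair (by decide)) (by decide) (by simp) (by simp) (by simp) (by simp; decide)
      (by simp; decide) (by decide) (by decide) (by decide) (by decide) (by simp; decide)
      (by simp; decide)
  · exact wheel_isMinorOf_of_pair (h₁ := 0) (h₂ := 6) ![1, 8, 7, 5, 4, 2] (by decide) (by decide)
      (by decide) (by decide) (by decide) (by decide)
  · exact wheel_isMinorOf_of_pair (h₁ := 0) (h₂ := 6) ![1, 8, 2, 4, 5, 7] (by decide) (by decide)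
      (by decide) (by decide) (by decide) (by decide)
  · exact absurd rfl hij

end SimpleGraph

namespace SimpleGraph

variable {V : Type*} {G : SimpleGraph V}

lemma _root_.FourConnected.exists_forall_ne_adj (hG : FourConnected G) {z z' a b c d : V}
    (hN : ∀ v, G.Adj z v → v = z' ∨ v = a ∨ v = b ∨ v = c ∨ v = d) :
    (G.Adj z b ∧ G.Adj z c ∧ G.Adj z d) ∨ (G.Adj z a ∧ G.Adj z c ∧ G.Adj z d) ∨
      (G.Adj z a ∧ G.Adj z b ∧ G.Adj z d) ∨ (G.Adj z a ∧ G.Adj z b ∧ G.Adj z c) := by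
  have h3 : ∀ p q r : V, (∀ v, G.Adj z v → v = p ∨ v = q ∨ v = r) → False := by
    intro p q r h
    refine hG.false_of_three {z} p q r (by simp) ?_ (by have := hG.1; simp; omega)
    simp only [Finset.mem_singleton, forall_eq]
    exact fun v hv => Or.inr (h v hv)
  have hab : G.Adj z a ∨ G.Adj z b := by
    by_contra h
    exact h3 z' c d (by grind)
  have hac : G.Adj z a ∨ G.Adj z c := by
    by_contra h
    exact h3 z' b d (by grind)
  have had : G.Adj z a ∨ G.Adj z d := by
    by_contra h
    exact h3 z' b c (by grind)
  have hbc : G.Adj z b ∨ G.Adj z c := by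
    by_contra h
    exact h3 z' a d (by grind)
  have hbd : G.Adj z b ∨ G.Adj z d := by
    by_contra h
    exact h3 z' a c (by grind)
  have hcd : G.Adj z c ∨ G.Adj z d := by
    by_contra h
    exact h3 z' a b (by grind)
  clear h3 hN
  tauto

instance (n : ℕ) : DecidableRel (cycleSq n).Adj := fun a b =>
  inferInstanceAs (Decidable (a ≠ b ∧ (_ ∨ _)))

lemma cycleSq_adj_add_left (c j k : ZMod 8) :
    (cycleSq 8).Adj (c + j) (c + k) ↔ (cycleSq 8).Adj j k := by
  simp [cycleSq, fromRel_adj, add_assoc]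

lemma isMinorOf_of_contract_iso_cycleSq (hG : FourConnected G) {x y : V} (hxy : G.Adj x y)
    (e : G.contract x y ≃g cycleSq 8) : (wheel 6).IsMinorOf G := by
  have hx := hxy.ne
  set u' : ZMod 8 → {v // v ≠ y} := fun j => e.symm (e ⟨x, hx⟩ + j) with hu'
  have hu0 : u' 0 = ⟨x, hx⟩ := by simp [hu']
  have hinj : Function.Injective u' := fun a b h => by simpa [hu'] using h
  have hsurj : ∀ v, ∃ j, u' j = v := fun v => ⟨e v - e ⟨x, hx⟩, by simp [hu']⟩
  have hadj : ∀ j k, (G.contract x y).Adj (u' j) (u' k) ↔ (cycleSq 8).Adj j k := by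
    intro j k
    rw [← e.map_adj_iff]
    simp [hu', cycleSq_adj_add_left]
  clear_value u'
  have hne : ∀ j, j ≠ 0 → (u' j : V) ≠ x := fun j hj h =>
    hj (hinj (hu0 ▸ Subtype.ext h))
  have hne' : ∀ j, (u' j : V) ≠ y := fun j => (u' j).2
  have h1 : ∀ j k, j ≠ 0 → k ≠ 0 → (cycleSq 8).Adj j k → G.Adj (u' j) (u' k) := by
    rintro j k hj hk h
    obtain ⟨-, h | ⟨h, -⟩ | ⟨h, -⟩⟩ := (hadj j k).mpr h
    exacts [h, absurd h (hne j hj), absurd h (hne k hk)]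
  have h2 : ∀ k, (cycleSq 8).Adj 0 k → G.Adj x (u' k) ∨ G.Adj y (u' k) := by
    intro k hk
    obtain ⟨-, h | ⟨-, h⟩ | ⟨h, -⟩⟩ := (hadj 0 k).mpr hk
    · exact Or.inl (by simpa [hu0] using h)
    · exact Or.inr h
    · exact absurd h (hne k hk.ne')
  have h3 : ∀ v, G.Adj x v ∨ G.Adj y v → v = x ∨ v = y ∨ v = u' 1 ∨ v = u' 2 ∨ v = u' 6 ∨
      v = u' 7 := by
    intro v hv
    by_cases hvx : v = x
    · exact Or.inl hvx
    by_cases hvy : v = y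
    · exact Or.inr (Or.inl hvy)
    obtain ⟨k, hk⟩ := hsurj ⟨v, hvy⟩
    have hv' : v = u' k := by rw [hk]
    have hk0 : (cycleSq 8).Adj 0 k := by
      refine (hadj 0 k).mp ⟨?_, ?_⟩
      · rw [hu0, hk]
        exact fun h => hvx (congrArg Subtype.val h).symm
      · rw [hu0, hk]
        rcases hv with h | h
        exacts [Or.inl h, Or.inr (Or.inl ⟨rfl, h⟩)]
    have : ∀ k : ZMod 8, (cycleSq 8).Adj 0 k → k = 1 ∨ k = 2 ∨ k = 6 ∨ k = 7 := by
      decide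
    rcases this k hk0 with rfl | rfl | rfl | rfl <;> simp [hv']
  have hX := hG.exists_forall_ne_adj (z := x) (z' := y) (a := u' 1) (b := u' 2) (c := u' 6)
    (d := u' 7) fun v hv => (h3 v (Or.inl hv)).resolve_left hv.ne'
  have hY := hG.exists_forall_ne_adj (z := y) (z' := x) (a := u' 1) (b := u' 2) (c := u' 6)
    (d := u' 7) fun v hv => by have := h3 v (Or.inr hv); have := hv.ne'; tauto
  have c1 := h2 1 (by decide)
  have c2 := h2 2 (by decide)
  have c6 := h2 6 (by decide)
  have c7 := h2 7 (by decide)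
  set f : Fin 9 → V := fun a => if h : a.val < 8 then u' (⟨a.val, h⟩ : Fin 8) else y with hf
  have hfinj : Function.Injective f := by
    intro a b hab
    simp only [hf] at hab
    split_ifs at hab with h h' h'
    · have := hinj (Subtype.ext hab)
      exact Fin.ext (Fin.mk.inj_iff.mp this)
    · exact absurd hab (hne' _)
    · exact absurd hab.symm (hne' _)
    · omega
  have f0 : f 0 = x := congrArg Subtype.val hu0
  have f8 : f 8 = y := rfl
  obtain ⟨i, j, hi, hj, hij, hXi, hYj⟩ : ∃ i j, i ∈ ([1, 2, 6, 7] : List (Fin 9)) ∧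
      j ∈ ([1, 2, 6, 7] : List (Fin 9)) ∧ i ≠ j ∧
      (∀ k ∈ ([1, 2, 6, 7] : List (Fin 9)), k ≠ i → G.Adj x (f k)) ∧
      (∀ k ∈ ([1, 2, 6, 7] : List (Fin 9)), k ≠ j → G.Adj y (f k)) := by
    have key : ∀ z, ((G.Adj z (f 2) ∧ G.Adj z (f 6) ∧ G.Adj z (f 7)) ∨
        (G.Adj z (f 1) ∧ G.Adj z (f 6) ∧ G.Adj z (f 7)) ∨
        (G.Adj z (f 1) ∧ G.Adj z (f 2) ∧ G.Adj z (f 7)) ∨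
        (G.Adj z (f 1) ∧ G.Adj z (f 2) ∧ G.Adj z (f 6))) →
        ∃ i ∈ ([1, 2, 6, 7] : List (Fin 9)),
          ∀ k ∈ ([1, 2, 6, 7] : List (Fin 9)), k ≠ i → G.Adj z (f k) := by
      clear * -
      rintro z (h | h | h | h)
      · exact ⟨1, by simp, by simpa using h⟩
      · exact ⟨2, by simp, by simpa using h⟩
      · exact ⟨6, by simp, by simpa using h⟩
      · exact ⟨7, by simp, by simpa using h⟩
    obtain ⟨i, hi, hXi⟩ := key _ hX
    obtain ⟨j, hj, hYj⟩ := key _ hY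
    by_cases hij : i = j
    · subst hij
      obtain ⟨i', hi', hne'⟩ : ∃ i' ∈ ([1, 2, 6, 7] : List (Fin 9)), i' ≠ i :=
        (by decide : ∀ i : Fin 9, ∃ i' ∈ ([1, 2, 6, 7] : List (Fin 9)), i' ≠ i) i
      have hc : G.Adj x (f i) ∨ G.Adj y (f i) := by
        clear * - hi c1 c2 c6 c7
        simp only [List.mem_cons, List.not_mem_nil, or_false] at hi
        rcases hi with rfl | rfl | rfl | rfl
        exacts [c1, c2, c6, c7]
      rcases hc with hc | hc
      · exact ⟨i', i, hi', hi, hne', fun k hk _ => if h : k = i then h ▸ hc else hXi k hk h, hYj⟩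
      · exact ⟨i, i', hi, hi', hne'.symm, hXi, fun k hk _ =>
          if h : k = i then h ▸ hc else hYj k hk h⟩
    · exact ⟨i, j, hi, hj, hij, hXi, hYj⟩
  refine (wheel_isMinorOf_expandedCycleSq hi hj hij).of_injective_hom f hfinj ?_
  have hf' : ∀ a b : Fin 9, 1 ≤ a → a ≤ 7 → 1 ≤ b → b ≤ 7 →
      (b = a + 1 ∨ b = a + 2 ∨ a = 7 ∧ b = 1) → G.Adj (f a) (f b) := by
    intro a b ha1 ha7 hb1 hb7 h
    have ha : a.val < 8 := by omega
    have hb : b.val < 8 := by omega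
    simp only [hf, ha, hb, dif_pos]
    have key : ∀ j k : ZMod 8, 1 ≤ j.val → 1 ≤ k.val →
        (k.val = j.val + 1 ∨ k.val = j.val + 2 ∨ j.val = 7 ∧ k.val = 1) →
        j ≠ 0 ∧ k ≠ 0 ∧ (cycleSq 8).Adj j k := by
      clear * -
      decide
    obtain ⟨h0, h0', hjk⟩ := key (⟨a.val, ha⟩ : Fin 8) (⟨b.val, hb⟩ : Fin 8) ha1 hb1
      (show b.val = a.val + 1 ∨ b.val = a.val + 2 ∨ a.val = 7 ∧ b.val = 1 by omega)
    exact h1 _ _ h0 h0' hjk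
  have hrel : ∀ a b : Fin 9, a ≠ b → ((1 ≤ a ∧ a < b ∧ b ≤ 7 ∧ (b = a + 1 ∨ b = a + 2)) ∨
      (a = 7 ∧ b = 1) ∨ (a = 0 ∧ b = 8) ∨ (a = 0 ∧ b ≠ i ∧ b ∈ ([1, 2, 6, 7] : List (Fin 9))) ∨
      (a = 8 ∧ b ≠ j ∧ b ∈ ([1, 2, 6, 7] : List (Fin 9)))) → G.Adj (f a) (f b) := by
    rintro a b hab (⟨h, h₁, h', h''⟩ | ⟨rfl, rfl⟩ | ⟨rfl, rfl⟩ | ⟨rfl, h, h'⟩ | ⟨rfl, h, h'⟩)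
    · exact hf' a b h (by omega) (by omega) h' (by omega)
    · exact hf' 7 1 (by decide) (by decide) (by decide) (by decide) (by decide)
    · exact f0 ▸ hxy
    · exact f0 ▸ hXi b h' h
    · exact hYj b h' h
  rintro a b ⟨hab, h | h⟩
  · exact hrel a b hab h
  · exact (hrel b a hab.symm h).symm

end SimpleGraph

namespace SimpleGraph

/-- Every 4-connected graph on at least nine vertices has a `W₆` minor, provided that those on
eight vertices other than the square of the 8-cycle have one. -/
theorem wheel_isMinorOf_of_nine_le.{u}
    (h8 : ∀ {W : Type u} (G : SimpleGraph W), FourConnected G → Nat.card W = 8 →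
      ¬ (wheel 6).IsMinorOf G → Nonempty (G ≃g cycleSq 8))
    {V : Type u} (G : SimpleGraph V) (hG : FourConnected G) (h9 : 9 ≤ Nat.card V) :
    (wheel 6).IsMinorOf G := by
  classical
  induction hn : Nat.card V using Nat.strong_induction_on generalizing V with
  | h n ih =>
  have := hG.finite
  have := Fintype.ofFinite V
  obtain ⟨K, hKG, hK⟩ := Set.Finite.exists_le_minimal
    (s := {K : SimpleGraph V | FourConnected K}) (Set.toFinite _) hG
  refine IsMinorOf.mono ?_ hKG
  clear hKG hG
  by_cases hc : ∃ x y, K.Adj x y ∧ FourConnected (K.contract x y)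
  · obtain ⟨x, y, hxy, hc⟩ := hc
    have hcard := card_ne y
    by_cases hn9 : n = 9
    · by_contra hno
      obtain ⟨e⟩ := h8 (K.contract x y) hc (by omega) fun h => hno (h.of_contract hxy)
      exact hno (isMinorOf_of_contract_iso_cycleSq hK.1 hxy e)
    · exact (ih _ (by omega) (K.contract x y) hc (by omega) rfl).of_contract hxy
  · push Not at hc
    rw [Nat.card_eq_fintype_card] at h9
    refine IsMinorCritical.isMinorOf ⟨hK.1, h9, fun x y hxy =>
      exists_isFourCut_of_contract hK.1 (by omega) hxy (hc x y hxy), fun x y hxy =>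
      exists_isTripartition_of_deleteEdges hK.1 fun h => ?_⟩
    have := hK.2 h (deleteEdges_le _) hxy
    simp at this

end SimpleGraph

namespace SimpleGraph

section Tautology

/-- The number with the given binary digits, least significant first. -/
def ofDigits (l : List Bool) : ℕ := l.foldr Nat.bit 0

lemma testBit_ofDigits (l : List Bool) (i : ℕ) : (ofDigits l).testBit i = l.getD i false := by
  induction l generalizing i with
  | nil => simp [ofDigits]
  | cons b l ih =>
    cases i with
    | zero => simp [ofDigits]
    | succ i => simpa [ofDigits, Nat.testBit_bit_succ] using ih i

variable {κ τ : Type*}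

/-- The members of `u` which survive whatever the values of the given variables are. -/
def independentOf (p n : κ → ℕ) (u : ℕ) (ks : List κ) : ℕ :=
  ks.foldr (fun k m => p k &&& n k &&& m) u

/-- Here `p k` and `n k` are the sets of terms which survive when the variable `k` is true and when
it is false. Check that for every valuation some member of `m` survives. -/
def survives (p n : κ → ℕ) (u : ℕ) : List κ → ℕ → Bool
  | [], m => m != 0
  | k :: ks, m => m &&& independentOf p n u (k :: ks) != 0 ||
      (survives p n u ks (m &&& p k) && survives p n u ks (m &&& n k))

lemma exists_testBit_of_survives (p n : κ → ℕ) (u : ℕ) (f : κ → Prop) :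
    ∀ (ks : List κ) (m : ℕ), survives p n u ks m = true →
      ∃ i, m.testBit i = true ∧ ∀ k ∈ ks, (f k → (p k).testBit i = true) ∧
        (¬ f k → (n k).testBit i = true) := by
  have hbit : ∀ m : ℕ, m ≠ 0 → ∃ i, m.testBit i = true := fun m h => by
    by_contra! hno
    exact h (Nat.eq_of_testBit_eq fun i => by simpa using hno i)
  have hind : ∀ (ks : List κ) (i : ℕ), (independentOf p n u ks).testBit i = true →
      ∀ k ∈ ks, (p k).testBit i = true ∧ (n k).testBit i = true := by
    intro ks i h
    induction ks with
    | nil => simp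
    | cons k ks ih =>
      simp only [independentOf, List.foldr_cons, Nat.testBit_and, Bool.and_eq_true] at h
      simpa [h.1] using ih h.2
  intro ks
  induction ks with
  | nil =>
    intro m h
    obtain ⟨i, hi⟩ := hbit m (by simpa [survives] using h)
    exact ⟨i, hi, by simp⟩
  | cons k ks ih =>
    intro m h
    simp only [survives, Bool.or_eq_true, Bool.and_eq_true, bne_iff_ne] at h
    rcases h with h | ⟨h1, h2⟩
    · obtain ⟨i, hi⟩ := hbit _ h
      rw [Nat.testBit_and, Bool.and_eq_true] at hi
      have := hind _ i hi.2
      exact ⟨i, hi.1, fun k hk => ⟨fun _ => (this k hk).1, fun _ => (this k hk).2⟩⟩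
    · by_cases hk : f k
      · obtain ⟨i, hi, hks⟩ := ih _ h1
        simp only [Nat.testBit_and, Bool.and_eq_true] at hi
        refine ⟨i, hi.1, List.forall_mem_cons.mpr ⟨⟨fun _ => hi.2, fun h => absurd hk h⟩, hks⟩⟩
      · obtain ⟨i, hi, hks⟩ := ih _ h2
        simp only [Nat.testBit_and, Bool.and_eq_true] at hi
        refine ⟨i, hi.1, List.forall_mem_cons.mpr ⟨⟨fun h => absurd h hk, fun _ => hi.2⟩, hks⟩⟩

/-- Each term is a conjunction of literals, the positive ones given by `pos` and the negative ones
by `neg`. Check that the disjunction of the terms is a tautology. -/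
def isTautology (pos neg : τ → κ → Bool) (ks : List κ) (terms : List τ) : Bool :=
  survives (fun k => ofDigits (terms.map fun t => !neg t k))
    (fun k => ofDigits (terms.map fun t => !pos t k)) (ofDigits (terms.map fun _ => true)) ks
    (ofDigits (terms.map fun _ => true))

lemma exists_term_of_isTautology {pos neg : τ → κ → Bool} {ks : List κ} {terms : List τ}
    (h : isTautology pos neg ks terms = true) (f : κ → Prop) :
    ∃ t ∈ terms, ∀ k ∈ ks, (pos t k = true → f k) ∧ (neg t k = true → ¬ f k) := by
  obtain ⟨i, hi, hk⟩ := exists_testBit_of_survives _ _ _ f ks _ h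
  have hlen : i < terms.length := by
    by_contra hlt
    simp [testBit_ofDigits, hlt] at hi
  refine ⟨terms[i], List.getElem_mem hlen, fun k hks => ⟨fun hp => ?_, fun hn hf => ?_⟩⟩
  · by_contra hf
    simpa [testBit_ofDigits, hlen, hp] using (hk k hks).2 hf
  · simpa [testBit_ofDigits, hlen, hn] using (hk k hks).1 hf

end Tautology

section SixVertices

/-- The orderings of a list. -/
def orderings {α : Type*} : List α → List (List α)
  | [] => [[]]
  | a :: l => (orderings l).flatMap fun s =>
      (List.range (s.length + 1)).map fun i => s.take i ++ a :: s.drop i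

/-- The pairs of cyclically consecutive members of a list. -/
def cyclicPairs {α : Type*} (c : List α) : List (α × α) := c.zip (c.drop 1 ++ c.take 1)

/-- The edges of the Hamiltonian cycles of the complete graph on six vertices. -/
def hamiltonianCycles : List (List (Fin 6 × Fin 6)) :=
  (orderings [1, 2, 3, 4, 5]).map fun c => cyclicPairs (0 :: c)

/-- The pairs which have to be nonadjacent for all neighbours of `A` to be in `A` or in `B`. -/
def separatedPairs (A B : List (Fin 6)) : List (Fin 6 × Fin 6) :=
  A ×ˢ (List.finRange 6).filter fun v => v ∉ A ∧ v ∉ B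

/-- The pairs of at most two vertices with at most one neighbour, as nonadjacent pairs. -/
def smallCuts : List (List (Fin 6 × Fin 6)) :=
  ((List.finRange 6 ×ˢ List.finRange 6 ×ˢ List.finRange 6).filter
    fun t => t.1 ≤ t.2.1 ∧ t.2.2 ≠ t.1 ∧ t.2.2 ≠ t.2.1).map
    fun t => separatedPairs [t.1, t.2.1] [t.2.2]

/-- The pairs of vertices with all neighbours among the same two vertices, as nonadjacent pairs. -/
def smallTwins : List (List (Fin 6 × Fin 6)) :=
  ((List.finRange 6 ×ˢ List.finRange 6 ×ˢ List.finRange 6 ×ˢ List.finRange 6).filter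
    fun t => t.1 < t.2.1 ∧ t.2.2.1 < t.2.2.2 ∧ t.1 ≠ t.2.2.1 ∧ t.1 ≠ t.2.2.2 ∧ t.2.1 ≠ t.2.2.1 ∧
      t.2.1 ≠ t.2.2.2).map
    fun t => separatedPairs [t.1] [t.2.2.1, t.2.2.2] ++ separatedPairs [t.2.1] [t.2.2.1, t.2.2.2]

def mentions (l : List (Fin 6 × Fin 6)) (k : Fin 6 × Fin 6) : Bool :=
  l.contains k || l.contains k.swap

def edgeVars : List (Fin 6 × Fin 6) :=
  (List.finRange 6 ×ˢ List.finRange 6).filter fun t => t.1 < t.2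

set_option maxRecDepth 10000 in
lemma isTautology_six : isTautology (fun t k => mentions t.1 k) (fun t k => mentions t.2 k) edgeVars
    (hamiltonianCycles.map (fun c => (c, [])) ++ smallCuts.map (fun c => ([], c)) ++
      smallTwins.map (fun c => ([], c))) = true := by
  decide +kernel

end SixVertices

end SimpleGraph

namespace SimpleGraph

/-- A graph on six vertices is Hamiltonian, or has a small cut, or two vertices with all their
neighbours among the same two vertices. -/
lemma hamiltonian_or_of_six (M : SimpleGraph (Fin 6)) :
    (∃ r : Fin 6 → Fin 6, Function.Injective r ∧ ∀ i, M.Adj (r i) (r (i + 1))) ∨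
      (∃ x y b, (∀ v, M.Adj x v → v = y ∨ v = b) ∧ ∀ v, M.Adj y v → v = x ∨ v = b) ∨
      ∃ a b s t, a ≠ b ∧ s ≠ t ∧ a ≠ s ∧ a ≠ t ∧ b ≠ s ∧ b ≠ t ∧
        (∀ v, M.Adj a v → v = s ∨ v = t) ∧ ∀ v, M.Adj b v → v = s ∨ v = t := by
  obtain ⟨t, ht, hk⟩ := exists_term_of_isTautology isTautology_six fun k => M.Adj k.1 k.2
  have hvar : ∀ k : Fin 6 × Fin 6, k.1 ≠ k.2 → k ∈ edgeVars ∨ k.swap ∈ edgeVars := by decide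
  have hpos : ∀ k ∈ t.1, k.1 ≠ k.2 → M.Adj k.1 k.2 := by
    intro k hkt hne
    rcases hvar k hne with h | h
    · exact (hk k h).1 (by simp [mentions, hkt])
    · exact ((hk _ h).1 (by simp [mentions, hkt])).symm
  have hneg : ∀ k ∈ t.2, ¬ M.Adj k.1 k.2 := by
    intro k hkt hadj
    rcases hvar k hadj.ne with h | h
    · exact (hk k h).2 (by simp [mentions, hkt]) hadj
    · exact (hk _ h).2 (by simp [mentions, hkt]) hadj.symm
  have hsep : ∀ A B, (∀ k ∈ separatedPairs A B, ¬ M.Adj k.1 k.2) → ∀ a ∈ A, ∀ v, M.Adj a v →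
      v ∈ A ∨ v ∈ B := by
    intro A B h a ha v hv
    by_contra hno
    exact h (a, v) (by simpa [separatedPairs, ha] using hno) hv
  simp only [List.mem_append, List.mem_map] at ht
  rcases ht with (⟨c, hc, rfl⟩ | ⟨c, hc, rfl⟩) | ⟨c, hc, rfl⟩
  · left
    obtain ⟨l, hl, rfl⟩ := List.mem_map.mp hc
    have : ∀ l ∈ orderings ([1, 2, 3, 4, 5] : List (Fin 6)), l.length = 5 ∧ (0 :: l).Nodup := by
      decide +kernel
    obtain ⟨hlen, hnd⟩ := this l hl
    obtain ⟨a, b, c, d, e, rfl⟩ : ∃ a b c d e, l = [a, b, c, d, e] := by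
      match l, hlen with
      | [a, b, c, d, e], _ => exact ⟨a, b, c, d, e, rfl⟩
    have hinj : Function.Injective ![0, a, b, c, d, e] := by
      rw [← List.nodup_ofFn]
      simpa using hnd
    refine ⟨_, hinj, fun i => ?_⟩
    have hi : i ≠ i + 1 := by revert i; decide
    refine hpos (![0, a, b, c, d, e] i, ![0, a, b, c, d, e] (i + 1)) ?_ (hinj.ne hi)
    fin_cases i <;> simp [cyclicPairs]
  · right
    left
    obtain ⟨⟨x, y, b⟩, -, rfl⟩ := List.mem_map.mp hc
    have h := hsep _ _ hneg
    refine ⟨x, y, b, fun v hv => ?_, fun v hv => ?_⟩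
    · have := h x (by simp) v hv
      have := hv.ne'
      simp at *
      tauto
    · have := h y (by simp) v hv
      have := hv.ne'
      simp at *
      tauto
  · right
    right
    obtain ⟨⟨a, b, s, t⟩, hf, rfl⟩ := List.mem_map.mp hc
    simp only [List.mem_filter, decide_eq_true_eq] at hf
    obtain ⟨-, hab, hst, h1, h2, h3, h4⟩ := hf
    simp only [List.mem_append] at hneg
    have ha := hsep _ _ fun k hk => hneg k (Or.inl hk)
    have hb := hsep _ _ fun k hk => hneg k (Or.inr hk)
    refine ⟨a, b, s, t, hab.ne, hst.ne, h1, h2, h3, h4, fun v hv => ?_, fun v hv => ?_⟩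
    · simpa [hv.ne'] using ha a (by simp) v hv
    · simpa [hv.ne'] using hb b (by simp) v hv

end SimpleGraph

namespace SimpleGraph

variable {V : Type*} {G : SimpleGraph V}

/-- A connected pair dominating the other six vertices is the hub of a wheel minor, unless two of
these six have all their neighbours among four vertices. -/
lemma exists_twins_of_dominating (hG : FourConnected G) (h7 : 7 ≤ Nat.card V) {u v : V}
    (huv : u = v ∨ G.Adj u v) (f : Fin 6 → V) (hf : Function.Injective f)
    (hfs : ∀ w, w = u ∨ w = v ∨ ∃ i, f i = w) (hu : ∀ i, f i ≠ u) (hv : ∀ i, f i ≠ v)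
    (hdom : ∀ i, G.Adj u (f i) ∨ G.Adj v (f i)) :
    (wheel 6).IsMinorOf G ∨ ∃ a b s t, [a, b, s, t].Nodup ∧
      (∀ w, G.Adj (f a) w → w = f s ∨ w = f t ∨ w = u ∨ w = v) ∧
      ∀ w, G.Adj (f b) w → w = f s ∨ w = f t ∨ w = u ∨ w = v := by
  classical
  rcases hamiltonian_or_of_six (G.comap f) with ⟨r, hr, hadj⟩ | ⟨x, y, b, hx, hy⟩ |
    ⟨a, b, s, t, hab, hst, has, hat, hbs, hbt, ha, hb⟩
  · refine .inl (wheel_isMinorOf_of_cycle {u, v} (f ∘ r) ?_ (hf.comp hr) ?_ hadj ?_)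
    · rcases huv with rfl | h
      · rw [Set.pair_eq_singleton]
        exact conn_singleton u
      · exact conn_pair h
    · simp [hu, hv]
    · simpa using fun i => hdom (r i)
  · exfalso
    refine hG.false_of_three {f x, f y} u v (f b) (by simp) ?_ ?_
    · simp only [Finset.mem_insert, Finset.mem_singleton]
      rintro q (rfl | rfl) w hw <;> rcases hfs w with rfl | rfl | ⟨i, rfl⟩
      any_goals simp
      · rcases hx i hw with rfl | rfl <;> simp
      · rcases hy i hw with rfl | rfl <;> simp
    · have := Finset.card_le_two (a := f x) (b := f y)
      omega
  · refine .inr ⟨a, b, s, t, by simp; tauto, fun w hw => ?_, fun w hw => ?_⟩ <;>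
      rcases hfs w with rfl | rfl | ⟨i, rfl⟩
    any_goals simp
    · rcases ha i hw with rfl | rfl <;> simp
    · rcases hb i hw with rfl | rfl <;> simp

lemma _root_.FourConnected.adj_of_forall (hG : FourConnected G) (h6 : 6 ≤ Nat.card V)
    {z a b c d : V} (hN : ∀ v, G.Adj z v → v = a ∨ v = b ∨ v = c ∨ v = d) :
    G.Adj z a ∧ G.Adj z b ∧ G.Adj z c ∧ G.Adj z d := by
  have h3 : ∀ p q r : V, (∀ v, G.Adj z v → v = p ∨ v = q ∨ v = r) → False := by
    intro p q r h
    refine hG.false_of_three {z} p q r (by simp) ?_ (by simp; omega)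
    simp only [Finset.mem_singleton, forall_eq]
    exact fun v hv => Or.inr (h v hv)
  refine ⟨?_, ?_, ?_, ?_⟩ <;> by_contra hno
  · exact h3 b c d (by grind)
  · exact h3 a c d (by grind)
  · exact h3 a b d (by grind)
  · exact h3 a b c (by grind)

lemma wheel_isMinorOf_of_card_seven (hG : FourConnected G) (hcard : Nat.card V = 7) {v : V}
    (hdom : ∀ w, w ≠ v → G.Adj v w) : (wheel 6).IsMinorOf G := by
  classical
  have := hG.finite
  have := Fintype.ofFinite V
  have hc : Fintype.card {w // w ≠ v} = 6 := by
    rw [Fintype.card_subtype_compl, ← Nat.card_eq_fintype_card, hcard]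
    simp
  let e := (Fintype.equivFinOfCardEq hc).symm
  have hsurj : ∀ w, w = v ∨ w = v ∨ ∃ i, (e i : V) = w := by
    intro w
    by_cases hw : w = v
    · exact .inl hw
    · exact .inr (.inr ⟨e.symm ⟨w, hw⟩, by simp⟩)
  rcases exists_twins_of_dominating hG hcard.ge (.inl rfl : v = v ∨ _) (fun i => (e i : V))
    (Subtype.val_injective.comp e.injective) hsurj (fun i => (e i).2) (fun i => (e i).2)
    (fun i => .inl (hdom _ (e i).2)) with h | ⟨a, -, s, t, -, ha, -⟩
  · exact h
  · exfalso
    refine hG.false_of_three {(e a : V)} (e s) (e t) v (by simp) ?_ ?_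
    · simp only [Finset.mem_singleton]
      rintro q rfl w hw
      have := ha w hw
      tauto
    · rw [Finset.card_singleton]
      omega

lemma wheel_isMinorOf_of_bipartite_pairs {a b p q t₀ t₁ t₂ t₃ : V}
    (hnd : [a, b, p, q, t₀, t₁, t₂, t₃].Nodup)
    (ha : G.Adj a t₀ ∧ G.Adj a t₁ ∧ G.Adj a t₂ ∧ G.Adj a t₃)
    (hb : G.Adj b t₀ ∧ G.Adj b t₁ ∧ G.Adj b t₂ ∧ G.Adj b t₃)
    (h₀ : G.Adj p t₀) (h₀' : G.Adj q t₀) (h₁ : G.Adj p t₁) (h₁' : G.Adj q t₁)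
    (h₂ : G.Adj p t₂) (h₃ : G.Adj q t₃) : (wheel 6).IsMinorOf G := by
  simp only [List.nodup_cons, List.mem_cons, List.not_mem_nil, or_false, not_or,
    List.nodup_nil, not_false_eq_true, and_true] at hnd
  refine wheel_isMinorOf_of_pair (h₁ := a) (h₂ := t₀) ![b, t₂, p, t₁, q, t₃] ha.1 ?_ ?_ ?_ ?_ ?_
  · rw [← List.nodup_ofFn]
    simp
    grind
  · intro i
    fin_cases i <;> simp <;> grind
  · intro i
    fin_cases i <;> simp <;> grind
  · intro i
    fin_cases i <;> simp <;> grind [G.adj_comm]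
  · intro i
    fin_cases i <;> simp <;> grind [G.adj_comm]

lemma wheel_isMinorOf_of_twins (hG : FourConnected G) (h6 : 6 ≤ Nat.card V)
    {a b p q t₀ t₁ t₂ t₃ : V} (hnd : [a, b, p, q, t₀, t₁, t₂, t₃].Nodup)
    (hall : ∀ w, w = a ∨ w = b ∨ w = p ∨ w = q ∨ w = t₀ ∨ w = t₁ ∨ w = t₂ ∨ w = t₃)
    (ha : ∀ w, G.Adj a w → w = t₀ ∨ w = t₁ ∨ w = t₂ ∨ w = t₃)
    (hb : ∀ w, G.Adj b w → w = t₀ ∨ w = t₁ ∨ w = t₂ ∨ w = t₃) : (wheel 6).IsMinorOf G := by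
  classical
  have hnd' := hnd
  simp only [List.nodup_cons, List.mem_cons, List.not_mem_nil, or_false, not_or,
    List.nodup_nil, not_false_eq_true, and_true] at hnd'
  have ha' := hG.adj_of_forall h6 ha
  have hb' := hG.adj_of_forall h6 hb
  have hp : ∀ w, G.Adj p w → w = q ∨ w = t₀ ∨ w = t₁ ∨ w = t₂ ∨ w = t₃ := by
    intro w hw
    have := hw.ne
    rcases hall w with rfl | rfl | h
    · have := ha p hw.symm
      grind
    · have := hb p hw.symm
      grind
    · grind
  have hq : ∀ w, G.Adj q w → w = p ∨ w = t₀ ∨ w = t₁ ∨ w = t₂ ∨ w = t₃ := by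
    intro w hw
    have := hw.ne
    rcases hall w with rfl | rfl | h
    · have := ha q hw.symm
      grind
    · have := hb q hw.symm
      grind
    · grind
  have hpq : ∀ x y z, (∀ w, G.Adj p w → w = q ∨ w = x ∨ w = y ∨ w = z) →
      (∀ w, G.Adj q w → w = p ∨ w = x ∨ w = y ∨ w = z) → False := by
    intro x y z h h'
    refine hG.false_of_three {p, q} x y z (by simp) ?_ ?_
    · simp only [Finset.mem_insert, Finset.mem_singleton]
      grind
    · have := Finset.card_le_two (a := p) (b := q)
      omega
  have hor : (G.Adj p t₀ ∨ G.Adj q t₀) ∧ (G.Adj p t₁ ∨ G.Adj q t₁) ∧ (G.Adj p t₂ ∨ G.Adj q t₂) ∧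
      (G.Adj p t₃ ∨ G.Adj q t₃) := by
    clear ha hb ha' hb' hall hnd
    refine ⟨?_, ?_, ?_, ?_⟩ <;> by_contra! hno
    · exact hpq t₁ t₂ t₃ (by grind) (by grind)
    · exact hpq t₀ t₂ t₃ (by grind) (by grind)
    · exact hpq t₀ t₁ t₃ (by grind) (by grind)
    · exact hpq t₀ t₁ t₂ (by grind) (by grind)
  let T : Fin 4 → V := ![t₀, t₁, t₂, t₃]
  have hperm : ∀ P Q : Fin 4 → Prop, (∀ i, P i ∨ Q i) → (∃ i, ∀ j ≠ i, P j) →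
      (∃ i, ∀ j ≠ i, Q j) → ∃ σ : Equiv.Perm (Fin 4), P (σ 0) ∧ Q (σ 0) ∧ P (σ 1) ∧ Q (σ 1) ∧
        P (σ 2) ∧ Q (σ 3) := by
    intro P Q h hP hQ
    have key : ∀ P Q : Fin 4 → Bool, (∀ i, P i ∨ Q i) → (∃ i, ∀ j ≠ i, P j) →
      (∃ i, ∀ j ≠ i, Q j) → ∃ σ : Equiv.Perm (Fin 4), P (σ 0) ∧ Q (σ 0) ∧ P (σ 1) ∧ Q (σ 1) ∧
        P (σ 2) ∧ Q (σ 3) := by decide +kernel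
    simpa using key (fun i => decide (P i)) (fun i => decide (Q i)) (by simpa using h)
      (by simpa using hP) (by simpa using hQ)
  have hfour : ∀ z, (G.Adj z t₁ ∧ G.Adj z t₂ ∧ G.Adj z t₃) ∨ (G.Adj z t₀ ∧ G.Adj z t₂ ∧ G.Adj z t₃) ∨
      (G.Adj z t₀ ∧ G.Adj z t₁ ∧ G.Adj z t₃) ∨ (G.Adj z t₀ ∧ G.Adj z t₁ ∧ G.Adj z t₂) →
      ∃ i, ∀ j ≠ i, G.Adj z (T j) := by
    rintro z (h | h | h | h)
    · exact ⟨0, by simpa [T, Fin.forall_fin_succ] using h⟩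
    · exact ⟨1, by simpa [T, Fin.forall_fin_succ] using h⟩
    · exact ⟨2, by simpa [T, Fin.forall_fin_succ] using h⟩
    · exact ⟨3, by simpa [T, Fin.forall_fin_succ] using h⟩
  obtain ⟨σ, hσ⟩ := hperm (fun i => G.Adj p (T i)) (fun i => G.Adj q (T i))
    (by simpa [T, Fin.forall_fin_succ] using hor) (hfour p (hG.exists_forall_ne_adj hp))
    (hfour q (hG.exists_forall_ne_adj hq))
  have haT : ∀ i, G.Adj a (T i) := by simpa [T, Fin.forall_fin_succ] using ha'
  have hbT : ∀ i, G.Adj b (T i) := by simpa [T, Fin.forall_fin_succ] using hb'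
  have hT : Function.Injective T := by
    rw [← List.nodup_ofFn]
    simp [T]
    tauto
  have hTn : ∀ i, a ≠ T i ∧ b ≠ T i ∧ p ≠ T i ∧ q ≠ T i := by
    simp [T, Fin.forall_fin_succ]
    tauto
  refine wheel_isMinorOf_of_bipartite_pairs ?_ ⟨haT _, haT _, haT _, haT _⟩
    ⟨hbT _, hbT _, hbT _, hbT _⟩ hσ.1 hσ.2.1 hσ.2.2.1 hσ.2.2.2.1 hσ.2.2.2.2.1 hσ.2.2.2.2.2
  simp [hTn, hT.eq_iff]
  tauto

lemma wheel_isMinorOf_of_card_eight (hG : FourConnected G) (hcard : Nat.card V = 8) {u v : V}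
    (huv : G.Adj u v) (hdom : ∀ w, w ≠ u → w ≠ v → G.Adj u w ∨ G.Adj v w) :
    (wheel 6).IsMinorOf G := by
  classical
  have := hG.finite
  have := Fintype.ofFinite V
  have hc : Fintype.card {w // w ∉ ({u, v} : Finset V)} = 6 := by
    rw [Fintype.card_subtype_compl, ← Nat.card_eq_fintype_card, hcard, Fintype.card_coe,
      Finset.card_pair huv.ne]
  let e := (Fintype.equivFinOfCardEq hc).symm
  have he : ∀ i, (e i : V) ≠ u ∧ (e i : V) ≠ v := fun i => by simpa using (e i).2
  have hinj : Function.Injective fun i => (e i : V) := Subtype.val_injective.comp e.injective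
  have hsurj : ∀ w, w = u ∨ w = v ∨ ∃ i, (e i : V) = w := by
    intro w
    by_cases hw : w = u ∨ w = v
    · tauto
    · exact .inr (.inr ⟨e.symm ⟨w, by simpa using hw⟩, by simp⟩)
  rcases exists_twins_of_dominating hG (by omega) (.inr huv) (fun i => (e i : V)) hinj hsurj
    (fun i => (he i).1) (fun i => (he i).2) (fun i => hdom _ (he i).1 (he i).2)
    with h | ⟨a, b, s, t, hnd, ha, hb⟩
  · exact h
  have hpq : ∀ a b s t : Fin 6, [a, b, s, t].Nodup → ∃ p q, [a, b, p, q, s, t].Nodup ∧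
      ∀ i, i = a ∨ i = b ∨ i = p ∨ i = q ∨ i = s ∨ i = t := by decide +kernel
  obtain ⟨p, q, hnd', hall⟩ := hpq a b s t hnd
  refine wheel_isMinorOf_of_twins hG (by omega) (a := e a) (b := e b) (p := e p) (q := e q)
    (t₀ := e s) (t₁ := e t) (t₂ := u) (t₃ := v) ?_ (fun w => ?_) ha hb
  · have := hnd'.map hinj
    simp only [List.map_cons, List.map_nil, List.nodup_cons, List.mem_cons, List.not_mem_nil,
      or_false, not_or, List.nodup_nil, not_false_eq_true, and_true] at this ⊢
    have h1 := he a
    have h2 := he b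
    have h3 := he p
    have h4 := he q
    have h5 := he s
    have h6 := he t
    have := huv.ne
    clear hpq hb ha hsurj
    tauto
  · rcases hsurj w with h | h | ⟨i, h⟩
    · tauto
    · tauto
    · rcases hall i with rfl | rfl | rfl | rfl | rfl | rfl <;> subst h <;> simp

end SimpleGraph

namespace SimpleGraph

/-- Whether the new row `r` is compatible with all rows of the list, whose indices decrease. -/
def rowsCompat (compat : ℕ → ℕ → ℕ → ℕ → Bool) (j r : ℕ) : List ℕ → Bool
  | [] => true
  | s :: l => compat l.length s j r && rowsCompat compat j r l

/-- The number whose binary digits are the `j`-th digits of the rows. -/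
def column (j : ℕ) : List ℕ → ℕ
  | [] => 0
  | s :: l => column j l + 2 ^ l.length * (s / 2 ^ j % 2)

/-- Whether every way of prepending `k` rows, keeping the matrix symmetric with zeros on the
diagonal and the rows pairwise compatible, gives a list passing the test. -/
def searchRows (compat : ℕ → ℕ → ℕ → ℕ → Bool) (rows : List ℕ) (test : List ℕ → Bool) :
    ℕ → List ℕ → Bool
  | 0, l => test l
  | k + 1, l => rows.all fun r =>
      !Nat.beq (r % 2 ^ (l.length + 1)) (column l.length l) || !rowsCompat compat l.length r l ||
        searchRows compat rows test k (r :: l)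

/-- The first `n` values of a sequence, in reverse order. -/
def initialRows (R : ℕ → ℕ) : ℕ → List ℕ
  | 0 => []
  | n + 1 => R n :: initialRows R n

lemma length_initialRows (R : ℕ → ℕ) (n : ℕ) : (initialRows R n).length = n := by
  induction n with
  | zero => rfl
  | succ n ih => simp [initialRows, ih]

lemma rowsCompat_initialRows {compat : ℕ → ℕ → ℕ → ℕ → Bool} {R : ℕ → ℕ} {j r : ℕ} (n : ℕ)
    (h : ∀ i < n, compat i (R i) j r) : rowsCompat compat j r (initialRows R n) := by
  induction n with
  | zero => rfl
  | succ n ih =>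
    simp only [initialRows, rowsCompat, length_initialRows, Bool.and_eq_true]
    exact ⟨h n (by simp), ih fun i hi => h i (by omega)⟩

lemma column_initialRows {R : ℕ → ℕ} {j r : ℕ} (n : ℕ)
    (h : ∀ i < n, r.testBit i = (R i).testBit j) : column j (initialRows R n) = r % 2 ^ n := by
  induction n with
  | zero => simp [initialRows, column, Nat.mod_one]
  | succ n ih =>
    rw [Nat.mod_pow_succ, ← Nat.toNat_testBit, h n (by simp), Nat.toNat_testBit, initialRows,
      column, length_initialRows, ih fun i hi => h i (by omega)]

lemma test_of_searchRows {compat : ℕ → ℕ → ℕ → ℕ → Bool} {rows : List ℕ} {test : List ℕ → Bool}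
    {R : ℕ → ℕ} {n : ℕ} (hrows : ∀ i < n, R i ∈ rows) (hirrefl : ∀ i < n, (R i).testBit i = false)
    (hsymm : ∀ i j, i < j → j < n → (R j).testBit i = (R i).testBit j)
    (hcompat : ∀ i j, i < j → j < n → compat i (R i) j (R j)) (k m : ℕ) (hkm : m + k = n)
    (h : searchRows compat rows test k (initialRows R m)) : test (initialRows R n) := by
  induction k generalizing m with
  | zero =>
    obtain rfl : m = n := hkm
    exact h
  | succ k ih =>
    refine ih (m + 1) (by omega) ?_
    simp only [searchRows, List.all_eq_true, length_initialRows] at h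
    have := h _ (hrows m (by omega))
    rw [rowsCompat_initialRows m fun i hi => hcompat i m hi (by omega),
      column_initialRows m fun i hi => hsymm i m hi (by omega), Nat.mod_pow_succ,
      ← Nat.toNat_testBit, hirrefl m (by omega)] at this
    simpa [initialRows] using this

/-- Whether the vertex `x` of the second graph is related to the images of the vertices so far as
the next vertex of the first graph is to these vertices. -/
def imageCompat (r t : ℕ) (x : ℕ) : List ℕ → Bool
  | [] => true
  | y :: l => x != y && r.testBit l.length == t.testBit y && imageCompat r t x l

/-- Whether the number has at most one digit one. -/
def atMostOneBit (r : ℕ) : Bool :=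
  Nat.beq (r &&& (r - 1)) 0

/-- Backtracking search for an isomorphism between graphs on `n` vertices given by lists of rows,
extending a partial map. Rows of the first graph which are matched have been removed. Vertices of
degree at most one are matched with each other only. -/
def searchIso (T : List ℕ) (n : ℕ) : List ℕ → List ℕ → Bool
  | [], _ => true
  | r :: L, img => (List.range n).any fun x =>
      atMostOneBit r == atMostOneBit (T.getD x 0) &&
        (imageCompat r (T.getD x 0) x img && searchIso T n L (x :: img))

lemma imageCompat_spec {r t x : ℕ} {g : ℕ → ℕ} {m : ℕ}
    (h : imageCompat r t x (initialRows g m)) :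
    ∀ j < m, x ≠ g j ∧ r.testBit j = t.testBit (g j) := by
  induction m with
  | zero => simp
  | succ m ih =>
    simp only [initialRows, imageCompat, length_initialRows, Bool.and_eq_true, bne_iff_ne,
      beq_iff_eq] at h
    intro j hj
    rcases Nat.lt_succ_iff_lt_or_eq.mp hj with hj | rfl
    · exact ih h.2 j hj
    · exact h.1

lemma initialRows_congr {g g' : ℕ → ℕ} {m : ℕ} (h : ∀ j < m, g j = g' j) :
    initialRows g m = initialRows g' m := by
  induction m with
  | zero => rfl
  | succ m ih => simp only [initialRows, h m (by simp), ih fun j hj => h j (by omega)]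

lemma exists_of_searchIso {T L : List ℕ} {n : ℕ} {R : ℕ → ℕ} (m : ℕ) (g : ℕ → ℕ)
    (hL : ∀ i (hi : i < L.length), L[i] = R (m + i)) (h : searchIso T n L (initialRows g m))
    (hg : ∀ j < m, g j < n)
    (hgg : ∀ i < m, ∀ j < i, g i ≠ g j ∧ (R i).testBit j = (T.getD (g i) 0).testBit (g j)) :
    ∃ g : ℕ → ℕ, (∀ j < m + L.length, g j < n) ∧ ∀ i < m + L.length, ∀ j < i,
      g i ≠ g j ∧ (R i).testBit j = (T.getD (g i) 0).testBit (g j) := by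
  induction L generalizing m g with
  | nil => exact ⟨g, hg, hgg⟩
  | cons r L ih =>
    simp only [searchIso, List.any_eq_true, List.mem_range, Bool.and_eq_true] at h
    obtain ⟨x, hx, -, hc, hs⟩ := h
    obtain rfl : r = R m := hL 0 (by simp)
    have hc := imageCompat_spec hc
    have hlt : ∀ j < m, Function.update g m x j = g j := fun j hj =>
      Function.update_of_ne (by omega) _ _
    have hm : Function.update g m x m = x := Function.update_self ..
    have := ih (m + 1) (Function.update g m x) ?_ ?_ ?_ ?_
    · obtain ⟨g', h⟩ := this
      refine ⟨g', ?_⟩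
      rwa [show m + (R m :: L).length = m + 1 + L.length by simp; omega]
    · intro i hi
      have := hL (i + 1) (by simpa using hi)
      simpa [show m + 1 + i = m + (i + 1) by omega] using this
    · rw [initialRows, hm, initialRows_congr hlt]
      exact hs
    · intro j hj
      rcases Nat.lt_succ_iff_lt_or_eq.mp hj with hj | rfl
      · rw [hlt j hj]
        exact hg j hj
      · rwa [hm]
    · intro i hi j hj
      rcases Nat.lt_succ_iff_lt_or_eq.mp hi with hi | rfl
      · rw [hlt i hi, hlt j (by omega)]
        exact hgg i hi j hj
      · rw [hm, hlt j hj]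
        exact hc j hj

/-- The neighbours of a vertex, as the binary digits of a number. -/
noncomputable def row {n : ℕ} (M : SimpleGraph (Fin n)) (i : ℕ) : ℕ :=
  open Classical in Nat.ofBits fun j : Fin n => decide (∃ hi : i < n, M.Adj ⟨i, hi⟩ j)

lemma testBit_row {n : ℕ} (M : SimpleGraph (Fin n)) (i j : Fin n) :
    (M.row i).testBit j ↔ M.Adj i j := by
  simp [row, Nat.testBit_ofBits_lt]

lemma reverse_initialRows (R : ℕ → ℕ) (n : ℕ) :
    (initialRows R n).reverse = (List.range n).map R := by
  induction n with
  | zero => rfl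
  | succ n ih => simp [initialRows, ih, List.range_succ]

lemma exists_of_searchRows {n : ℕ} (M : SimpleGraph (Fin n)) {compat : ℕ → ℕ → ℕ → ℕ → Bool}
    {rows : List ℕ} {targets : List (List ℕ)} (hrows : ∀ i : Fin n, M.row i ∈ rows)
    (hcompat : ∀ i j : Fin n, i < j → compat i (M.row i) j (M.row j)) (m : ℕ) (hm : m ≤ n)
    (h : searchRows compat rows (fun l => targets.any fun T => searchIso T n l.reverse [])
      (n - m) (initialRows M.row m)) :
    ∃ T ∈ targets, ∃ g : Fin n → Fin n, Function.Injective g ∧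
      ∀ i, ∀ j < i, M.Adj i j ↔ (T.getD (g i) 0).testBit (g j) := by
  have := test_of_searchRows (fun i hi => hrows ⟨i, hi⟩)
    (fun i hi => by simpa using (M.testBit_row ⟨i, hi⟩ ⟨i, hi⟩).not.mpr (M.loopless.irrefl _))
    (fun i j hij hj => Bool.eq_iff_iff.mpr <| by
      rw [M.testBit_row ⟨j, hj⟩ ⟨i, hij.trans hj⟩, M.testBit_row ⟨i, hij.trans hj⟩ ⟨j, hj⟩,
        M.adj_comm])
    (fun i j hij hj => hcompat ⟨i, hij.trans hj⟩ ⟨j, hj⟩ hij) _ m (by omega) h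
  obtain ⟨T, hT, hs⟩ := List.any_eq_true.mp this
  rw [reverse_initialRows] at hs
  obtain ⟨g, hg, hgg⟩ := exists_of_searchIso (R := M.row) 0 id (by simp) hs (by simp) (by simp)
  simp only [List.length_map, List.length_range, zero_add] at hg hgg
  refine ⟨T, hT, fun i => ⟨g i, hg i i.2⟩, fun i j hij => ?_, fun i j hij => ?_⟩
  · have hij : g i = g j := by simpa using hij
    by_contra hne
    rcases Ne.lt_or_gt hne with h | h
    · exact (hgg j j.2 i h).1 hij.symm
    · exact (hgg i i.2 j h).1 hij
  · rw [← testBit_row, (hgg i i.2 j hij).2]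

/-- The numbers in the list are the rows of the adjacency matrix of the complement of `K`. -/
def IsComplRows {W : Type*} (n : ℕ) (T : List ℕ) (K : SimpleGraph W) : Prop :=
  ∃ w : Fin n → W, Function.Bijective w ∧
    ∀ a b : Fin n, a ≠ b → ((T.getD a 0).testBit b ↔ ¬ K.Adj (w a) (w b))

lemma IsComplRows.nonempty_iso {n : ℕ} {V W : Type*} {G : SimpleGraph V} {K : SimpleGraph W}
    {T : List ℕ} (hK : IsComplRows n T K) (e : Fin n ≃ V) {g : Fin n → Fin n}
    (hg : Function.Injective g)
    (h : ∀ i, ∀ j < i, ¬ G.Adj (e i) (e j) ↔ (T.getD (g i) 0).testBit (g j)) :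
    Nonempty (G ≃g K) := by
  obtain ⟨w, hw, hT⟩ := hK
  have key : ∀ i, ∀ j < i, (K.Adj (w (g i)) (w (g j)) ↔ G.Adj (e i) (e j)) := fun i j hij =>
    not_iff_not.mp ((hT _ _ (hg.ne hij.ne')).symm.trans (h i j hij).symm)
  let f : Fin n ≃ W := (Equiv.ofBijective g (Finite.injective_iff_bijective.mp hg)).trans
    (Equiv.ofBijective w hw)
  refine ⟨⟨e.symm.trans f, fun {x y} => ?_⟩⟩
  obtain ⟨i, rfl⟩ := e.surjective x
  obtain ⟨j, rfl⟩ := e.surjective y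
  simp only [Equiv.trans_apply, Equiv.symm_apply_apply, f, Equiv.ofBijective_apply]
  rcases lt_trichotomy i j with hij | rfl | hij
  · rw [K.adj_comm, key j i hij, G.adj_comm]
  · simp
  · exact key i j hij

end SimpleGraph

namespace SimpleGraph

variable {V : Type*} {G : SimpleGraph V}

/-- Distinct vertices `i < j` with rows `s`, `r` are adjacent or have a common neighbour, and have
different neighbours. -/
def diameterTwoCompat (i s _j r : ℕ) : Bool :=
  !Nat.beq r s && (r.testBit i || !Nat.beq (r &&& s) 0)

/-- The rows of the vertices of degree three in a graph on eight vertices. -/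
def cubicRows : List ℕ :=
    [7, 11, 13, 14, 19, 21, 22, 25, 26, 28, 35, 37, 38, 41, 42, 44, 49, 50, 52, 56, 67, 69, 70,
     73, 74, 76, 81, 82, 84, 88, 97, 98, 100, 104, 112, 131, 133, 134, 137, 138, 140, 145, 146,
     148, 152, 161, 162, 164, 168, 176, 193, 194, 196, 200, 208, 224]

/-- The rows of the complement of the square of an 8-cycle. -/
def wagnerRows : List ℕ :=
    [56, 112, 224, 193, 131, 7, 14, 28]

lemma searchRows_wagner :
    searchRows diameterTwoCompat cubicRows (fun l => [wagnerRows].any fun T =>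
      searchIso T 8 l.reverse []) 7 [14] := by
  decide +kernel

end SimpleGraph

namespace SimpleGraph

variable {V : Type*} {G : SimpleGraph V}

lemma exists_equiv_of_nodup {n : ℕ} (hcard : Nat.card V = n) (hn : n ≠ 0) {l : List V}
    (hl : l.Nodup) : ∃ e : Fin n ≃ V, ∀ i (hi : i < l.length) (hi' : i < n), e ⟨i, hi'⟩ = l[i] := by
  have := Nat.finite_of_card_ne_zero (hcard.trans_ne hn)
  have := Fintype.ofFinite V
  classical
  cases l with
  | nil => exact ⟨(Finite.equivFinOfCardEq hcard).symm, by simp⟩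
  | cons v l =>
    have hinj : Set.InjOn (fun i : Fin n => (v :: l).getD i v)
        {i | (i : ℕ) < (v :: l).length} := by
      intro i hi j hj hij
      simp only [Set.mem_ofPred_eq] at hi hj
      simp only [List.getD_eq_getElem _ _ hi, List.getD_eq_getElem _ _ hj] at hij
      exact Fin.ext ((hl.getElem_inj_iff).mp hij)
    obtain ⟨g, hg⟩ := Set.MapsTo.exists_equiv_extend_of_card_eq (t := Finset.univ)
      (by simp [← hcard]) (by simp) hinj
    refine ⟨g.trans (Equiv.subtypeUnivEquiv (by simp)), fun i hi hi' => ?_⟩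
    rw [Equiv.trans_apply, Equiv.subtypeUnivEquiv_apply, hg ⟨i, hi'⟩ hi]
    exact List.getD_eq_getElem _ _ hi

lemma _root_.FourConnected.compl_degree_add_six_le [Fintype V] [DecidableEq V] [DecidableRel G.Adj]
    (hG : FourConnected G) {u v w : V} (huv : u ≠ v) (huw : Gᶜ.Adj u w)
    (h : ∀ w, Gᶜ.Adj u w ↔ Gᶜ.Adj v w) : Gᶜ.degree u + 6 ≤ Fintype.card V := by
  have hvu : ¬ Gᶜ.Adj u v := fun hv => Gᶜ.loopless.irrefl v ((h v).mp hv)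
  have h4 := hG.four_le (Q := {u, v}) (R := Finset.univ \ ({u, v} ∪ Gᶜ.neighborFinset u)) (w := w)
    (by simp) ?_ ?_ ?_ ?_
  · rw [Finset.card_sdiff_of_subset (Finset.subset_univ _), Finset.card_union_of_disjoint,
      Finset.card_pair huv, card_neighborFinset_eq_degree, Finset.card_univ] at h4
    · omega
    · simpa using hvu
  · rw [Finset.disjoint_left]
    simp
  · simp only [Finset.mem_insert, Finset.mem_singleton, Finset.mem_sdiff, Finset.mem_univ,
      Finset.mem_union, mem_neighborFinset, true_and]
    rintro q (rfl | rfl) x hx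
    · have : ¬ Gᶜ.Adj q x := by simp [hx]
      tauto
    · have : ¬ Gᶜ.Adj q x := by simp [hx]
      rw [← h] at this
      tauto
  · have := (h w).mp huw
    simpa using ⟨huw.ne', this.ne'⟩
  · simpa using fun _ _ => (compl_adj _ _ _).mp huw

end SimpleGraph

namespace SimpleGraph

variable {V : Type*} {G : SimpleGraph V}

lemma row_eq {n : ℕ} (M : SimpleGraph (Fin n)) [DecidableRel M.Adj] (i : Fin n) :
    M.row i = Nat.ofBits fun j => decide (M.Adj i j) := by
  simp [row]

lemma row_ne {n : ℕ} {M : SimpleGraph (Fin n)} {i j : Fin n}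
    (h : ∃ k, ¬ (M.Adj i k ↔ M.Adj j k)) : M.row i ≠ M.row j := by
  obtain ⟨k, hk⟩ := h
  intro h
  rw [← testBit_row, ← testBit_row, h] at hk
  exact hk Iff.rfl

lemma row_and_ne {n : ℕ} {M : SimpleGraph (Fin n)} {i j k : Fin n} (hi : M.Adj i k)
    (hj : M.Adj j k) : M.row i &&& M.row j ≠ 0 := by
  intro h
  rw [← testBit_row] at hi hj
  have : (M.row i &&& M.row j).testBit k := by rw [Nat.testBit_and, hi, hj]; rfl
  simp [h] at this

lemma compl_degree_eq_three [Fintype V] [DecidableEq V] [DecidableRel G.Adj]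
    (hG : FourConnected G) (hcard : Fintype.card V = 8)
    (hdiam : ∀ u v, G.Adj u v → ∃ w, Gᶜ.Adj u w ∧ Gᶜ.Adj v w) (v : V) : Gᶜ.degree v = 3 := by
  have hle : ∀ v, Gᶜ.degree v ≤ 3 := by
    intro v
    have := hG.four_le_degree (by omega) v
    rw [degree_compl]
    omega
  have hcover : (Finset.univ : Finset V) ⊆ insert v (Gᶜ.neighborFinset v) ∪
      (Gᶜ.neighborFinset v).biUnion fun w => (Gᶜ.neighborFinset w).erase v := by
    intro u _
    by_cases huv : u = v
    · simp [huv]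
    · by_cases h : Gᶜ.Adj v u
      · simp [h]
      · obtain ⟨w, hw, hw'⟩ := hdiam v u (by simpa [Ne.symm huv] using h)
        simp only [Finset.mem_union, Finset.mem_biUnion, Finset.mem_erase, mem_neighborFinset]
        exact .inr ⟨w, hw, huv, hw'.symm⟩
  have h1 := (Finset.card_le_card hcover).trans (Finset.card_union_le _ _)
  have h2 := Finset.card_insert_le v (Gᶜ.neighborFinset v)
  have h3 : ((Gᶜ.neighborFinset v).biUnion fun w => (Gᶜ.neighborFinset w).erase v).card ≤
      (Gᶜ.neighborFinset v).card * 2 := by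
    refine Finset.card_biUnion_le_card_mul _ _ _ fun w hw => ?_
    rw [Finset.card_erase_of_mem (by simpa [Gᶜ.adj_comm] using hw), card_neighborFinset_eq_degree]
    have := hle w
    omega
  rw [card_neighborFinset_eq_degree] at h2 h3
  rw [Finset.card_univ] at h1
  have := hle v
  omega

lemma isComplRows_cycleSq_eight : IsComplRows 8 wagnerRows (cycleSq 8) :=
  ⟨![0, 1, 2, 3, 4, 5, 6, 7], by decide +kernel, by decide +kernel⟩

lemma nonempty_iso_cycleSq_of_card_eight (hG : FourConnected G) (hcard : Nat.card V = 8)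
    (hW : ¬ (wheel 6).IsMinorOf G) : Nonempty (G ≃g cycleSq 8) := by
  classical
  have := hG.finite
  have := Fintype.ofFinite V
  have hcard' : Fintype.card V = 8 := by rwa [← Nat.card_eq_fintype_card]
  have hdiam : ∀ u v, G.Adj u v → ∃ w, Gᶜ.Adj u w ∧ Gᶜ.Adj v w := by
    intro u v huv
    by_contra! hno
    refine hW (wheel_isMinorOf_of_card_eight hG hcard huv fun w hwu hwv => ?_)
    have := hno w
    simp only [compl_adj] at this
    tauto
  have hdeg := compl_degree_eq_three hG hcard' hdiam
  have hne : ∀ u v, u ≠ v → ∃ k, ¬ (Gᶜ.Adj u k ↔ Gᶜ.Adj v k) := by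
    intro u v huv
    by_contra! hno
    obtain ⟨w, hw⟩ := (Gᶜ.degree_pos_iff_exists_adj u).mp (by rw [hdeg]; norm_num)
    have := hG.compl_degree_add_six_le huv hw hno
    have := hdeg u
    omega
  obtain ⟨v⟩ : Nonempty V := Fintype.card_pos_iff.mp (by omega)
  obtain ⟨a, b, c, hab, hac, hbc, hv⟩ := Finset.card_eq_three.mp
    ((Gᶜ.card_neighborFinset_eq_degree v).trans (hdeg v))
  have hva : ∀ w, Gᶜ.Adj v w ↔ w = a ∨ w = b ∨ w = c := by
    intro w
    rw [← mem_neighborFinset, hv]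
    simp
  have hnd : [v, a, b, c].Nodup := by
    have h1 := (hva a).mpr (by simp)
    have h2 := (hva b).mpr (by simp)
    have h3 := (hva c).mpr (by simp)
    simp [hab, hac, hbc, h1.ne, h2.ne, h3.ne]
  obtain ⟨e, he⟩ := exists_equiv_of_nodup hcard (by norm_num) hnd
  obtain rfl : e 0 = v := he 0 (by simp) (by simp)
  obtain rfl : e 1 = a := he 1 (by simp) (by simp)
  obtain rfl : e 2 = b := he 2 (by simp) (by simp)
  obtain rfl : e 3 = c := he 3 (by simp) (by simp)
  have hrow0 : (Gᶜ.comap e).row 0 = 14 := by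
    have := (Gᶜ.comap e).row_eq 0
    simp only [comap_adj, hva, e.injective.eq_iff] at this
    refine this.trans ?_
    decide +kernel
  have hrows : ∀ i : Fin 8, (Gᶜ.comap e).row i ∈ cubicRows := by
    intro i
    have key : ∀ f : Fin 8 → Bool, (Finset.univ.filter fun j => f j = true).card = 3 →
      Nat.ofBits f ∈ cubicRows := by decide +kernel
    rw [row_eq]
    refine key _ ?_
    rw [← hdeg (e i), ← card_neighborFinset_eq_degree]
    exact Finset.card_bijective e e.bijective (by simp)
  have hcompat : ∀ i j : Fin 8, i < j →
      diameterTwoCompat i ((Gᶜ.comap e).row i) j ((Gᶜ.comap e).row j) := by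
    intro i j hij
    have h1 := row_ne (M := Gᶜ.comap e) (i := j) (j := i) <| by
      obtain ⟨k, hk⟩ := hne (e j) (e i) (e.injective.ne hij.ne')
      exact ⟨e.symm k, by simpa using hk⟩
    have h2 : ((Gᶜ.comap e).row j).testBit i ∨ (Gᶜ.comap e).row j &&& (Gᶜ.comap e).row i ≠ 0 := by
      rw [testBit_row, comap_adj]
      by_cases hadj : G.Adj (e j) (e i)
      · obtain ⟨w, hj, hi⟩ := hdiam _ _ hadj
        exact .inr (row_and_ne (k := e.symm w) (by simpa using hj) (by simpa using hi))
      · exact .inl (by simpa [e.injective.ne hij.ne'] using hadj)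
    simpa only [diameterTwoCompat, Bool.and_eq_true, Bool.or_eq_true, Bool.not_eq_true',
      ← Bool.not_eq_true, Nat.beq_eq] using And.intro h1 h2
  obtain ⟨T, hT, g, hg, h⟩ := exists_of_searchRows (Gᶜ.comap e) hrows hcompat 1 (by norm_num)
    (by rw [initialRows, initialRows, hrow0]; exact searchRows_wagner)
  obtain rfl := List.mem_singleton.mp hT
  refine isComplRows_cycleSq_eight.nonempty_iso e hg fun i j hij => ?_
  rw [← h i j hij]
  simp [e.injective.ne hij.ne']

end SimpleGraph

namespace SimpleGraph

variable {V : Type*} {G : SimpleGraph V}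

instance (n : ℕ) : DecidableRel (doubleWheel n).Adj := fun a b =>
  match a, b with
  | .inl i, .inl j => inferInstanceAs (Decidable (Sum.inl i ≠ Sum.inl j ∧ (j = i + 1 ∨ i = j + 1)))
  | .inl i, .inr j => inferInstanceAs (Decidable (Sum.inl i ≠ Sum.inr j ∧ (True ∨ True)))
  | .inr i, .inl j => inferInstanceAs (Decidable (Sum.inr i ≠ Sum.inl j ∧ (True ∨ True)))
  | .inr i, .inr j => inferInstanceAs (Decidable (Sum.inr i ≠ Sum.inr j ∧ (False ∨ False)))

instance (n : ℕ) : DecidableRel (doubleWheelPlus n).Adj := fun a b =>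
  match a, b with
  | .inl i, .inl j => inferInstanceAs (Decidable (Sum.inl i ≠ Sum.inl j ∧ (j = i + 1 ∨ i = j + 1)))
  | .inl i, .inr j => inferInstanceAs (Decidable (Sum.inl i ≠ Sum.inr j ∧ (True ∨ True)))
  | .inr i, .inl j => inferInstanceAs (Decidable (Sum.inr i ≠ Sum.inl j ∧ (True ∨ True)))
  | .inr i, .inr j => inferInstanceAs (Decidable (Sum.inr i ≠ Sum.inr j ∧ (True ∨ True)))

instance : DecidableRel K43_30.Adj := fun a b =>
  match a, b with
  | .inl i, .inl j => inferInstanceAs (Decidable (Sum.inl i ≠ Sum.inl j ∧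
      ((j : ℕ) = i + 1 ∨ (i : ℕ) = j + 1)))
  | .inl i, .inr j => inferInstanceAs (Decidable (Sum.inl i ≠ Sum.inr j ∧ (True ∨ True)))
  | .inr i, .inl j => inferInstanceAs (Decidable (Sum.inr i ≠ Sum.inl j ∧ (True ∨ True)))
  | .inr i, .inr j => inferInstanceAs (Decidable (Sum.inr i ≠ Sum.inr j ∧ (False ∨ False)))

instance : DecidableRel K43_31.Adj := fun a b =>
  match a, b with
  | .inl i, .inl j => inferInstanceAs (Decidable (Sum.inl i ≠ Sum.inl j ∧
      ((j : ℕ) = i + 1 ∨ (i : ℕ) = j + 1)))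
  | .inl i, .inr j => inferInstanceAs (Decidable (Sum.inl i ≠ Sum.inr j ∧ (True ∨ True)))
  | .inr i, .inl j => inferInstanceAs (Decidable (Sum.inr i ≠ Sum.inl j ∧ (True ∨ True)))
  | .inr i, .inr j => inferInstanceAs (Decidable (Sum.inr i ≠ Sum.inr j ∧
      (i = 0 ∧ j = 1 ∨ j = 0 ∧ i = 1)))

instance : DecidableRel K43_40.Adj := fun a b =>
  match a, b with
  | .inl i, .inl j => inferInstanceAs (Decidable (Sum.inl i ≠ Sum.inl j ∧ (j = i + 1 ∨ i = j + 1)))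
  | .inl i, .inr j => inferInstanceAs (Decidable (Sum.inl i ≠ Sum.inr j ∧ (True ∨ True)))
  | .inr i, .inl j => inferInstanceAs (Decidable (Sum.inr i ≠ Sum.inl j ∧ (True ∨ True)))
  | .inr i, .inr j => inferInstanceAs (Decidable (Sum.inr i ≠ Sum.inr j ∧ (False ∨ False)))

instance : DecidableRel K43_41.Adj := fun a b =>
  match a, b with
  | .inl i, .inl j => inferInstanceAs (Decidable (Sum.inl i ≠ Sum.inl j ∧ (j = i + 1 ∨ i = j + 1)))
  | .inl i, .inr j => inferInstanceAs (Decidable (Sum.inl i ≠ Sum.inr j ∧ (True ∨ True)))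
  | .inr i, .inl j => inferInstanceAs (Decidable (Sum.inr i ≠ Sum.inl j ∧ (True ∨ True)))
  | .inr i, .inr j => inferInstanceAs (Decidable (Sum.inr i ≠ Sum.inr j ∧
      (i = 0 ∧ j = 1 ∨ j = 0 ∧ i = 1)))

instance : DecidableRel cycleSq7PlusE.Adj := fun a b =>
  inferInstanceAs (Decidable (a ≠ b ∧ (_ ∨ _)))

instance : DecidableRel K6.Adj := inferInstanceAs (DecidableRel (⊤ : SimpleGraph (Fin 6)).Adj)

instance : DecidableRel K6e.Adj := fun a b =>
  decidable_of_iff (a ≠ b ∧ s(a, b) ≠ s(0, 1)) (by simp [K6e])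

instance : DecidableRel Gamma1.Adj := fun a b =>
  inferInstanceAs (Decidable (s(a, b) ∈ _ ∧ a ≠ b))

/-- The rows of the complements of the listed graphs on six vertices. -/
def rowsSix : List (List ℕ) :=
  [[8, 16, 32, 1, 2, 4], [4, 8, 1, 2, 0, 0], [2, 1, 0, 0, 0, 0], [0, 0, 0, 0, 0, 0]]

/-- The rows of the complements of the listed graphs on seven vertices. -/
def rowsSeven : List (List ℕ) :=
  [[24, 48, 96, 65, 3, 6, 12], [16, 48, 96, 64, 3, 6, 12], [12, 24, 17, 3, 6, 64, 32],
    [12, 8, 1, 3, 96, 80, 48], [12, 8, 1, 3, 64, 64, 48], [4, 8, 1, 2, 96, 80, 48],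
    [72, 40, 16, 3, 4, 2, 1], [4, 8, 1, 2, 64, 64, 48]]

lemma isComplRows_cycleSq_six : IsComplRows 6 [8, 16, 32, 1, 2, 4] (cycleSq 6) :=
  ⟨![0, 1, 2, 3, 4, 5], by decide +kernel, by decide +kernel⟩

lemma isComplRows_doubleWheelPlus : IsComplRows 6 [4, 8, 1, 2, 0, 0] (doubleWheelPlus 4) :=
  ⟨![.inl 0, .inl 1, .inl 2, .inl 3, .inr 0, .inr 1], by decide +kernel, by decide +kernel⟩

lemma isComplRows_K6e : IsComplRows 6 [2, 1, 0, 0, 0, 0] K6e :=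
  ⟨![0, 1, 2, 3, 4, 5], by decide +kernel, by decide +kernel⟩

lemma isComplRows_K6 : IsComplRows 6 [0, 0, 0, 0, 0, 0] K6 :=
  ⟨![0, 1, 2, 3, 4, 5], by decide +kernel, by decide +kernel⟩

lemma isComplRows_cycleSq_seven : IsComplRows 7 [24, 48, 96, 65, 3, 6, 12] (cycleSq 7) :=
  ⟨![0, 1, 2, 3, 4, 5, 6], by decide +kernel, by decide +kernel⟩

lemma isComplRows_cycleSq7PlusE : IsComplRows 7 [16, 48, 96, 64, 3, 6, 12] cycleSq7PlusE :=
  ⟨![0, 1, 2, 3, 4, 5, 6], by decide +kernel, by decide +kernel⟩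

lemma isComplRows_doubleWheel : IsComplRows 7 [12, 24, 17, 3, 6, 64, 32] (doubleWheel 5) :=
  ⟨![.inl 0, .inl 1, .inl 2, .inl 3, .inl 4, .inr 0, .inr 1], by decide +kernel, by decide +kernel⟩

lemma isComplRows_K43_30 : IsComplRows 7 [12, 8, 1, 3, 96, 80, 48] K43_30 :=
  ⟨![.inl 0, .inl 1, .inl 2, .inl 3, .inr 0, .inr 1, .inr 2], by decide +kernel, by decide +kernel⟩

lemma isComplRows_K43_31 : IsComplRows 7 [12, 8, 1, 3, 64, 64, 48] K43_31 :=
  ⟨![.inl 0, .inl 1, .inl 2, .inl 3, .inr 0, .inr 1, .inr 2], by decide +kernel, by decide +kernel⟩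

lemma isComplRows_K43_40 : IsComplRows 7 [4, 8, 1, 2, 96, 80, 48] K43_40 :=
  ⟨![.inl 0, .inl 1, .inl 2, .inl 3, .inr 0, .inr 1, .inr 2], by decide +kernel, by decide +kernel⟩

lemma isComplRows_K43_41 : IsComplRows 7 [4, 8, 1, 2, 64, 64, 48] K43_41 :=
  ⟨![.inl 0, .inl 1, .inl 2, .inl 3, .inr 0, .inr 1, .inr 2], by decide +kernel, by decide +kernel⟩

lemma isComplRows_Gamma1 : IsComplRows 7 [72, 40, 16, 3, 4, 2, 1] Gamma1 :=
  ⟨![0, 1, 2, 3, 4, 5, 6], by decide +kernel, by decide +kernel⟩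

/-- Rows `s`, `r` are different or have a single digit one. -/
def twinCompat (_i s _j r : ℕ) : Bool :=
  !Nat.beq r s || atMostOneBit r

lemma searchRows_six :
    searchRows (fun _ _ _ _ => true) [0, 1, 2, 4, 8, 16, 32] (fun l => rowsSix.any fun T =>
      searchIso T 6 l.reverse []) 6 [] := by
  decide +kernel

end SimpleGraph

namespace SimpleGraph

variable {V : Type*} {G : SimpleGraph V}

/-- The rows of the vertices of degree two in a graph on seven vertices. -/
def degreeTwoRows : List ℕ :=
  [3, 5, 6, 9, 10, 12, 17, 18, 20, 24, 33, 34, 36, 40, 48, 65, 66, 68, 72, 80, 96]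

lemma searchRows_seven_of_degree_one :
    searchRows twinCompat ([1, 2, 4, 8, 16, 32, 64] ++ degreeTwoRows) (fun l =>
      rowsSeven.any fun T => searchIso T 7 l.reverse []) 6 [2] := by
  decide +kernel

lemma searchRows_seven_of_degree_two :
    searchRows twinCompat degreeTwoRows (fun l =>
      rowsSeven.any fun T => searchIso T 7 l.reverse []) 6 [6] := by
  decide +kernel

end SimpleGraph

namespace SimpleGraph

variable {V : Type*} {G : SimpleGraph V}

lemma ofBits_mem_of_card_le_one (f : Fin 6 → Bool)
    (h : (Finset.univ.filter fun j => f j = true).card ≤ 1) :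
    Nat.ofBits f ∈ [0, 1, 2, 4, 8, 16, 32] := by
  revert f
  decide +kernel

lemma ofBits_mem_of_card_eq_one (f : Fin 7 → Bool)
    (h : (Finset.univ.filter fun j => f j = true).card = 1) :
    Nat.ofBits f ∈ [1, 2, 4, 8, 16, 32, 64] := by
  revert f
  decide +kernel

lemma ofBits_mem_of_card_eq_two (f : Fin 7 → Bool)
    (h : (Finset.univ.filter fun j => f j = true).card = 2) : Nat.ofBits f ∈ degreeTwoRows := by
  revert f
  decide +kernel

lemma atMostOneBit_of_mem {r : ℕ} (h : r ∈ [1, 2, 4, 8, 16, 32, 64]) : atMostOneBit r := by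
  revert r
  decide +kernel

lemma card_filter_comap_adj [Fintype V] {n : ℕ} (e : Fin n ≃ V) (H : SimpleGraph V)
    [DecidableRel H.Adj] (i : Fin n) :
    (Finset.univ.filter fun j => decide ((H.comap e).Adj i j) = true).card = H.degree (e i) := by
  rw [← card_neighborFinset_eq_degree]
  exact Finset.card_bijective e e.bijective (by simp)

lemma nonempty_iso_cycleSq_of_card_five (hG : FourConnected G) (hcard : Nat.card V = 5) :
    Nonempty (G ≃g cycleSq 5) := by
  classical
  have := hG.finite
  have := Fintype.ofFinite V
  have hcard' : Fintype.card V = 5 := by rwa [← Nat.card_eq_fintype_card]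
  have hadj : ∀ u v, u ≠ v → G.Adj u v := by
    intro u v huv
    by_contra hno
    have h4 := hG.four_le (Q := {u}) (R := Finset.univ \ {u, v}) (w := v) (by simp) (by simp)
      (by
        rintro q hq x hx
        obtain rfl := Finset.mem_singleton.mp hq
        have : x ≠ v := by rintro rfl; exact hno hx
        simpa [hx.ne'] using this)
      (by simpa using huv.symm) (by simp)
    rw [Finset.card_sdiff_of_subset (Finset.subset_univ _), Finset.card_pair huv,
      Finset.card_univ] at h4
    omega
  have hcomplete : ∀ a b : ZMod 5, a ≠ b → (cycleSq 5).Adj a b := by decide +kernel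
  let e : V ≃ ZMod 5 := Finite.equivFinOfCardEq hcard
  exact ⟨⟨e, fun {a b} => ⟨fun h => hadj a b (ne_of_apply_ne e h.ne),
    fun h => hcomplete _ _ (e.injective.ne h.ne)⟩⟩⟩

lemma nonempty_iso_of_card_six (hG : FourConnected G) (hcard : Nat.card V = 6) :
    Nonempty (G ≃g cycleSq 6) ∨ Nonempty (G ≃g doubleWheelPlus 4) ∨ Nonempty (G ≃g K6e) ∨
      Nonempty (G ≃g K6) := by
  classical
  have := hG.finite
  have := Fintype.ofFinite V
  have hcard' : Fintype.card V = 6 := by rwa [← Nat.card_eq_fintype_card]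
  let e : Fin 6 ≃ V := (Finite.equivFinOfCardEq hcard).symm
  have hrows : ∀ i : Fin 6, (Gᶜ.comap e).row i ∈ [0, 1, 2, 4, 8, 16, 32] := by
    intro i
    rw [row_eq]
    refine ofBits_mem_of_card_le_one _ ?_
    rw [card_filter_comap_adj, degree_compl]
    have := hG.four_le_degree hcard'.ge (e i)
    omega
  obtain ⟨T, hT, g, hg, h⟩ := exists_of_searchRows (Gᶜ.comap e) hrows (by simp) 0 (by norm_num)
    searchRows_six
  have h : ∀ i, ∀ j < i, ¬ G.Adj (e i) (e j) ↔ (T.getD (g i) 0).testBit (g j) :=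
    fun i j hij => by rw [← h i j hij]; simp [e.injective.ne hij.ne']
  simp only [rowsSix, List.mem_cons, List.not_mem_nil, or_false] at hT
  rcases hT with rfl | rfl | rfl | rfl
  · exact .inl (isComplRows_cycleSq_six.nonempty_iso e hg h)
  · exact .inr (.inl (isComplRows_doubleWheelPlus.nonempty_iso e hg h))
  · exact .inr (.inr (.inl (isComplRows_K6e.nonempty_iso e hg h)))
  · exact .inr (.inr (.inr (isComplRows_K6.nonempty_iso e hg h)))

lemma exists_rowsSeven (hG : FourConnected G) (hcard : Nat.card V = 7)
    (hW : ¬ (wheel 6).IsMinorOf G) : ∃ T ∈ rowsSeven, ∃ e : Fin 7 ≃ V, ∃ g : Fin 7 → Fin 7,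
      Function.Injective g ∧
        ∀ i, ∀ j < i, ¬ G.Adj (e i) (e j) ↔ (T.getD (g i) 0).testBit (g j) := by
  classical
  have := hG.finite
  have := Fintype.ofFinite V
  have hcard' : Fintype.card V = 7 := by rwa [← Nat.card_eq_fintype_card]
  have hdeg : ∀ v, Gᶜ.degree v = 1 ∨ Gᶜ.degree v = 2 := by
    intro v
    have h1 : Gᶜ.degree v ≤ 2 := by
      rw [degree_compl]
      have := hG.four_le_degree (by omega) v
      omega
    have h2 : 0 < Gᶜ.degree v := by
      rw [degree_pos_iff_exists_adj]
      by_contra! hno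
      refine hW (wheel_isMinorOf_of_card_seven hG hcard (v := v) fun w hw => ?_)
      simpa [hw.symm] using hno w
    omega
  have hrow1 : ∀ (e : Fin 7 ≃ V) (i : Fin 7), Gᶜ.degree (e i) = 1 →
      (Gᶜ.comap e).row i ∈ [1, 2, 4, 8, 16, 32, 64] := by
    intro e i hi
    rw [row_eq]
    exact ofBits_mem_of_card_eq_one _ (by rwa [card_filter_comap_adj])
  have hrow2 : ∀ (e : Fin 7 ≃ V) (i : Fin 7), Gᶜ.degree (e i) = 2 →
      (Gᶜ.comap e).row i ∈ degreeTwoRows := by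
    intro e i hi
    rw [row_eq]
    exact ofBits_mem_of_card_eq_two _ (by rwa [card_filter_comap_adj])
  have hcompat : ∀ (e : Fin 7 ≃ V) (i j : Fin 7), i < j →
      twinCompat i ((Gᶜ.comap e).row i) j ((Gᶜ.comap e).row j) := by
    intro e i j hij
    have h : (Gᶜ.comap e).row j ≠ (Gᶜ.comap e).row i ∨ atMostOneBit ((Gᶜ.comap e).row j) := by
      refine (hdeg (e j)).symm.imp (fun hj => row_ne ?_)
        fun hj => atMostOneBit_of_mem (hrow1 e j hj)
      by_contra! hno
      obtain ⟨w, hw⟩ := (Gᶜ.degree_pos_iff_exists_adj (e j)).mp (by omega)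
      have := hG.compl_degree_add_six_le (e.injective.ne hij.ne') hw fun w => by
        simpa using hno (e.symm w)
      omega
    simpa only [twinCompat, Bool.or_eq_true, Bool.not_eq_true', ← Bool.not_eq_true,
      Nat.beq_eq] using h
  suffices h : ∃ e : Fin 7 ≃ V, ∃ T ∈ rowsSeven, ∃ g : Fin 7 → Fin 7, Function.Injective g ∧
      ∀ i, ∀ j < i, (Gᶜ.comap e).Adj i j ↔ (T.getD (g i) 0).testBit (g j) by
    obtain ⟨e, T, hT, g, hg, h⟩ := h
    refine ⟨T, hT, e, g, hg, fun i j hij => ?_⟩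
    rw [← h i j hij]
    simp [e.injective.ne hij.ne']
  by_cases hone : ∃ v, Gᶜ.degree v = 1
  · obtain ⟨v, hv⟩ := hone
    obtain ⟨a, ha⟩ := Finset.card_eq_one.mp ((Gᶜ.card_neighborFinset_eq_degree v).trans hv)
    have hva : ∀ w, Gᶜ.Adj v w ↔ w = a := by
      intro w
      rw [← mem_neighborFinset, ha, Finset.mem_singleton]
    obtain ⟨e, he⟩ := exists_equiv_of_nodup (l := [v, a]) hcard (by norm_num)
      (by simpa using ((hva a).mpr rfl).ne)
    obtain rfl : e 0 = v := he 0 (by simp) (by simp)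
    obtain rfl : e 1 = a := he 1 (by simp) (by simp)
    have hrow0 : (Gᶜ.comap e).row 0 = 2 := by
      have := (Gᶜ.comap e).row_eq 0
      simp only [comap_adj, hva, e.injective.eq_iff] at this
      refine this.trans ?_
      decide +kernel
    refine ⟨e, exists_of_searchRows _ (fun i => List.mem_append.mpr
      ((hdeg (e i)).imp (hrow1 e i) (hrow2 e i))) (hcompat e) 1 (by norm_num) ?_⟩
    rw [initialRows, initialRows, hrow0]
    exact searchRows_seven_of_degree_one
  · have htwo : ∀ v, Gᶜ.degree v = 2 := fun v => (hdeg v).resolve_left fun h => hone ⟨v, h⟩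
    obtain ⟨v⟩ : Nonempty V := Fintype.card_pos_iff.mp (by omega)
    obtain ⟨a, b, hab, hv⟩ := Finset.card_eq_two.mp
      ((Gᶜ.card_neighborFinset_eq_degree v).trans (htwo v))
    have hva : ∀ w, Gᶜ.Adj v w ↔ w = a ∨ w = b := by
      intro w
      rw [← mem_neighborFinset, hv, Finset.mem_insert, Finset.mem_singleton]
    obtain ⟨e, he⟩ := exists_equiv_of_nodup (l := [v, a, b]) hcard (by norm_num)
      (by simp [hab, ((hva a).mpr (.inl rfl)).ne, ((hva b).mpr (.inr rfl)).ne])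
    obtain rfl : e 0 = v := he 0 (by simp) (by simp)
    obtain rfl : e 1 = a := he 1 (by simp) (by simp)
    obtain rfl : e 2 = b := he 2 (by simp) (by simp)
    have hrow0 : (Gᶜ.comap e).row 0 = 6 := by
      have := (Gᶜ.comap e).row_eq 0
      simp only [comap_adj, hva, e.injective.eq_iff] at this
      refine this.trans ?_
      decide +kernel
    refine ⟨e, exists_of_searchRows _ (fun i => hrow2 e i (htwo _)) (hcompat e) 1
      (by norm_num) ?_⟩
    rw [initialRows, initialRows, hrow0]
    exact searchRows_seven_of_degree_two

lemma nonempty_iso_of_card_seven (hG : FourConnected G) (hcard : Nat.card V = 7)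
    (hW : ¬ (wheel 6).IsMinorOf G) : Nonempty (G ≃g cycleSq 7) ∨ Nonempty (G ≃g cycleSq7PlusE) ∨
      Nonempty (G ≃g doubleWheel 5) ∨ Nonempty (G ≃g K43_30) ∨ Nonempty (G ≃g K43_31) ∨
      Nonempty (G ≃g K43_40) ∨ Nonempty (G ≃g Gamma1) ∨ Nonempty (G ≃g K43_41) := by
  obtain ⟨T, hT, e, g, hg, h⟩ := exists_rowsSeven hG hcard hW
  simp only [rowsSeven, List.mem_cons, List.not_mem_nil, or_false] at hT
  rcases hT with rfl | rfl | rfl | rfl | rfl | rfl | rfl | rfl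
  · exact .inl (isComplRows_cycleSq_seven.nonempty_iso e hg h)
  · exact .inr (.inl (isComplRows_cycleSq7PlusE.nonempty_iso e hg h))
  · exact .inr (.inr (.inl (isComplRows_doubleWheel.nonempty_iso e hg h)))
  · exact .inr (.inr (.inr (.inl (isComplRows_K43_30.nonempty_iso e hg h))))
  · exact .inr (.inr (.inr (.inr (.inl (isComplRows_K43_31.nonempty_iso e hg h)))))
  · exact .inr (.inr (.inr (.inr (.inr (.inl (isComplRows_K43_40.nonempty_iso e hg h))))))
  · exact .inr (.inr (.inr (.inr (.inr (.inr (.inl (isComplRows_Gamma1.nonempty_iso e hg h)))))))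
  · exact .inr (.inr (.inr (.inr (.inr (.inr (.inr (isComplRows_K43_41.nonempty_iso e hg h)))))))

end SimpleGraph

namespace SimpleGraph

variable {V : Type*} {G : SimpleGraph V}

lemma degree_or_dominating_edge_of_wheel_isMinorOf [Fintype V] [DecidableEq V]
    [DecidableRel G.Adj] (hcard : Fintype.card V ≤ 8) (h : (wheel 6).IsMinorOf G) :
    (∃ u, 6 ≤ G.degree u) ∨ Fintype.card V = 8 ∧
      ∃ u v, G.Adj u v ∧ ∀ w, w ≠ u → w ≠ v → G.Adj u w ∨ G.Adj v w := by
  classical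
  obtain ⟨φ, hne, hconn, hdisj, hadj⟩ := h
  have hhub : ∀ i : ZMod 6, ∃ a ∈ φ none, ∃ b ∈ φ (some i), G.Adj a b := fun i =>
    hadj (by simp [wheel])
  choose a ha s hs has using hhub
  have hsinj : Function.Injective s := by
    intro i j hij
    by_contra hne
    exact Set.disjoint_left.mp (hdisj fun h => hne (Option.some_injective _ h)) (hs i)
      (hij ▸ hs j)
  have hcs : (Finset.univ.image s).card = 6 := by
    rw [Finset.card_image_of_injective _ hsinj]
    rfl
  have hHs : Disjoint (φ none).toFinset (Finset.univ.image s) := by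
    rw [Finset.disjoint_left]
    intro v hv hv'
    obtain ⟨i, -, rfl⟩ := Finset.mem_image.mp hv'
    exact Set.disjoint_left.mp (hdisj (Option.some_ne_none i).symm) (Set.mem_toFinset.mp hv)
      (hs i)
  have hle := Finset.card_le_univ ((φ none).toFinset ∪ Finset.univ.image s)
  have hpos : 0 < (φ none).toFinset.card := Finset.card_pos.mpr (Set.toFinset_nonempty.mpr (hne none))
  rw [Finset.card_union_of_disjoint hHs, hcs] at hle
  obtain hH | hH : (φ none).toFinset.card = 1 ∨ (φ none).toFinset.card = 2 := by omega
  · left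
    obtain ⟨u, hu⟩ := Finset.card_eq_one.mp hH
    refine ⟨u, ?_⟩
    rw [← hcs, ← card_neighborFinset_eq_degree]
    refine Finset.card_le_card fun w hw => ?_
    obtain ⟨i, -, rfl⟩ := Finset.mem_image.mp hw
    obtain rfl : a i = u := by rw [← Finset.mem_singleton, ← hu]; simpa using ha i
    simpa using has i
  · right
    obtain ⟨u, v, huv, hH2⟩ := Finset.card_eq_two.mp hH
    have hmem : ∀ w, w ∈ φ none ↔ w = u ∨ w = v := by
      intro w
      rw [← Set.mem_toFinset, hH2, Finset.mem_insert, Finset.mem_singleton]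
    refine ⟨by omega, u, v, ?_, fun w hwu hwv => ?_⟩
    · by_contra hno
      refine huv.symm (mem_of_conn_closed (A := {u}) (hconn none) ?_ rfl ((hmem u).mpr (.inl rfl))
        ((hmem v).mpr (.inr rfl)))
      rintro _ rfl - b hb hab
      rcases (hmem b).mp hb with rfl | rfl
      · rfl
      · exact absurd hab hno
    · have huniv : (φ none).toFinset ∪ Finset.univ.image s = Finset.univ := by
        refine Finset.eq_univ_of_card _ ?_
        rw [Finset.card_union_of_disjoint hHs, hcs]
        omega
      have hw : w ∈ (φ none).toFinset ∪ Finset.univ.image s := huniv ▸ Finset.mem_univ w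
      rw [hH2] at hw
      obtain ⟨i, rfl⟩ : ∃ i, s i = w := by simpa [hwu, hwv] using hw
      rcases (hmem _).mp (ha i) with hi | hi
      · exact .inl (hi ▸ has i)
      · exact .inr (hi ▸ has i)

lemma not_wheel_isMinorOf_of_degree_lt_six [Fintype V] [DecidableEq V] [DecidableRel G.Adj]
    (hcard : Fintype.card V ≤ 7) (hdeg : ∀ v, G.degree v < 6) : ¬ (wheel 6).IsMinorOf G := by
  intro h
  rcases degree_or_dominating_edge_of_wheel_isMinorOf (by omega) h with ⟨u, hu⟩ | ⟨h8, -⟩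
  · have := hdeg u
    omega
  · omega

lemma not_wheel_isMinorOf_cycleSq {n : ℕ} (h5 : 5 ≤ n) (h8 : n ≤ 8) :
    ¬ (wheel 6).IsMinorOf (cycleSq n) := by
  interval_cases n
  · exact not_wheel_isMinorOf_of_degree_lt_six (by decide) (by decide +kernel)
  · exact not_wheel_isMinorOf_of_degree_lt_six (by decide) (by decide +kernel)
  · exact not_wheel_isMinorOf_of_degree_lt_six (by decide) (by decide +kernel)
  · intro h
    rcases degree_or_dominating_edge_of_wheel_isMinorOf (by decide) h with h | ⟨-, h⟩
    · revert h
      decide +kernel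
    · revert h
      decide +kernel

lemma Iso.wheel_isMinorOf {W : Type*} {K : SimpleGraph W} (e : G ≃g K)
    (h : (wheel 6).IsMinorOf G) : (wheel 6).IsMinorOf K :=
  h.of_injective_hom e e.injective fun _ _ => e.map_rel_iff.mpr

end SimpleGraph

theorem stmt0 {V : Type*} (G : SimpleGraph V) (hG : FourConnected G) :
    ¬ (wheel 6).IsMinorOf G ↔
      ((∃ n : ℕ, 5 ≤ n ∧ n ≤ 8 ∧ Nonempty (G ≃g cycleSq n)) ∨
        Nonempty (G ≃g doubleWheelPlus 4) ∨ Nonempty (G ≃g K6e) ∨ Nonempty (G ≃g K6) ∨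
        Nonempty (G ≃g cycleSq7PlusE) ∨ Nonempty (G ≃g doubleWheel 5) ∨
        Nonempty (G ≃g K43_30) ∨ Nonempty (G ≃g K43_31) ∨ Nonempty (G ≃g K43_40) ∨
        Nonempty (G ≃g Gamma1) ∨ Nonempty (G ≃g K43_41)) := by
  constructor
  · intro hW
    have h5 := hG.1
    have h8 : Nat.card V ≤ 8 := by
      by_contra! h9
      exact hW (wheel_isMinorOf_of_nine_le
        (fun _ hG hcard hW => nonempty_iso_cycleSq_of_card_eight hG hcard hW) G hG h9)
    interval_cases hcard : Nat.card V
    · exact .inl ⟨5, by norm_num, by norm_num, nonempty_iso_cycleSq_of_card_five hG hcard⟩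
    · rcases nonempty_iso_of_card_six hG hcard with h | h
      · exact .inl ⟨6, by norm_num, by norm_num, h⟩
      · tauto
    · rcases nonempty_iso_of_card_seven hG hcard hW with h | h
      · exact .inl ⟨7, by norm_num, by norm_num, h⟩
      · tauto
    · exact .inl ⟨8, by norm_num, by norm_num, nonempty_iso_cycleSq_of_card_eight hG hcard hW⟩
  · intro h hW
    obtain ⟨n, h5, h8, ⟨e⟩⟩ | ⟨⟨e⟩⟩ | ⟨⟨e⟩⟩ | ⟨⟨e⟩⟩ | ⟨⟨e⟩⟩ | ⟨⟨e⟩⟩ | ⟨⟨e⟩⟩ | ⟨⟨e⟩⟩ | ⟨⟨e⟩⟩ | ⟨⟨e⟩⟩ |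
      ⟨⟨e⟩⟩ := h
    · exact not_wheel_isMinorOf_cycleSq h5 h8 (e.wheel_isMinorOf hW)
    all_goals
      exact not_wheel_isMinorOf_of_degree_lt_six (by decide) (by decide +kernel)
        (e.wheel_isMinorOf hW)
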